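/- Halting Problem Theorem: the halting problems h = {p ∈ ℕ : φ_p(0) halts} (viewed as a set of reals via the identification of naturals with reals) and H = {(p,x) : p ∈ ℕ, x ∈ 2^ℕ, φ_p(x) halts} (viewed as a set of reals via the pair coding) are both infinite time semi-decidable, but neither is infinite time decidable. -/

import Mathlib

open scoped Classical

namespace ITTM

/-- A real is an element of Cantor space. -/
abbrev R := ℕ → Bool

/-- The constant-zero real. -/
def zeroR : R := fun _ => false

/-- The real ⟨1,0,0,...⟩ coding the answer "Yes". -/
def oneR : R := fun n => decide (n = 0)

/-- The real coding a natural number `p`: `p` ones followed by zeros. -/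
def natR (p : ℕ) : R := fun n => decide (n < p)

/-- The real coding the pair of reals `(y, z)`. -/
def pairR (y z : R) : R := fun n => if n % 2 = 0 then y (n / 2) else z (n / 2)

/-- A snapshot of an infinite time Turing machine computation with state set
`Fin (Q+1)`: the current state, the head position, and the contents of the
three tapes (tape 0 is the input tape, tape 1 the scratch tape, tape 2 the
output tape); cells hold values in `Bool` (`true` = 1, `false` = 0). -/
structure Snapshot (Q : ℕ) where
  state : Fin (Q + 1)
  head : ℕ
  tape : Fin 3 → ℕ → Bool

/-- An infinite time Turing machine program: a finite set of states
`Fin (Q+1)` with distinguished start, limit and halt states, and a finite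
transition table which, given the current state and the three cell values
read by the head, specifies the next state, the three values to write, and
the direction to move (`true` = right, `false` = left). -/
structure Machine where
  Q : ℕ
  start : Fin (Q + 1)
  limit : Fin (Q + 1)
  halt : Fin (Q + 1)
  trans : Fin (Q + 1) × (Fin 3 → Bool) → Fin (Q + 1) × (Fin 3 → Bool) × Bool

instance : Inhabited Machine := ⟨⟨0, 0, 0, 0, fun _ => (0, fun _ => false, true)⟩⟩

namespace Machine

/-- The initial snapshot on input `x`: head on cell 0 in the start state, `x`
on the input tape, the other tapes filled with zeros. -/
def init (M : Machine) (x : R) : Snapshot M.Q where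
  state := M.start
  head := 0
  tape := fun i n => if i = 0 then x n else false

/-- One step of computation applied to a snapshot. -/
def stepSnap (M : Machine) (s : Snapshot M.Q) : Snapshot M.Q :=
  let t := M.trans (s.state, fun i => s.tape i s.head)
  { state := t.1
    head := if t.2.2 then s.head + 1 else s.head - 1
    tape := fun i n => if n = s.head then t.2.1 i else s.tape i n }

/-- The snapshot of the computation of machine `M` on input `x` at ordinal
stage `α`, defined by transfinite recursion: at stage 0 the initial snapshot,
at successor stages the transition table is applied, and at limit stages the
head is on cell 0 in the limit state and each cell holds the `limsup` of its
earlier values (1 iff its value was 1 cofinally often below the limit). -/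
noncomputable def snap (M : Machine) (x : R) : Ordinal.{0} → Snapshot M.Q :=
  WellFounded.fix Ordinal.lt_wf fun α ih =>
    if _h0 : α = 0 then M.init x
    else if hs : ∃ β, β < α ∧ α = β + 1 then
      M.stepSnap (ih hs.choose hs.choose_spec.1)
    else
      { state := M.limit
        head := 0
        tape := fun i n =>
          decide (∀ β < α, ∃ γ, β ≤ γ ∧ ∃ hγ : γ < α, (ih γ hγ).tape i n = true) }

/-- The machine is in the halt state at stage `α`. -/
def haltedAt (M : Machine) (x : R) (α : Ordinal) : Prop :=
  (M.snap x α).state = M.halt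

/-- The computation of `M` on input `x` halts exactly at stage `α`: stage `α`
is the first stage at which the machine is in the halt state. -/
def haltsAt (M : Machine) (x : R) (α : Ordinal) : Prop :=
  M.haltedAt x α ∧ ∀ β < α, ¬ M.haltedAt x β

/-- The computation of `M` on input `x` halts. -/
def halts (M : Machine) (x : R) : Prop := ∃ α, M.haltedAt x α

/-- The computation of `M` on input `x` halts with output `y`: at the first
stage at which the machine is in the halt state, the output tape reads `y`. -/
def outputs (M : Machine) (x y : R) : Prop :=
  ∃ α, M.haltsAt x α ∧ (M.snap x α).tape 2 = y

end Machine

/-- Machines are coded by natural numbers. -/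
noncomputable instance : Encodable Machine :=
  Encodable.ofEquiv
    (Σ Q : ℕ, (Fin (Q + 1) × Fin (Q + 1) × Fin (Q + 1)) ×
      ((Fin (Q + 1) × (Fin 3 → Bool)) → Fin (Q + 1) × (Fin 3 → Bool) × Bool))
    { toFun := fun M => ⟨M.Q, (M.start, M.limit, M.halt), M.trans⟩
      invFun := fun s => ⟨s.1, s.2.1.1, s.2.1.2.1, s.2.1.2.2, s.2.2⟩
      left_inv := fun _ => rfl
      right_inv := fun _ => rfl }

/-- The machine coded by the natural number `p`; every natural number codes a
machine, and every machine is coded by some natural number. -/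
noncomputable def prog (p : ℕ) : Machine :=
  ((Encodable.decode p : Option Machine)).getD default

/-- `φ_p(x)` halts with output `y`. -/
noncomputable def phiOutputs (p : ℕ) (x y : R) : Prop := (prog p).outputs x y

/-- A set of reals is infinite time decidable when some machine, on any input
`x`, halts with output ⟨1,0,0,...⟩ if `x ∈ A` and output ⟨0,0,0,...⟩ if
`x ∉ A`. -/
def ITTMDecidable (A : Set R) : Prop :=
  ∃ M : Machine, ∀ x : R, (x ∈ A → M.outputs x oneR) ∧ (x ∉ A → M.outputs x zeroR)

/-- A set of reals is infinite time semi-decidable when it is the halting set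
of some machine. -/
def ITTMSemiDecidable (A : Set R) : Prop :=
  ∃ M : Machine, A = {x : R | M.halts x}

/-- The binary relation on ℕ coded by the real `x`:
`n ◁ k ⟺ x(⟨n,k⟩) = 1` where `⟨·,·⟩` is the pairing function. -/
def rel (x : R) (n k : ℕ) : Prop := x (Nat.pair n k) = true

/-- The field of the relation coded by `x`. -/
def field (x : R) : Set ℕ := {n | ∃ k, rel x n k ∨ rel x k n}

/-- The relation coded by `x`, restricted to its field. -/
def relOn (x : R) : field x → field x → Prop := fun a b => rel x a.1 b.1

/-- The real `x` codes a well-order of (a subset of) ℕ, namely its field. -/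
def codesWellOrder (x : R) : Prop := IsWellOrder (field x) (relOn x)

/-- The set of reals coding well-orders. -/
def WO : Set R := {x | codesWellOrder x}

/-- The real `x` codes a well-order of order type `α`. -/
def codesOrdinal (x : R) (α : Ordinal) : Prop :=
  ∃ h : codesWellOrder x, @Ordinal.type _ (relOn x) h = α

/-- An ordinal is clockable when some machine on input 0 halts exactly at
stage `α`. -/
def Clockable (α : Ordinal) : Prop := ∃ M : Machine, M.haltsAt zeroR α

/-- A real is writable when it is the output of some machine on input 0. -/
def WritableReal (x : R) : Prop := ∃ M : Machine, M.outputs zeroR x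

/-- An ordinal is writable when some writable real codes a well-order of that
order type. -/
def WritableOrdinal (α : Ordinal) : Prop :=
  ∃ x : R, WritableReal x ∧ codesOrdinal x α

/-- A real is eventually writable when some machine on input 0 never halts,
but from some stage onward the content of its output tape is exactly `x`. -/
def EventuallyWritableReal (x : R) : Prop :=
  ∃ M : Machine, ¬ M.halts zeroR ∧ ∃ α : Ordinal, ∀ β ≥ α, (M.snap zeroR β).tape 2 = x

/-- An ordinal is eventually writable when some eventually writable real codes
a well-order of that order type. -/
def EventuallyWritableOrdinal (α : Ordinal) : Prop :=
  ∃ x : R, EventuallyWritableReal x ∧ codesOrdinal x α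

end ITTM

/-- The lightface halting problem `h = {p ∈ ℕ : φ_p(0) halts}`, viewed as a
set of reals via the identification of a natural number with a real. -/
def haltSet : Set ITTM.R :=
  {w | ∃ p : ℕ, w = ITTM.natR p ∧ (ITTM.prog p).halts ITTM.zeroR}

/-- The boldface halting problem `H = {(p,x) : φ_p(x) halts}`, viewed as a
set of reals via the pair coding. -/
def HaltSet : Set ITTM.R :=
  {w | ∃ (p : ℕ) (x : ITTM.R), w = ITTM.pairR (ITTM.natR p) x ∧ (ITTM.prog p).halts x}

namespace ITTM

open Order

/-- A transfinite dynamical system: a control state together with a family of binary cells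
indexed by `X`, a successor rule, and the control state entered at limit stages (where every
cell takes the `limsup` of its earlier values). -/
structure Sys (S X : Type) where
  next : S × (X → Bool) → S × (X → Bool)
  lim : S

namespace Sys

variable {S X S' X' : Type}

/-- The configuration at a given ordinal stage when starting from `c`. -/
noncomputable def run (A : Sys S X) (c : S × (X → Bool)) (α : Ordinal.{0}) : S × (X → Bool) :=
  Ordinal.limitRecOn α c (fun _ d => A.next d) fun α _ ih =>
    (A.lim, fun x => decide (∀ β < α, ∃ γ, β ≤ γ ∧ ∃ hγ : γ < α, (ih γ hγ).2 x = true))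

variable (A : Sys S X) (B : Sys S' X') (c : S × (X → Bool))

@[simp] theorem run_zero : A.run c 0 = c := by simp [run]

theorem run_add_one (α : Ordinal) : A.run c (α + 1) = A.next (A.run c α) := by simp [run]

theorem run_limit {α : Ordinal} (h : IsSuccLimit α) :
    A.run c α =
      (A.lim, fun x => decide (∀ β < α, ∃ γ, β ≤ γ ∧ γ < α ∧ (A.run c γ).2 x = true)) := by
  rw [run, Ordinal.limitRecOn_limit (h := h)]
  refine Prod.ext rfl (funext fun x => ?_)
  rw [Bool.eq_iff_iff]
  simp only [run, exists_prop, decide_eq_true_eq]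
  exact decide_eq_true_iff.symm

theorem run_limit_fst {α : Ordinal} (h : IsSuccLimit α) : (A.run c α).1 = A.lim := by
  rw [run_limit A c h]

theorem run_limit_snd {α : Ordinal} (h : IsSuccLimit α) (x : X) :
    (A.run c α).2 x = true ↔ ∀ β < α, ∃ γ, β ≤ γ ∧ γ < α ∧ (A.run c γ).2 x = true := by
  rw [run_limit A c h]; simp

theorem run_add (α β : Ordinal) : A.run c (α + β) = A.run (A.run c α) β := by
  induction β using Ordinal.limitRecOn with
  | zero => simp
  | add_one β ih => rw [← add_assoc, run_add_one, run_add_one, ih]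
  | limit β hβ ih =>
    have hl : IsSuccLimit (α + β) := Ordinal.isSuccLimit_add α hβ
    refine Prod.ext ?_ (funext fun x => ?_)
    · rw [run_limit_fst _ _ hl, run_limit_fst _ _ hβ]
    · rw [Bool.eq_iff_iff, run_limit_snd _ _ hl, run_limit_snd _ _ hβ]
      constructor
      · intro h γ hγ
        obtain ⟨δ, h1, h2, h3⟩ := h (α + γ) (by simpa using hγ)
        obtain ⟨ε, rfl⟩ := exists_add_of_le ((le_self_add).trans h1)
        have hε : ε < β := by simpa using h2
        exact ⟨ε, by simpa using h1, hε, by rwa [← ih ε hε]⟩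
      · intro h γ hγ
        obtain ⟨δ, h1, h2, h3⟩ := h (γ - α) (by
          rcases le_total α γ with h | h
          · rw [← add_lt_add_iff_left α, Ordinal.add_sub_cancel_of_le h]; exact hγ
          · rw [Ordinal.sub_eq_zero_iff_le.2 h]; exact hβ.bot_lt)
        exact ⟨α + δ, by rwa [← Ordinal.sub_le], by simpa using h2, by rwa [ih δ h2]⟩

theorem run_nat (n : ℕ) : A.run c n = A.next^[n] c := by
  induction n with
  | zero => simp
  | succ n ih => rw [Nat.cast_succ, run_add_one, ih, Function.iterate_succ_apply']

/-- A cell whose value is constant below a limit stage keeps that value at the limit. -/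
theorem run_limit_const {α : Ordinal} (h : IsSuccLimit α) {x : X} {v : Bool} {β : Ordinal}
    (hβ : β < α) (hv : ∀ γ, β ≤ γ → γ < α → (A.run c γ).2 x = v) : (A.run c α).2 x = v := by
  cases v
  · rw [← Bool.not_eq_true, run_limit_snd _ _ h]
    intro H
    obtain ⟨γ, h1, h2, h3⟩ := H β hβ
    simp [hv γ h1 h2] at h3
  · rw [run_limit_snd _ _ h]
    intro δ hδ
    exact ⟨max β δ, le_max_right _ _, max_lt hβ hδ, hv _ (le_max_left _ _) (max_lt hβ hδ)⟩

/-- A step of `A` made from a configuration satisfying `Good`. -/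
def GoodStep (Good : S × (X → Bool) → Prop) (b b' : S × (X → Bool)) : Prop :=
  Good b ∧ A.next b = b'

variable {A B c}

theorem GoodStep.exists_iterate {Good : S × (X → Bool) → Prop} {b b' : S × (X → Bool)}
    (h : Relation.ReflTransGen (A.GoodStep Good) b b') :
    ∃ n : ℕ, A.next^[n] b = b' ∧ ∀ k < n, Good (A.next^[k] b) := by
  induction h with
  | refl => exact ⟨0, rfl, by simp⟩
  | tail _ h ih =>
    obtain ⟨n, rfl, h2⟩ := ih
    refine ⟨n + 1, by rw [Function.iterate_succ_apply']; exact h.2, fun k hk => ?_⟩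
    rcases Nat.lt_succ_iff_lt_or_eq.1 hk with h' | rfl
    · exact h2 k h'
    · exact h.1

theorem GoodStep.exists_iterate_pos {Good : S × (X → Bool) → Prop} {b b' : S × (X → Bool)}
    (h : Relation.TransGen (A.GoodStep Good) b b') :
    ∃ n : ℕ, 0 < n ∧ A.next^[n] b = b' ∧ ∀ k < n, Good (A.next^[k] b) := by
  obtain ⟨d, h1, h2⟩ := Relation.TransGen.head'_iff.1 h
  obtain ⟨n, h3, h4⟩ := GoodStep.exists_iterate h2
  obtain ⟨h5, rfl⟩ := h1
  refine ⟨n + 1, by omega, h3, fun k hk => ?_⟩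
  cases k with
  | zero => exact h5
  | succ k => exact h4 k (by omega)

theorem GoodStep.chain {r : S × (X → Bool) → S × (X → Bool) → Prop} (f : ℕ → S × (X → Bool)) (n : ℕ)
    (h : ∀ k < n, r (f k) (f (k + 1))) : Relation.ReflTransGen r (f 0) (f n) := by
  induction n with
  | zero => exact .refl
  | succ n ih => exact (ih fun k hk => h k (by omega)).tail (h n (by omega))

/-- A chain of good steps, seen as a transfinite run of finite length. -/
theorem GoodStep.exists_run {Good : S × (X → Bool) → Prop} {b b' : S × (X → Bool)}
    (h : Relation.ReflTransGen (A.GoodStep Good) b b') :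
    ∃ n : ℕ, A.run b n = b' ∧ ∀ ξ < (n : Ordinal), Good (A.run b ξ) := by
  obtain ⟨n, h1, h2⟩ := GoodStep.exists_iterate h
  refine ⟨n, by rw [run_nat, h1], fun ξ hξ => ?_⟩
  obtain ⟨k, rfl⟩ := Ordinal.lt_omega0.1 (hξ.trans (Ordinal.natCast_lt_omega0 n))
  rw [run_nat]
  exact h2 k (by exact_mod_cast hξ)

/-- Data showing that `B` simulates `A`. Cell `x` of `A` is stored in cell `ι x` of `B`; the cells
in `Z` keep the constant values `v`; the cells in `P` hold `1` whenever `B` represents a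
configuration of `A`. -/
structure Simulation (A : Sys S X) (B : Sys S' X') (hA : S → Prop) (hB : S' → Prop)
    (Rel : S × (X → Bool) → S' × (X' → Bool) → Prop) (ι : X → X') (Z : Set X') (v : X' → Bool)
    (P : Set X') : Prop where
  tape : ∀ a b, Rel a b → ∀ x, b.2 (ι x) = a.2 x
  flag : ∀ a b, Rel a b → ∀ y ∈ P, b.2 y = true
  step : ∀ a b, Rel a b → ¬ hA a.1 → ∃ b', Rel (A.next a) b' ∧
    Relation.TransGen (B.GoodStep fun d => ¬ hB d.1 ∧
      (∀ x, d.2 (ι x) = a.2 x ∨ d.2 (ι x) = (A.next a).2 x) ∧ ∀ z ∈ Z, d.2 z = v z) b b'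
  limit : ∀ (T : X → Bool) (T' : X' → Bool), (∀ x, T' (ι x) = T x) → (∀ z ∈ Z, T' z = v z) →
    (∀ y ∈ P, T' y = true) → ∃ δ : Ordinal, Rel (A.lim, T) (B.run (B.lim, T') δ) ∧
      ∀ ξ < δ, ¬ hB (B.run (B.lim, T') ξ).1 ∧ (∀ x, (B.run (B.lim, T') ξ).2 (ι x) = T x) ∧
        ∀ z ∈ Z, (B.run (B.lim, T') ξ).2 z = v z

/-- The clock translation built from the lengths of the simulating segments. -/
noncomputable def clock (N D : Ordinal.{0} → Ordinal.{0} → Ordinal.{0}) (α : Ordinal.{0}) :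
    Ordinal.{0} :=
  Ordinal.limitRecOn α 0 (fun β f => f + N β f) fun α _ ih =>
    (⨆ β : Set.Iio α, ih β.1 β.2) + D α (⨆ β : Set.Iio α, ih β.1 β.2)

section Clock

variable {N D : Ordinal.{0} → Ordinal.{0} → Ordinal.{0}}

@[simp] theorem clock_zero : clock N D 0 = 0 := by simp [clock]

theorem clock_add_one (α : Ordinal) : clock N D (α + 1) = clock N D α + N α (clock N D α) := by
  simp [clock]

theorem clock_limit {α : Ordinal} (h : IsSuccLimit α) : clock N D α =
    (⨆ β : Set.Iio α, clock N D β) + D α (⨆ β : Set.Iio α, clock N D β) := by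
  rw [clock, Ordinal.limitRecOn_limit (h := h)]; simp [clock]

theorem clock_strictMono (hN : ∀ α β, 0 < N α β) : StrictMono (clock N D) := by
  have key : ∀ α, ∀ β < α, clock N D β < clock N D α := by
    intro α
    induction α using Ordinal.limitRecOn with
    | zero => intro β hβ; simp at hβ
    | add_one α ih =>
      intro β hβ
      rw [clock_add_one]
      have h2 : clock N D α < clock N D α + N α (clock N D α) := by simpa using hN _ _
      rcases (lt_add_one_iff.1 hβ).lt_or_eq with h | rfl
      · exact (ih β h).trans h2
      · exact h2
    | limit α hα ih =>
      intro β hβ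
      have hβ' : β + 1 < α := hα.add_one_lt hβ
      rw [clock_limit hα]
      exact ((ih _ hβ' β (lt_add_one β)).trans_le
        (Ordinal.le_iSup (fun β : Set.Iio α => clock N D β) ⟨β + 1, hβ'⟩)).trans_le le_self_add
  exact fun β α h => key α β h

theorem isSuccLimit_iSup_clock (hN : ∀ α β, 0 < N α β) {α : Ordinal} (h : IsSuccLimit α) :
    IsSuccLimit (⨆ β : Set.Iio α, clock N D β) := by
  have hm := clock_strictMono (D := D) hN
  have hlt : ∀ ξ < ⨆ β : Set.Iio α, clock N D β, ξ + 1 < ⨆ β : Set.Iio α, clock N D β := by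
    intro ξ hξ
    obtain ⟨⟨β, hβ⟩, h1⟩ := Ordinal.lt_iSup_iff.1 hξ
    refine Ordinal.lt_iSup_iff.2 ⟨⟨β + 1, h.add_one_lt hβ⟩, ?_⟩
    exact (add_one_le_of_lt h1).trans_lt (hm (lt_add_one β))
  rw [Ordinal.isSuccLimit_iff]
  refine ⟨fun h0 => ?_, isSuccPrelimit_of_succ_lt fun a ha => by simpa using hlt a ha⟩
  have h1 : clock N D 0 < clock N D 1 := hm zero_lt_one
  have h2 := Ordinal.le_iSup (fun β : Set.Iio α => clock N D β)
    ⟨1, by simpa using h.add_one_lt h.bot_lt⟩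
  rw [h0] at h2
  exact absurd (h1.trans_le h2) (by simp)

end Clock

variable {hA : S → Prop} {hB : S' → Prop} {Rel : S × (X → Bool) → S' × (X' → Bool) → Prop}
  {ι : X → X'} {Z : Set X'} {v : X' → Bool} {P : Set X'}

theorem Simulation.exists_clock (H : Simulation A B hA hB Rel ι Z v P) {a : S × (X → Bool)}
    {b : S' × (X' → Bool)} (h0 : Rel a b) :
    ∃ f : Ordinal.{0} → Ordinal.{0}, StrictMono f ∧
      ∀ α, (∀ β < α, ¬ hA (A.run a β).1) → Rel (A.run a α) (B.run b (f α)) ∧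
        ∀ ξ < f α, ¬ hB (B.run b ξ).1 := by
  let okN (α ζ n : Ordinal.{0}) : Prop := 0 < n ∧ Rel (A.run a (α + 1)) (B.run b (ζ + n)) ∧
    ∀ ξ < n, ¬ hB (B.run b (ζ + ξ)).1 ∧ (∀ x, (B.run b (ζ + ξ)).2 (ι x) = (A.run a α).2 x ∨
      (B.run b (ζ + ξ)).2 (ι x) = (A.run a (α + 1)).2 x) ∧ ∀ z ∈ Z, (B.run b (ζ + ξ)).2 z = v z
  let okD (α ζ δ : Ordinal.{0}) : Prop := Rel (A.run a α) (B.run b (ζ + δ)) ∧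
    ∀ ξ < δ, ¬ hB (B.run b (ζ + ξ)).1 ∧ (∀ x, (B.run b (ζ + ξ)).2 (ι x) = (A.run a α).2 x) ∧
      ∀ z ∈ Z, (B.run b (ζ + ξ)).2 z = v z
  let N (α ζ : Ordinal.{0}) : Ordinal.{0} := if h : ∃ n, okN α ζ n then h.choose else 1
  let D (α ζ : Ordinal.{0}) : Ordinal.{0} := if h : ∃ δ, okD α ζ δ then h.choose else 0
  have hN : ∀ α ζ, 0 < N α ζ := by
    intro α ζ
    by_cases h : ∃ n, okN α ζ n
    · simp only [N, dif_pos h]; exact h.choose_spec.1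
    · simp only [N, dif_neg h]; exact zero_lt_one
  have hm : StrictMono (clock N D) := clock_strictMono hN
  have key : ∀ α, (∀ β < α, ¬ hA (A.run a β).1) → Rel (A.run a α) (B.run b (clock N D α)) ∧
      (∀ ξ < clock N D α, ¬ hB (B.run b ξ).1 ∧ ∀ z ∈ Z, (B.run b ξ).2 z = v z) ∧
      ∀ β < α, ∀ ξ, clock N D β ≤ ξ → ξ < clock N D α → ∀ x, ∃ γ, β ≤ γ ∧ γ ≤ α ∧
        (B.run b ξ).2 (ι x) = (A.run a γ).2 x := by
    intro α
    induction α using Ordinal.limitRecOn with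
    | zero => exact fun _ => ⟨by simpa using h0, by simp, by simp⟩
    | add_one α ih =>
      intro hα
      obtain ⟨r1, r2, r3⟩ := ih fun β hβ => hα β (hβ.trans (lt_add_one α))
      have hex : ∃ n, okN α (clock N D α) n := by
        obtain ⟨b', h1, h2⟩ := H.step _ _ r1 (hα α (lt_add_one α))
        obtain ⟨n, h3, h4, h5⟩ := GoodStep.exists_iterate_pos h2
        refine ⟨n, by exact_mod_cast h3, ?_, fun ξ hξ => ?_⟩
        · rw [run_add_one, run_add, run_nat, h4]; exact h1
        · obtain ⟨k, rfl⟩ := Ordinal.lt_omega0.1 (hξ.trans (Ordinal.natCast_lt_omega0 n))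
          rw [run_add, run_nat, run_add_one]
          exact h5 k (by exact_mod_cast hξ)
      have hs : okN α (clock N D α) (N α (clock N D α)) := by
        simp only [N, dif_pos hex]; exact hex.choose_spec
      rw [clock_add_one]
      obtain ⟨-, s1, s2⟩ := hs
      have s3 : ∀ ξ, clock N D α ≤ ξ → ξ < clock N D α + N α (clock N D α) →
          ∃ ζ < N α (clock N D α), ξ = clock N D α + ζ := by
        intro ξ h1 h2
        obtain ⟨ζ, rfl⟩ := exists_add_of_le h1
        exact ⟨ζ, by simpa using h2, rfl⟩
      refine ⟨s1, fun ξ hξ => ?_, fun β hβ ξ h1 h2 x => ?_⟩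
      · rcases lt_or_ge ξ (clock N D α) with h | h
        · exact r2 ξ h
        · obtain ⟨ζ, hζ, rfl⟩ := s3 ξ h hξ
          exact ⟨(s2 ζ hζ).1, (s2 ζ hζ).2.2⟩
      · have hβ' := lt_add_one_iff.1 hβ
        rcases lt_or_ge ξ (clock N D α) with h | h
        · rcases hβ'.lt_or_eq with h' | rfl
          · obtain ⟨γ, g1, g2, g3⟩ := r3 β h' ξ h1 h x
            exact ⟨γ, g1, g2.trans (lt_add_one α).le, g3⟩
          · exact absurd h h1.not_gt
        · obtain ⟨ζ, hζ, rfl⟩ := s3 ξ h h2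
          rcases (s2 ζ hζ).2.1 x with h' | h'
          · exact ⟨α, hβ', (lt_add_one α).le, h'⟩
          · exact ⟨α + 1, hβ.le, le_rfl, h'⟩
    | limit α hα ih =>
      intro hh
      have ih' := fun β hβ => ih β hβ fun γ hγ => hh γ (hγ.trans hβ)
      set σ := ⨆ β : Set.Iio α, clock N D β with hσ
      have hσl : IsSuccLimit σ := isSuccLimit_iSup_clock hN hα
      have hltσ : ∀ β < α, clock N D β < σ := fun β hβ =>
        (hm (lt_add_one β)).trans_le
          (Ordinal.le_iSup (fun β : Set.Iio α => clock N D β) ⟨β + 1, hα.add_one_lt hβ⟩)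
      have hex' : ∀ ξ < σ, ∃ β < α, ξ < clock N D β := by
        intro ξ hξ
        obtain ⟨⟨β, hβ⟩, h1⟩ := Ordinal.lt_iSup_iff.1 hξ
        exact ⟨β, hβ, h1⟩
      have q2 : ∀ ξ < σ, ¬ hB (B.run b ξ).1 ∧ ∀ z ∈ Z, (B.run b ξ).2 z = v z := by
        intro ξ hξ
        obtain ⟨β, hβ, h1⟩ := hex' ξ hξ
        exact (ih' β hβ).2.1 ξ h1
      have q3 : ∀ β < α, ∀ ξ, clock N D β ≤ ξ → ξ < σ → ∀ x, ∃ γ, β ≤ γ ∧ γ < α ∧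
          (B.run b ξ).2 (ι x) = (A.run a γ).2 x := by
        intro β hβ ξ h1 h2 x
        obtain ⟨β', hβ', h3⟩ := hex' ξ h2
        obtain ⟨γ, g1, g2, g3⟩ := (ih' β' hβ').2.2 β (hm.lt_iff_lt.1 (h1.trans_lt h3)) ξ h1 h3 x
        exact ⟨γ, g1, g2.trans_lt hβ', g3⟩
      have ht : ∀ x, (B.run b σ).2 (ι x) = (A.run a α).2 x := by
        intro x
        rw [Bool.eq_iff_iff, run_limit_snd _ _ hσl, run_limit_snd _ _ hα]
        constructor
        · intro h β hβ
          obtain ⟨ξ, h1, h2, h3⟩ := h _ (hltσ β hβ)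
          obtain ⟨γ, g1, g2, g3⟩ := q3 β hβ ξ h1 h2 x
          exact ⟨γ, g1, g2, g3 ▸ h3⟩
        · intro h ξ hξ
          obtain ⟨β, hβ, h1⟩ := hex' ξ hξ
          obtain ⟨γ, g1, g2, g3⟩ := h β hβ
          exact ⟨clock N D γ, h1.le.trans (hm.monotone g1), hltσ γ g2,
            (H.tape _ _ (ih' γ g2).1 x).trans g3⟩
      have hz : ∀ z ∈ Z, (B.run b σ).2 z = v z := fun z hz =>
        run_limit_const B b hσl hσl.bot_lt fun γ _ hγ => (q2 γ hγ).2 z hz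
      have hp : ∀ y ∈ P, (B.run b σ).2 y = true := by
        intro y hy
        rw [run_limit_snd _ _ hσl]
        intro ξ hξ
        obtain ⟨β, hβ, h1⟩ := hex' ξ hξ
        exact ⟨_, h1.le, hltσ β hβ, H.flag _ _ (ih' β hβ).1 y hy⟩
      have hs1 : B.run b σ = (B.lim, (B.run b σ).2) := Prod.ext (run_limit_fst _ _ hσl) rfl
      have hs2 : A.run a α = (A.lim, (A.run a α).2) := Prod.ext (run_limit_fst _ _ hα) rfl
      have hex : ∃ δ, okD α σ δ := by
        obtain ⟨δ, h1, h2⟩ := H.limit _ _ ht hz hp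
        rw [← hs1] at h1 h2
        rw [← hs2] at h1
        exact ⟨δ, by rwa [run_add], fun ξ hξ => by rw [run_add]; exact h2 ξ hξ⟩
      have hs : okD α σ (D α σ) := by
        simp only [D, dif_pos hex]; exact hex.choose_spec
      obtain ⟨s1, s2⟩ := hs
      rw [clock_limit hα, ← hσ]
      have s3 : ∀ ξ, σ ≤ ξ → ξ < σ + D α σ → ∃ ζ < D α σ, ξ = σ + ζ := by
        intro ξ h1 h2
        obtain ⟨ζ, rfl⟩ := exists_add_of_le h1
        exact ⟨ζ, by simpa using h2, rfl⟩
      refine ⟨s1, fun ξ hξ => ?_, fun β hβ ξ h1 h2 x => ?_⟩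
      · rcases lt_or_ge ξ σ with h | h
        · exact q2 ξ h
        · obtain ⟨ζ, hζ, rfl⟩ := s3 ξ h hξ
          exact ⟨(s2 ζ hζ).1, (s2 ζ hζ).2.2⟩
      · rcases lt_or_ge ξ σ with h | h
        · obtain ⟨γ, g1, g2, g3⟩ := q3 β hβ ξ h1 h x
          exact ⟨γ, g1, g2.le, g3⟩
        · obtain ⟨ζ, hζ, rfl⟩ := s3 ξ h h2
          exact ⟨α, hβ.le, le_rfl, (s2 ζ hζ).2.1 x⟩
  exact ⟨clock N D, hm, fun α hα => ⟨(key α hα).1, fun ξ hξ => ((key α hα).2.1 ξ hξ).1⟩⟩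

/-- `A` started at `a` is first in a state satisfying `hA` at stage `α`. -/
def FirstHit (A : Sys S X) (hA : S → Prop) (a : S × (X → Bool)) (α : Ordinal.{0}) : Prop :=
  hA (A.run a α).1 ∧ ∀ β < α, ¬ hA (A.run a β).1

theorem exists_firstHit {α : Ordinal.{0}} {a : S × (X → Bool)} (h : hA (A.run a α).1) :
    ∃ β, A.FirstHit hA a β := by
  induction α using WellFoundedLT.induction with
  | ind α ih =>
    by_cases hno : ∃ β < α, hA (A.run a β).1
    · obtain ⟨β, h1, h2⟩ := hno
      exact ih β h1 h2
    · push Not at hno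
      exact ⟨α, h, hno⟩

/-- `B` from `b` halts exactly when `A` from `a` does, and not earlier. -/
def Slower (A : Sys S X) (hA : S → Prop) (a : S × (X → Bool)) (B : Sys S' X') (hB : S' → Prop)
    (b : S' × (X' → Bool)) : Prop :=
  (∀ α, A.FirstHit hA a α → ∃ α', α ≤ α' ∧ B.FirstHit hB b α') ∧
    ((∀ α, ¬ hA (A.run a α).1) → ∀ α, ¬ hB (B.run b α).1)

/-- A simulation, entered after an initial segment of length `δ`, transfers halting. -/
theorem Simulation.slower (H : Simulation A B hA hB Rel ι Z v P) {a : S × (X → Bool)}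
    {b : S' × (X' → Bool)} {δ : Ordinal.{0}} (h0 : Rel a (B.run b δ))
    (hδ : ∀ ξ < δ, ¬ hB (B.run b ξ).1)
    (hh : ∀ a b, Rel a b → hA a.1 → ∃ b', hB b'.1 ∧
      Relation.ReflTransGen (B.GoodStep fun d => ¬ hB d.1) b b') : Slower A hA a B hB b := by
  obtain ⟨f, hm, hf⟩ := H.exists_clock h0
  have hpre : ∀ α, (∀ β < α, ¬ hA (A.run a β).1) → ∀ ξ < δ + f α, ¬ hB (B.run b ξ).1 := by
    intro α hα ξ hξ
    rcases lt_or_ge ξ δ with h | h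
    · exact hδ ξ h
    · obtain ⟨ζ, rfl⟩ := exists_add_of_le h
      rw [run_add]
      exact (hf α hα).2 ζ (by simpa using hξ)
  constructor
  · rintro α ⟨h1, h2⟩
    obtain ⟨b', h3, h4⟩ := hh _ _ (hf α h2).1 h1
    obtain ⟨n, rfl, h6⟩ := GoodStep.exists_run h4
    refine ⟨δ + f α + n, (hm.le_apply).trans (le_add_self.trans le_self_add), ?_, ?_⟩
    · rw [run_add, run_add]; exact h3
    · intro ξ hξ
      rcases lt_or_ge ξ (δ + f α) with h | h
      · exact hpre α h2 ξ h
      · obtain ⟨ζ, rfl⟩ := exists_add_of_le h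
        rw [run_add, run_add]
        exact h6 ζ (by simpa using hξ)
  · intro h α
    exact hpre (α + 1) (fun β _ => h β) α
      ((lt_add_one α).trans_le ((hm.le_apply).trans le_add_self))

theorem Slower.trans {S'' X'' : Type} {C : Sys S'' X''} {hC : S'' → Prop} {a : S × (X → Bool)}
    {b : S' × (X' → Bool)} {c : S'' × (X'' → Bool)} (h : Slower A hA a B hB b)
    (h' : Slower B hB b C hC c) : Slower A hA a C hC c := by
  refine ⟨fun α hα => ?_, fun hα => h'.2 (h.2 hα)⟩
  obtain ⟨β, h1, h2⟩ := h.1 α hα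
  obtain ⟨γ, h3, h4⟩ := h'.1 β h2
  exact ⟨γ, h1.trans h3, h4⟩

end Sys

/-- A one-head machine acting on tracks indexed by `κ`. -/
structure HM (σ κ : Type) where
  δ : σ → (κ → Bool) → σ × (κ → Bool) × Bool
  lim : σ

namespace HM

variable {σ σ' κ : Type}

/-- The transfinite system generated by a head machine. -/
def sys (M : HM σ κ) : Sys (σ × ℕ) (κ × ℕ) where
  next c :=
    let t := M.δ c.1.1 fun i => c.2 (i, c.1.2)
    ((t.1, if t.2.2 then c.1.2 + 1 else c.1.2 - 1),
      fun x => if x.2 = c.1.2 then t.2.1 x.1 else c.2 x)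
  lim := (M.lim, 0)

theorem sys_next (M : HM σ κ) (s : σ) (h : ℕ) (T : κ × ℕ → Bool) :
    M.sys.next ((s, h), T) = (((M.δ s fun i => T (i, h)).1,
      if (M.δ s fun i => T (i, h)).2.2 then h + 1 else h - 1),
      fun x => if x.2 = h then (M.δ s fun i => T (i, h)).2.1 x.1 else T x) := rfl

/-- The tape contents that carry input `x` on track `i₀`. -/
def inputTape [DecidableEq κ] (i₀ : κ) (x : R) : κ × ℕ → Bool := fun y =>
  if y.1 = i₀ then x y.2 else false

end HM

theorem Sys.run_map {S S' X : Type} {A : Sys S X} {B : Sys S' X} (g : S → S')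
    (hl : B.lim = g A.lim) (hn : ∀ s T, B.next (g s, T) = (g (A.next (s, T)).1, (A.next (s, T)).2))
    (s : S) (T : X → Bool) (α : Ordinal.{0}) :
    B.run (g s, T) α = (g (A.run (s, T) α).1, (A.run (s, T) α).2) := by
  induction α using Ordinal.limitRecOn with
  | zero => simp
  | add_one α ih => rw [run_add_one, run_add_one, ih, hn]
  | limit α hα ih =>
    refine Prod.ext ?_ (funext fun x => ?_)
    · simp only [run_limit_fst _ _ hα, hl]
    · rw [Bool.eq_iff_iff, run_limit_snd _ _ hα, run_limit_snd _ _ hα]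
      exact forall₂_congr fun β hβ => exists_congr fun γ =>
        and_congr_right fun _ => and_congr_right fun h => by rw [ih γ h]

namespace Machine

/-- A machine as a head machine with three tracks. -/
def toHM (M : Machine) : HM (Fin (M.Q + 1)) (Fin 3) := ⟨fun s b => M.trans (s, b), M.limit⟩

theorem snap_zero (M : Machine) (x : R) : M.snap x 0 = M.init x := by
  rw [snap, WellFounded.fix_eq]; simp

theorem snap_add_one (M : Machine) (x : R) (α : Ordinal) :
    M.snap x (α + 1) = M.stepSnap (M.snap x α) := by
  have hs : ∃ β, β < α + 1 ∧ α + 1 = β + 1 := ⟨α, lt_add_one α, rfl⟩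
  have h : hs.choose = α := by
    have := hs.choose_spec.2
    simpa using this.symm
  rw [snap, WellFounded.fix_eq, dif_neg (by simp), dif_pos hs]
  change M.stepSnap (M.snap x hs.choose) = _
  rw [h]; rfl

theorem snap_limit (M : Machine) (x : R) {α : Ordinal} (h : IsSuccLimit α) :
    M.snap x α = ⟨M.limit, 0, fun i n => decide (∀ β < α, ∃ γ, β ≤ γ ∧ ∃ _ : γ < α,
      (M.snap x γ).tape i n = true)⟩ := by
  rw [snap, WellFounded.fix_eq, dif_neg (by simpa using h.ne_bot), dif_neg]
  rintro ⟨β, h1, h2⟩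
  exact absurd (h.add_one_lt h1) (h2 ▸ lt_irrefl _)

theorem snap_eq_run (M : Machine) (x : R) (α : Ordinal) :
    (((M.snap x α).state, (M.snap x α).head), fun y : Fin 3 × ℕ => (M.snap x α).tape y.1 y.2) =
      M.toHM.sys.run ((M.start, 0), HM.inputTape 0 x) α := by
  induction α using Ordinal.limitRecOn with
  | zero => rw [snap_zero, Sys.run_zero]; rfl
  | add_one α ih => rw [snap_add_one, Sys.run_add_one, ← ih]; rfl
  | limit α hα ih =>
    refine Prod.ext ?_ (funext fun y => ?_)
    · rw [Sys.run_limit_fst _ _ hα, snap_limit _ _ hα]; rfl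
    · rw [Bool.eq_iff_iff, Sys.run_limit_snd _ _ hα, snap_limit _ _ hα]
      simp only [decide_eq_true_eq]
      exact forall₂_congr fun β hβ => exists_congr fun γ => and_congr_right fun _ => by
        rw [exists_prop]
        exact and_congr_right fun h => by rw [← ih γ h]

theorem haltedAt_iff (M : Machine) (x : R) (α : Ordinal) :
    M.haltedAt x α ↔ (M.toHM.sys.run ((M.start, 0), HM.inputTape 0 x) α).1.1 = M.halt := by
  rw [haltedAt, ← snap_eq_run]

end Machine

/-- A head machine with three tracks that stays within a finite set of states is, up to renaming
of the states, a `Machine`. -/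
theorem HM.exists_machine {σ : Type} (M : HM σ (Fin 3)) (start halt : σ) (F : Set σ)
    (hF : F.Finite) (hs : start ∈ F) (hl : M.lim ∈ F) (hh : halt ∈ F)
    (hc : ∀ s ∈ F, ∀ b, (M.δ s b).1 ∈ F) :
    ∃ N : Machine, ∀ x α, N.haltedAt x α ↔
      (M.sys.run ((start, 0), inputTape 0 x) α).1.1 = halt := by
  have : Fintype F := hF.fintype
  obtain ⟨Q, hQ⟩ : ∃ Q, Fintype.card F = Q + 1 :=
    Nat.exists_eq_succ_of_ne_zero (Fintype.card_pos_iff.2 ⟨⟨start, hs⟩⟩).ne'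
  let e : F ≃ Fin (Q + 1) := Fintype.equivFinOfCardEq hQ
  let M' : HM F (Fin 3) := ⟨fun s b => (⟨(M.δ s b).1, hc s s.2 b⟩, (M.δ s b).2), ⟨M.lim, hl⟩⟩
  let N : Machine := ⟨Q, e ⟨start, hs⟩, e ⟨M.lim, hl⟩, e ⟨halt, hh⟩,
    fun sb => (e (M'.δ (e.symm sb.1) sb.2).1, (M'.δ (e.symm sb.1) sb.2).2)⟩
  refine ⟨N, fun x α => ?_⟩
  rw [N.haltedAt_iff]
  have h1 := Sys.run_map (A := M'.sys) (B := N.toHM.sys) (fun s : F × ℕ => (e s.1, s.2)) rfl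
    (fun s T => by simp [sys, N, Machine.toHM]) (⟨start, hs⟩, 0) (inputTape 0 x) α
  have h2 := Sys.run_map (A := M'.sys) (B := M.sys) (fun s : F × ℕ => (s.1.1, s.2)) rfl
    (fun s T => rfl) (⟨start, hs⟩, 0) (inputTape 0 x) α
  have h3 : N.toHM.sys.run ((N.start, 0), inputTape 0 x) α = _ := h1
  have h4 : M.sys.run ((start, 0), inputTape 0 x) α = _ := h2
  rw [h3, h4]
  simp [N, Subtype.ext_iff]

end ITTM

namespace ITTM

open Order Relation

/-- States of the machine that stores `B` tracks per tape in blocks of `B` consecutive cells. -/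
inductive BlockState (σ β : Type)
  | rd (s : σ) (k : ℕ) (buf : β)
  | bk (s : σ) (k : ℕ) (buf : β)
  | wr (s : σ) (k : ℕ) (buf : β) (d : Bool)
  | lf (s : σ) (k : ℕ)

namespace HM

variable {σ : Type} {B : ℕ}

open BlockState

/-- The canonical block state representing `s`. -/
def blockCanon (B : ℕ) (s : σ) : BlockState σ (Fin 3 × Fin B → Bool) := rd s 0 fun _ => false

/-- The machine on three tapes simulating a machine with `3 * B` tracks: it reads a block of `B`
columns, walks back, writes the new block and moves to the adjacent block. -/
def block (A : HM σ (Fin 3 × Fin B)) : HM (BlockState σ (Fin 3 × Fin B → Bool)) (Fin 3) where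
  lim := blockCanon B A.lim
  δ
    | rd s k buf, b =>
      (if k + 1 < B then rd s (k + 1) fun y => if y.2 = k then b y.1 else buf y
        else bk s (B - 1) fun y => if y.2 = k then b y.1 else buf y, b, true)
    | bk s (k + 1) buf, b => (bk s k buf, b, false)
    | bk s 0 buf, b =>
      (wr (A.δ s buf).1 0 (A.δ s buf).2.1 (A.δ s buf).2.2, b, false)
    | wr s k buf d, _ =>
      (if k + 1 < B then wr s (k + 1) buf d else if d then blockCanon B s else lf s (2 * B - 1),
        fun i => if h : k < B then buf (i, ⟨k, h⟩) else false, true)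
    | lf s (k + 1), b => (lf s k, b, false)
    | lf s 0, b => (blockCanon B s, b, false)

/-- The three-tape contents representing `3 * B` tracks. -/
def blockTape [NeZero B] (T : (Fin 3 × Fin B) × ℕ → Bool) : Fin 3 × ℕ → Bool :=
  fun y => T ((y.1, ⟨y.2 % B, Nat.mod_lt _ (NeZero.pos B)⟩), y.2 / B)

/-- The cell representing a given cell of a given track. -/
def blockCell (x : (Fin 3 × Fin B) × ℕ) : Fin 3 × ℕ := (x.1.1, B * x.2 + x.1.2)

variable [NeZero B]

theorem blockTape_blockCell (T : (Fin 3 × Fin B) × ℕ → Bool) (x : (Fin 3 × Fin B) × ℕ) :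
    blockTape T (blockCell x) = T x := by
  obtain ⟨⟨i, j⟩, n⟩ := x
  have hB := NeZero.pos B
  have h1 : (B * n + j) % B = j := by rw [Nat.mul_add_mod]; exact Nat.mod_eq_of_lt j.2
  have h2 : (B * n + j) / B = n := by
    rw [Nat.mul_add_div hB, Nat.div_eq_of_lt j.2]; simp
  simp only [blockTape, blockCell]
  congr 1
  simp only [h1, h2]

theorem blockTape_col (T : (Fin 3 × Fin B) × ℕ → Bool) (i : Fin 3) (h k : ℕ) (hk : k < B) :
    blockTape T (i, B * h + k) = T ((i, ⟨k, hk⟩), h) := blockTape_blockCell T ((i, ⟨k, hk⟩), h)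

theorem sys_next_same {σ κ : Type} (M : HM σ κ) (s s' : σ) (h : ℕ) (T : κ × ℕ → Bool) (d : Bool)
    (hδ : M.δ s (fun i => T (i, h)) = (s', fun i => T (i, h), d)) :
    M.sys.next ((s, h), T) = ((s', if d then h + 1 else h - 1), T) := by
  rw [sys_next, hδ]
  refine Prod.ext rfl (funext fun x => ?_)
  dsimp only
  split_ifs with hx
  · rw [← hx]
  · rfl

theorem block_step (A : HM σ (Fin 3 × Fin B)) (halt s : σ) (hs : s ≠ halt) (h : ℕ)
    (T : (Fin 3 × Fin B) × ℕ → Bool) :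
    let a' := A.sys.next ((s, h), T)
    TransGen (A.block.sys.GoodStep fun d => d.1.1 ≠ blockCanon B halt ∧
      ∀ x, d.2 (blockCell x) = T x ∨ d.2 (blockCell x) = a'.2 x)
      ((blockCanon B s, B * h), blockTape T)
      ((blockCanon B a'.1.1, B * a'.1.2), blockTape a'.2) := by
  intro a'
  have hB := NeZero.pos B
  set bits : Fin 3 × Fin B → Bool := fun i => T (i, h) with hbits
  set t := A.δ s bits with ht
  have ha1 : a'.1.1 = t.1 := rfl
  have ha2 : a'.1.2 = if t.2.2 then h + 1 else h - 1 := rfl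
  have ha3 : a'.2 = fun x => if x.2 = h then t.2.1 x.1 else T x := rfl
  set r := A.block.sys.GoodStep fun d => d.1.1 ≠ blockCanon B halt ∧
      ∀ x, d.2 (blockCell x) = T x ∨ d.2 (blockCell x) = a'.2 x with hr
  -- reading
  have e1 : ∀ k < B, r
      ((rd s k fun y => if y.2 < k then bits y else false, B * h + k), blockTape T)
      ((if k + 1 < B then rd s (k + 1) fun y => if y.2 < k + 1 then bits y else false
        else bk s (B - 1) bits, B * h + (k + 1)), blockTape T) := by
    intro k hk
    refine ⟨⟨?_, fun x => .inl (blockTape_blockCell T x)⟩, ?_⟩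
    · simp only [blockCanon, ne_eq, rd.injEq, not_and]; exact fun h => absurd h hs
    · rw [sys_next_same _ _ _ _ _ true]
      · rfl
      · simp only [block]
        have hb : (fun y : Fin 3 × Fin B => if (y.2 : ℕ) = k then blockTape T (y.1, B * h + k) else
            if (y.2 : ℕ) < k then bits y else false) =
            fun y => if (y.2 : ℕ) < k + 1 then bits y else false := by
          funext y
          rw [blockTape_col T _ h k hk]
          split_ifs with h1 h2 h2 h3
          · simp only [hbits]; congr 2; simp only [← h1]
          · omega
          · rfl
          · omega
          · omega
          · rfl
        rw [hb]
        refine Prod.ext ?_ rfl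
        dsimp only
        split_ifs with h1
        · rfl
        · congr 1; funext y; rw [if_pos (by omega)]
  have c1 : ReflTransGen r ((blockCanon B s, B * h), blockTape T)
      ((rd s (B - 1) fun y => if y.2 < B - 1 then bits y else false, B * h + (B - 1)),
        blockTape T) := by
    have := Sys.GoodStep.chain (r := r) (fun k =>
      ((rd s k fun y => if y.2 < k then bits y else false, B * h + k), blockTape T)) (B - 1) ?_
    · simpa [blockCanon] using this
    · intro k hk
      have := e1 k (by omega)
      rwa [if_pos (by omega)] at this
  have c2 : r ((rd s (B - 1) fun y => if y.2 < B - 1 then bits y else false, B * h + (B - 1)),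
      blockTape T) ((bk s (B - 1) bits, B * h + B), blockTape T) := by
    have := e1 (B - 1) (by omega)
    rw [if_neg (by omega)] at this
    rwa [Nat.sub_add_cancel (by omega)] at this
  -- walking back
  have c3 : ReflTransGen r ((bk s (B - 1) bits, B * h + B), blockTape T)
      ((bk s 0 bits, B * h + 1), blockTape T) := by
    have := Sys.GoodStep.chain (r := r) (fun k =>
      ((bk s (B - 1 - k) bits, B * h + (B - k)), blockTape T)) (B - 1) ?_
    · simpa [Nat.sub_sub_self (show 1 ≤ B by omega)] using this
    · intro k hk
      refine ⟨⟨by simp [blockCanon], fun x => .inl (blockTape_blockCell T x)⟩, ?_⟩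
      rw [show B - 1 - k = (B - 1 - (k + 1)) + 1 by omega, sys_next_same _ _ _ _ _ false rfl]
      simp only [Bool.false_eq_true, if_false]
      rw [show B * h + (B - k) - 1 = B * h + (B - (k + 1)) by omega]
  have c4 : r ((bk s 0 bits, B * h + 1), blockTape T)
      ((wr t.1 0 t.2.1 t.2.2, B * h), blockTape T) := by
    refine ⟨⟨by simp [blockCanon], fun x => .inl (blockTape_blockCell T x)⟩, ?_⟩
    rw [sys_next_same _ _ _ _ _ false rfl]
    simp [ht]
  -- writing
  set W : ℕ → (Fin 3 × Fin B) × ℕ → Bool := fun k x =>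
    if x.2 = h ∧ x.1.2 < k then t.2.1 x.1 else T x with hW
  have hWg : ∀ k x, blockTape (W k) (blockCell x) = T x ∨
      blockTape (W k) (blockCell x) = a'.2 x := by
    intro k x
    rw [blockTape_blockCell, hW, ha3]
    dsimp only
    split_ifs with h1 h2
    · exact .inr rfl
    · exact absurd h1.1 h2
    · exact .inl rfl
    · exact .inl rfl
  have hW0 : W 0 = T := by funext x; simp [hW]
  have hWB : W B = a'.2 := by funext x; simp [hW, ha3]
  have e5 : ∀ k < B, r ((wr t.1 k t.2.1 t.2.2, B * h + k), blockTape (W k))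
      ((if k + 1 < B then wr t.1 (k + 1) t.2.1 t.2.2 else
        if t.2.2 then blockCanon B t.1 else lf t.1 (2 * B - 1), B * h + (k + 1)),
        blockTape (W (k + 1))) := by
    intro k hk
    refine ⟨⟨by simp [blockCanon], hWg k⟩, ?_⟩
    rw [sys_next]
    refine Prod.ext rfl (funext fun y => ?_)
    simp only [block, dif_pos hk, blockTape, hW]
    by_cases hy : y.2 = B * h + k
    · have h1 : y.2 % B = k := by rw [hy, Nat.mul_add_mod]; exact Nat.mod_eq_of_lt hk
      have h2 : y.2 / B = h := by
        rw [hy, Nat.mul_add_div hB, Nat.div_eq_of_lt hk]; simp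
      rw [if_pos hy, if_pos ⟨h2, by simp only [h1]; omega⟩]
      simp only [h1]
    · rw [if_neg hy]
      have : (y.2 / B = h ∧ y.2 % B < k) ↔ (y.2 / B = h ∧ y.2 % B < k + 1) := by
        refine and_congr_right fun h2 => ?_
        have h3 := Nat.div_add_mod y.2 B
        rw [h2] at h3
        omega
      simp only [this]
  have c5 : ReflTransGen r ((wr t.1 0 t.2.1 t.2.2, B * h), blockTape T)
      ((wr t.1 (B - 1) t.2.1 t.2.2, B * h + (B - 1)), blockTape (W (B - 1))) := by
    have := Sys.GoodStep.chain (r := r) (fun k =>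
      ((wr t.1 k t.2.1 t.2.2, B * h + k), blockTape (W k))) (B - 1) ?_
    · simpa [hW0] using this
    · intro k hk
      have := e5 k (by omega)
      rwa [if_pos (by omega)] at this
  have c6 : r ((wr t.1 (B - 1) t.2.1 t.2.2, B * h + (B - 1)), blockTape (W (B - 1)))
      ((if t.2.2 then blockCanon B t.1 else lf t.1 (2 * B - 1), B * h + B), blockTape a'.2) := by
    have := e5 (B - 1) (by omega)
    rw [if_neg (by omega)] at this
    rwa [Nat.sub_add_cancel (by omega), hWB] at this
  -- final move
  have c7 : ReflTransGen r
      ((if t.2.2 then blockCanon B t.1 else lf t.1 (2 * B - 1), B * h + B), blockTape a'.2)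
      ((blockCanon B a'.1.1, B * a'.1.2), blockTape a'.2) := by
    rw [ha1, ha2]
    cases hd : t.2.2
    · simp only [Bool.false_eq_true, if_false]
      have := Sys.GoodStep.chain (r := r) (fun k =>
        ((lf t.1 (2 * B - 1 - k), B * h + B - k), blockTape a'.2)) (2 * B - 1) ?_
      · refine (by simpa using this : ReflTransGen r _ _).tail
          (b := ((lf t.1 0, B * h + B - (2 * B - 1)), blockTape a'.2)) ⟨⟨by simp [blockCanon],
            fun x => .inr (blockTape_blockCell a'.2 x)⟩, ?_⟩
        rw [sys_next_same _ _ _ _ _ false rfl]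
        simp only [Bool.false_eq_true, if_false]
        rw [show B * h + B - (2 * B - 1) - 1 = B * (h - 1) by
          rw [Nat.mul_sub]; omega]
      · intro k hk
        refine ⟨⟨by simp [blockCanon], fun x => .inr (blockTape_blockCell a'.2 x)⟩, ?_⟩
        rw [show 2 * B - 1 - k = (2 * B - 1 - (k + 1)) + 1 by omega,
          sys_next_same _ _ _ _ _ false rfl]
        simp only [Bool.false_eq_true, if_false]
        rw [show B * h + B - k - 1 = B * h + B - (k + 1) by omega]
    · simp only [if_true]
      rw [Nat.mul_add, Nat.mul_one]
  exact (((((TransGen.tail' c1 c2).trans_left c3).tail c4).trans_left c5).tail c6).trans_left c7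

theorem block_simulation (A : HM σ (Fin 3 × Fin B)) (halt : σ) :
    Sys.Simulation A.sys A.block.sys (fun s => s.1 = halt) (fun s => s.1 = blockCanon B halt)
      (fun a b => b = ((blockCanon B a.1.1, B * a.1.2), blockTape a.2)) blockCell ∅
      (fun _ => false) ∅ where
  tape := by rintro a _ rfl x; exact blockTape_blockCell _ x
  flag := by simp
  step := by
    rintro ⟨⟨s, h⟩, T⟩ _ rfl hs
    exact ⟨_, rfl, by simpa using block_step A halt s hs h T⟩
  limit := by
    intro T T' h _ _
    refine ⟨0, ?_, by simp⟩
    rw [Sys.run_zero]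
    refine Prod.ext (by simp [sys, block]) (funext fun y => ?_)
    dsimp only
    have : y = blockCell ((y.1, (⟨y.2 % B, Nat.mod_lt _ (NeZero.pos B)⟩ : Fin B)), y.2 / B) := by
      refine Prod.ext rfl ?_
      simp only [blockCell]
      exact (Nat.div_add_mod y.2 B).symm
    rw [this, h, blockTape_blockCell]

/-- Every head machine on `3 * B` tracks with finitely many states is simulated by a `Machine`;
the input appears interleaved on the tracks `(0, j)`. -/
theorem exists_machine_slower [Finite σ] (A : HM σ (Fin 3 × Fin B)) (start halt : σ) :
    ∃ N : Machine, ∀ x : R, Sys.Slower A.sys (fun s => s.1 = halt)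
      ((start, 0), fun y => if y.1.1 = 0 then x (B * y.2 + y.1.2) else false)
      N.toHM.sys (fun s => s.1 = N.halt) ((N.start, 0), inputTape 0 x) := by
  have hB := NeZero.pos B
  let β := Fin 3 × Fin B → Bool
  let F : Set (BlockState σ β) := {z | match z with
    | rd _ k _ => k ≤ 2 * B
    | bk _ k _ => k ≤ 2 * B
    | wr _ k _ _ => k ≤ 2 * B
    | lf _ k => k ≤ 2 * B}
  have hF : F.Finite := by
    let g : Fin 4 × σ × Fin (2 * B + 1) × β × Bool → BlockState σ β := fun z =>
      match z with
      | (0, s, k, b, _) => rd s k b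
      | (1, s, k, b, _) => bk s k b
      | (2, s, k, b, d) => wr s k b d
      | (3, s, k, _, _) => lf s k
    refine (Set.finite_range g).subset ?_
    rintro (⟨s, k, b⟩ | ⟨s, k, b⟩ | ⟨s, k, b, d⟩ | ⟨s, k⟩) hz
    · exact ⟨(0, s, ⟨k, Nat.lt_succ_of_le hz⟩, b, false), rfl⟩
    · exact ⟨(1, s, ⟨k, Nat.lt_succ_of_le hz⟩, b, false), rfl⟩
    · exact ⟨(2, s, ⟨k, Nat.lt_succ_of_le hz⟩, b, d), rfl⟩
    · exact ⟨(3, s, ⟨k, Nat.lt_succ_of_le hz⟩, fun _ => false, false), rfl⟩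
  have hcan : ∀ s, blockCanon B s ∈ F := fun s => Nat.zero_le _
  obtain ⟨N, hN⟩ := A.block.exists_machine (blockCanon B start) (blockCanon B halt) F hF
    (hcan _) (hcan _) (hcan _) (by
      rintro (⟨s, k, b⟩ | ⟨s, k, b⟩ | ⟨s, k, b, d⟩ | ⟨s, k⟩) hz b'
      · simp only [block]
        split_ifs
        · refine show _ ≤ 2 * B from ?_; omega
        · refine show _ ≤ 2 * B from ?_; omega
      · cases k with
        | zero => exact Nat.zero_le _
        | succ k => exact (Nat.le_succ k).trans hz
      · simp only [block]
        split_ifs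
        · refine show _ ≤ 2 * B from ?_; omega
        · exact hcan _
        · refine show _ ≤ 2 * B from ?_; omega
      · cases k with
        | zero => exact hcan _
        | succ k => exact (Nat.le_succ k).trans hz)
  refine ⟨N, fun x => ?_⟩
  have h := (block_simulation A halt).slower (δ := 0)
    (a := ((start, 0), fun y => if y.1.1 = 0 then x (B * y.2 + y.1.2) else false))
    (b := ((blockCanon B start, 0), inputTape 0 x)) (by
      rw [Sys.run_zero]
      refine Prod.ext (by simp) (funext fun y => ?_)
      simp only [blockTape, inputTape, Nat.div_add_mod]) (by simp) (by
      rintro a _ rfl h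
      exact ⟨_, by simp [h], .refl⟩)
  have h' : ∀ α, (N.toHM.sys.run ((N.start, 0), inputTape 0 x) α).1.1 = N.halt ↔
      (A.block.sys.run ((blockCanon B start, 0), inputTape 0 x) α).1.1 = blockCanon B halt :=
    fun α => by rw [← hN, N.haltedAt_iff]
  simpa only [Sys.Slower, Sys.FirstHit, h'] using h

end HM

/-! ### A structured language of counter programs -/

/-- The bit tested by a conditional: whether a register is nonzero, or the bit of a track or of
the interleaved input at the position given by a register. -/
inductive Src (K : ℕ)
  | pos (r : ℕ)
  | tape (r : ℕ) (t : Fin K)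
  | input (r : ℕ) (j : ℕ)

/-- Structured programs acting on registers and `K` tracks. -/
inductive Cmd (K : ℕ)
  | inc (r : ℕ)
  | dec (r : ℕ)
  | write (r : ℕ) (t : Fin K) (b : Bool)
  | seq (a b : Cmd K)
  | test (k : Src K) (a b : Cmd K)
  | loop (r : ℕ) (a : Cmd K)

section Exec

variable {K : ℕ}

/-- The value of a tested bit. -/
def Src.val (B : ℕ) (x : R) (s : ℕ → ℕ) (T : Fin K × ℕ → Bool) : Src K → Bool
  | pos r => decide (0 < s r)
  | tape r t => T (t, s r)
  | input r j => x (B * s r + j)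

/-- Big-step semantics; all track contents produced satisfy `Q`. -/
inductive Exec (B : ℕ) (x : R) (Q : (Fin K × ℕ → Bool) → Prop) :
    Cmd K → (ℕ → ℕ) → (Fin K × ℕ → Bool) → (ℕ → ℕ) → (Fin K × ℕ → Bool) → Prop
  | inc (r s T) : Exec B x Q (.inc r) s T (Function.update s r (s r + 1)) T
  | dec (r s T) : Exec B x Q (.dec r) s T (Function.update s r (s r - 1)) T
  | write (r t b s T) (h : Q (Function.update T (t, s r) b)) :
      Exec B x Q (.write r t b) s T s (Function.update T (t, s r) b)
  | seq {a b s T s₁ T₁ s' T'} (h₁ : Exec B x Q a s T s₁ T₁) (h₂ : Exec B x Q b s₁ T₁ s' T') :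
      Exec B x Q (.seq a b) s T s' T'
  | test_true {k a b s T s' T'} (hk : k.val B x s T = true) (h : Exec B x Q a s T s' T') :
      Exec B x Q (.test k a b) s T s' T'
  | test_false {k a b s T s' T'} (hk : k.val B x s T = false) (h : Exec B x Q b s T s' T') :
      Exec B x Q (.test k a b) s T s' T'
  | loop_zero {r a s T} (hr : s r = 0) : Exec B x Q (.loop r a) s T s T
  | loop_pos {r a s T s₁ T₁ s₂ T₂} (hr : 0 < s r) (h₁ : Exec B x Q a s T s₁ T₁)
      (h₂ : Exec B x Q (.loop r a) s₁ T₁ s₂ T₂) : Exec B x Q (.loop r a) s T s₂ T₂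

/-- All registers mentioned are `< N` and all input offsets are `< B`. -/
def Src.Below (N B : ℕ) : Src K → Prop
  | pos r => r < N
  | tape r _ => r < N
  | input r j => r < N ∧ j < B

/-- All registers mentioned are `< N` and all input offsets are `< B`. -/
def Cmd.Below (N B : ℕ) : Cmd K → Prop
  | inc r => r < N
  | dec r => r < N
  | write r _ _ => r < N
  | seq a b => a.Below N B ∧ b.Below N B
  | test k a b => k.Below N B ∧ a.Below N B ∧ b.Below N B
  | loop r a => r < N ∧ a.Below N B

end Exec

/-! ### Gadgets -/

/-- Positions inside a probe: walking out, acting one cell to the left, walking back. -/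
inductive ProbePos
  | out
  | mid (c : Bool)
  | back (c : Bool)

instance : Finite ProbePos :=
  Finite.of_surjective (α := Option (Bool × Bool))
    (fun | none => .out | some (true, c) => .mid c | some (false, c) => .back c) (by
      rintro (_ | c | c)
      exacts [⟨none, rfl⟩, ⟨some (true, c), rfl⟩, ⟨some (false, c), rfl⟩])

/-- Walk right while `go`, test `tst` and apply `act₁` to the column reached, apply `act₂` to
the column on its left, and walk back to the mark. -/
def probe {κ : Type} (mk : κ) (go tst : (κ → Bool) → Bool) (act₁ act₂ : (κ → Bool) → κ → Bool) :
    ProbePos → (κ → Bool) → (ProbePos ⊕ Bool) × (κ → Bool) × Bool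
  | .out, b => if go b then (.inl .out, b, true) else (.inl (.mid (tst b)), act₁ b, false)
  | .mid c, b => (.inl (.back c), act₂ b, false)
  | .back c, b => if b mk then (.inr c, b, false) else (.inl (.back c), b, false)

/-- Apply `act` to the column at position `v`. -/
def setCol {κ : Type} (U : κ × ℕ → Bool) (v : ℕ) (act : (κ → Bool) → κ → Bool) : κ × ℕ → Bool :=
  fun y => if y.2 = v then act (fun i => U (i, v)) y.1 else U y

section Probe

variable {σ κ : Type} {mk : κ} {go tst : (κ → Bool) → Bool} {act₁ act₂ : (κ → Bool) → κ → Bool}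

theorem setCol_id (U : κ × ℕ → Bool) (v : ℕ) : setCol U v (fun b => b) = U := by
  funext y
  simp only [setCol]
  split_ifs with h
  · rw [← h]
  · rfl

theorem probe_run (M : HM σ κ) (P : ProbePos → σ) (e : Bool → σ)
    (hM : ∀ p b, M.δ (P p) b = (Sum.elim P e (probe mk go tst act₁ act₂ p b).1,
      (probe mk go tst act₁ act₂ p b).2))
    {Good : (σ × ℕ) × (κ × ℕ → Bool) → Prop} {U U₁ U₂ : κ × ℕ → Bool} {v : ℕ}
    (h₁ : setCol U v act₁ = U₁) (h₂ : setCol U₁ (v - 1) act₂ = U₂)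
    (hgo : ∀ k < v, go (fun i => U (i, k)) = true) (hend : go (fun i => U (i, v)) = false)
    (hmk : ∀ n, U₂ (mk, n) = decide (n = 0))
    (hG : ∀ p h, Good ((P p, h), U) ∧ Good ((P p, h), U₁) ∧ Good ((P p, h), U₂)) :
    ReflTransGen (M.sys.GoodStep Good) ((P .out, 0), U)
      ((e (tst fun i => U (i, v)), 0), U₂) := by
  set c := tst fun i => U (i, v) with hc
  have s1 : ReflTransGen (M.sys.GoodStep Good) ((P .out, 0), U) ((P .out, v), U) := by
    refine Sys.GoodStep.chain (fun k => ((P .out, k), U)) v fun k hk => ⟨(hG _ _).1, ?_⟩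
    rw [HM.sys_next_same _ _ (P .out) _ _ true]
    · rfl
    · rw [hM]; simp [probe, hgo k hk]
  have s2 : M.sys.GoodStep Good ((P .out, v), U) ((P (.mid c), v - 1), U₁) := by
    refine ⟨(hG _ _).1, ?_⟩
    rw [HM.sys_next, hM, ← h₁]
    simp only [probe, hend, Bool.false_eq_true, if_false, Sum.elim_inl]
    rfl
  have s3 : M.sys.GoodStep Good ((P (.mid c), v - 1), U₁) ((P (.back c), v - 1 - 1), U₂) := by
    refine ⟨(hG _ _).2.1, ?_⟩
    rw [HM.sys_next, hM, ← h₂]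
    simp only [probe, Bool.false_eq_true, if_false, Sum.elim_inl]
    rfl
  have s4 : ∀ n, ReflTransGen (M.sys.GoodStep Good) ((P (.back c), n), U₂)
      ((P (.back c), 0), U₂) := by
    intro n
    induction n with
    | zero => exact .refl
    | succ n ih =>
      refine ReflTransGen.head ⟨(hG _ _).2.2, ?_⟩ ih
      rw [HM.sys_next_same _ _ (P (.back c)) _ _ false]
      · simp
      · rw [hM]; simp [probe, hmk]
  refine ((s1.tail s2).tail s3).trans ((s4 _).tail ⟨(hG _ _).2.2, ?_⟩)
  rw [HM.sys_next_same _ _ (e c) _ _ false]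
  · simp
  · rw [hM]; simp [probe, hmk]

end Probe

/-! ### Compilation of structured programs -/

/-- The number of tracks per tape needed for `K` data tracks and `N` registers. -/
abbrev width (K N : ℕ) : ℕ := N + K + 2

section Layout

variable {K N : ℕ}

/-- The `j`-th scratch track. -/
def auxTrack (K N j : ℕ) : Fin 3 × Fin (width K N) := (1, Fin.ofNat _ j)

/-- The track marking the origin. -/
def markTrack (K N : ℕ) := auxTrack K N 0

/-- The track holding the flag that tells apart the two kinds of limit stages. -/
def flagTrack (K N : ℕ) := auxTrack K N 1

/-- The track holding a data track. -/
def dataTrack (K N : ℕ) (t : Fin K) := auxTrack K N (2 + t)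

/-- The track holding a register in unary. -/
def regTrack (K N : ℕ) (r : ℕ) := auxTrack K N (2 + K + r)

/-- The input track with a given offset. -/
def inputTrack (K N j : ℕ) : Fin 3 × Fin (width K N) := (0, Fin.ofNat _ j)

theorem auxTrack_inj {i j : ℕ} (hi : i < width K N) (hj : j < width K N) :
    auxTrack K N i = auxTrack K N j ↔ i = j := by
  simp [auxTrack, Fin.ext_iff, Nat.mod_eq_of_lt hi, Nat.mod_eq_of_lt hj]

/-- The contents `U` of the tracks represent registers `s`, data tracks `T` and input `x`. -/
structure Enc (x : R) (s : ℕ → ℕ) (T : Fin K × ℕ → Bool)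
    (U : (Fin 3 × Fin (width K N)) × ℕ → Bool) : Prop where
  input : ∀ (j : Fin (width K N)) n, U ((0, j), n) = x (width K N * n + j)
  mark : ∀ n, U (markTrack K N, n) = decide (n = 0)
  flag : U (flagTrack K N, 0) = true
  data : ∀ t n, U (dataTrack K N t, n) = T (t, n)
  reg : ∀ r < N, ∀ n, U (regTrack K N r, n) = decide (n < s r)

/-- The part of `Enc` that holds throughout the execution of a program, with `Q` holding of the
data tracks. -/
structure EncInv (x : R) (Q : (Fin K × ℕ → Bool) → Prop)
    (U : (Fin 3 × Fin (width K N)) × ℕ → Bool) : Prop where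
  input : ∀ (j : Fin (width K N)) n, U ((0, j), n) = x (width K N * n + j)
  mark : ∀ n, U (markTrack K N, n) = decide (n = 0)
  data : Q fun y => U (dataTrack K N y.1, y.2)

theorem Enc.inv {x : R} {s : ℕ → ℕ} {T : Fin K × ℕ → Bool}
    {U : (Fin 3 × Fin (width K N)) × ℕ → Bool} {Q : (Fin K × ℕ → Bool) → Prop}
    (h : Enc x s T U) (hQ : Q T) : EncInv x Q U :=
  ⟨h.input, h.mark, by simpa only [h.data] using hQ⟩

/-- Writing one bit on one track. -/
def putBit {κ : Type} [DecidableEq κ] (k : κ) (c : Bool) (b : κ → Bool) : κ → Bool :=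
  Function.update b k c

/-- The walk towards the cell tested. -/
def Src.go (N : ℕ) : Src K → (Fin 3 × Fin (width K N) → Bool) → Bool
  | pos _, _ => false
  | tape r _, b => b (regTrack K N r)
  | input r _, b => b (regTrack K N r)

/-- The track tested. -/
def Src.track (N : ℕ) : Src K → Fin 3 × Fin (width K N)
  | pos r => regTrack K N r
  | tape _ t => dataTrack K N t
  | input _ j => inputTrack K N j

namespace Cmd

/-- Control positions of the compiled program. -/
def Pos : Cmd K → Type
  | inc _ => ProbePos
  | dec _ => ProbePos
  | write _ _ _ => ProbePos
  | seq a b => a.Pos ⊕ b.Pos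
  | test _ a b => ProbePos ⊕ a.Pos ⊕ b.Pos
  | loop _ a => ProbePos ⊕ a.Pos

instance finite_pos : ∀ c : Cmd K, Finite c.Pos
  | inc _ => inferInstanceAs (Finite ProbePos)
  | dec _ => inferInstanceAs (Finite ProbePos)
  | write _ _ _ => inferInstanceAs (Finite ProbePos)
  | seq a b =>
    have := finite_pos a
    have := finite_pos b
    inferInstanceAs (Finite (a.Pos ⊕ b.Pos))
  | test _ a b =>
    have := finite_pos a
    have := finite_pos b
    inferInstanceAs (Finite (ProbePos ⊕ a.Pos ⊕ b.Pos))
  | loop _ a =>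
    have := finite_pos a
    inferInstanceAs (Finite (ProbePos ⊕ a.Pos))

/-- The entry position. -/
def entry : (c : Cmd K) → c.Pos
  | inc _ => ProbePos.out
  | dec _ => ProbePos.out
  | write _ _ _ => ProbePos.out
  | seq a _ => .inl a.entry
  | test _ _ _ => .inl .out
  | loop _ _ => .inl .out

/-- The transition table of the compiled program, with its positions embedded by `f` and
exit `e` into the states of a host machine. -/
def table (N : ℕ) {σ : Type} : (c : Cmd K) → (c.Pos → σ) → σ → c.Pos →
    (Fin 3 × Fin (width K N) → Bool) → σ × (Fin 3 × Fin (width K N) → Bool) × Bool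
  | inc r, f, e, p, b => Prod.map (Sum.elim f fun _ => e) id
      (probe (markTrack K N) (fun b => b (regTrack K N r)) (fun _ => true)
        (putBit (regTrack K N r) true) (fun b => b) p b)
  | dec r, f, e, p, b => Prod.map (Sum.elim f fun _ => e) id
      (probe (markTrack K N) (fun b => b (regTrack K N r)) (fun _ => true)
        (fun b => b) (putBit (regTrack K N r) false) p b)
  | write r t c, f, e, p, b => Prod.map (Sum.elim f fun _ => e) id
      (probe (markTrack K N) (fun b => b (regTrack K N r)) (fun _ => true)
        (putBit (dataTrack K N t) c) (fun b => b) p b)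
  | seq a c, f, _, .inl p, b => a.table N (fun p => f (.inl p)) (f (.inr c.entry)) p b
  | seq _ c, f, e, .inr p, b => c.table N (fun p => f (.inr p)) e p b
  | test k a c, f, _, .inl p, b => Prod.map
      (Sum.elim (fun p => f (.inl p)) fun c' => if c' then f (.inr (.inl a.entry))
        else f (.inr (.inr c.entry))) id
      (probe (markTrack K N) (k.go N) (fun b => b (k.track N)) (fun b => b) (fun b => b) p b)
  | test _ a _, f, e, .inr (.inl p), b => a.table N (fun p => f (.inr (.inl p))) e p b
  | test _ _ c, f, e, .inr (.inr p), b => c.table N (fun p => f (.inr (.inr p))) e p b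
  | loop r a, f, e, .inl p, b => Prod.map
      (Sum.elim (fun p => f (.inl p)) fun c' => if c' then f (.inr a.entry) else e) id
      (probe (markTrack K N) ((Src.pos (K := K) r).go N) (fun b => b (regTrack K N r))
        (fun b => b) (fun b => b) p b)
  | loop _ a, f, _, .inr p, b => a.table N (fun p => f (.inr p)) (f (.inl .out)) p b

end Cmd

end Layout

section Compile

variable {K N : ℕ}

theorem setCol_putBit {κ : Type} [DecidableEq κ] (U : κ × ℕ → Bool) (v : ℕ) (k : κ) (c : Bool) :
    setCol U v (putBit k c) = Function.update U (k, v) c := by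
  funext y
  obtain ⟨i, n⟩ := y
  simp only [setCol, putBit, Function.update_apply, Prod.mk.injEq]
  by_cases hn : n = v
  · subst hn; by_cases hi : i = k <;> simp [hi]
  · simp [hn]

variable {x : R} {s : ℕ → ℕ} {T : Fin K × ℕ → Bool} {U : (Fin 3 × Fin (width K N)) × ℕ → Bool}

theorem mark_ne_reg {r : ℕ} (hr : r < N) : markTrack K N ≠ regTrack K N r := by
  rw [markTrack, regTrack, ne_eq, auxTrack_inj (by simp [width]) (by simp [width]; omega)]; omega

theorem flag_ne_reg {r : ℕ} (hr : r < N) : flagTrack K N ≠ regTrack K N r := by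
  rw [flagTrack, regTrack, ne_eq, auxTrack_inj (by simp [width]) (by simp [width]; omega)]; omega

theorem data_ne_reg {r : ℕ} (hr : r < N) (t : Fin K) : dataTrack K N t ≠ regTrack K N r := by
  have := t.2
  rw [dataTrack, regTrack, ne_eq, auxTrack_inj (by simp [width]; omega) (by simp [width]; omega)]
  omega

theorem mark_ne_data (t : Fin K) : markTrack K N ≠ dataTrack K N t := by
  have := t.2
  rw [markTrack, dataTrack, ne_eq, auxTrack_inj (by simp [width]) (by simp [width]; omega)]; omega

theorem flag_ne_data (t : Fin K) : flagTrack K N ≠ dataTrack K N t := by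
  have := t.2
  rw [flagTrack, dataTrack, ne_eq, auxTrack_inj (by simp [width]) (by simp [width]; omega)]; omega

theorem mark_ne_flag : markTrack K N ≠ flagTrack K N := by
  rw [markTrack, flagTrack, ne_eq, auxTrack_inj (by simp [width]) (by simp [width])]; omega

theorem reg_inj {r r' : ℕ} (hr : r < N) (hr' : r' < N) :
    regTrack K N r = regTrack K N r' ↔ r = r' := by
  rw [regTrack, regTrack, auxTrack_inj (by simp [width]; omega) (by simp [width]; omega)]; omega

theorem data_inj {t t' : Fin K} : dataTrack K N t = dataTrack K N t' ↔ t = t' := by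
  have := t.2
  have := t'.2
  rw [dataTrack, dataTrack, auxTrack_inj (by simp [width]; omega) (by simp [width]; omega),
    Fin.ext_iff]
  omega

theorem input_ne_aux (i : Fin (width K N)) (j : ℕ) : ((0, i) : Fin 3 × _) ≠ auxTrack K N j := by
  simp [auxTrack]

theorem Enc.update_reg (h : Enc x s T U) {r : ℕ} (hr : r < N) {m v : ℕ} {c : Bool}
    (hm : ∀ n, decide (n < m) = if n = v then c else decide (n < s r)) :
    Enc x (Function.update s r m) T (Function.update U (regTrack K N r, v) c) where
  input j n := by
    rw [Function.update_of_ne (by simp [regTrack, input_ne_aux]), h.input]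
  mark n := by rw [Function.update_of_ne (by simp [mark_ne_reg hr]), h.mark]
  flag := by rw [Function.update_of_ne (by simp [flag_ne_reg hr]), h.flag]
  data t n := by rw [Function.update_of_ne (by simp [data_ne_reg hr]), h.data]
  reg r' hr' n := by
    by_cases hrr : r' = r
    · subst hrr
      rw [Function.update_apply, h.reg r' hr', Function.update_self, hm]
      simp
    · rw [Function.update_of_ne (by simp [reg_inj hr' hr, hrr]), Function.update_of_ne hrr,
        h.reg r' hr']

theorem Enc.inc (h : Enc x s T U) {r : ℕ} (hr : r < N) :
    Enc x (Function.update s r (s r + 1)) T (Function.update U (regTrack K N r, s r) true) :=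
  h.update_reg hr fun n => by
    split_ifs with hn
    · simp; omega
    · exact decide_eq_decide.2 (by omega)

theorem Enc.dec (h : Enc x s T U) {r : ℕ} (hr : r < N) :
    Enc x (Function.update s r (s r - 1)) T (Function.update U (regTrack K N r, s r - 1) false) :=
  h.update_reg hr fun n => by
    split_ifs with hn
    · simp; omega
    · exact decide_eq_decide.2 (by omega)

theorem Enc.write (h : Enc x s T U) (t : Fin K) (v : ℕ) (c : Bool) :
    Enc x s (Function.update T (t, v) c) (Function.update U (dataTrack K N t, v) c) where
  input j n := by
    rw [Function.update_of_ne (by simp [dataTrack, input_ne_aux]), h.input]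
  mark n := by rw [Function.update_of_ne (by simp [mark_ne_data]), h.mark]
  flag := by rw [Function.update_of_ne (by simp [flag_ne_data]), h.flag]
  data t' n := by
    simp only [Function.update_apply, Prod.mk.injEq, data_inj, h.data]
  reg r hr n := by
    rw [Function.update_of_ne (by simp [(data_ne_reg hr t).symm]), h.reg r hr]

theorem Src.track_val (h : Enc x s T U) {k : Src K} (hk : k.Below N (width K N)) :
    ∃ v, (∀ i < v, k.go N (fun y => U (y, i)) = true) ∧ k.go N (fun y => U (y, v)) = false ∧
      U (k.track N, v) = k.val (width K N) x s T := by
  cases k with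
  | pos r => exact ⟨0, by simp, rfl, by simp [Src.track, Src.val, h.reg r hk]⟩
  | tape r t =>
    refine ⟨s r, fun i hi => ?_, ?_, h.data t (s r)⟩
    · simp [Src.go, h.reg r hk, hi]
    · simp [Src.go, h.reg r hk]
  | input r j =>
    refine ⟨s r, fun i hi => ?_, ?_, ?_⟩
    · simp [Src.go, h.reg r hk.1, hi]
    · simp [Src.go, h.reg r hk.1]
    · simp only [Src.track, inputTrack, Src.val, h.input]
      simp [Nat.mod_eq_of_lt hk.2]

variable {σ : Type} {M : HM σ (Fin 3 × Fin (width K N))} {Q : (Fin K × ℕ → Bool) → Prop}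

theorem Exec.exists_steps {Ok : σ → Prop} {c : Cmd K} {s' : ℕ → ℕ} {T' : Fin K × ℕ → Bool}
    (h : Exec (width K N) x Q c s T s' T') (hc : c.Below N (width K N)) (hQ : Q T)
    (f : c.Pos → σ) (e : σ) (hM : ∀ p b, M.δ (f p) b = c.table N f e p b) (hOk : ∀ p, Ok (f p))
    (hU : Enc x s T U) : Q T' ∧ ∃ U', Enc x s' T' U' ∧
      ReflTransGen (M.sys.GoodStep fun d => Ok d.1.1 ∧ EncInv x Q d.2)
        ((f c.entry, 0), U) ((e, 0), U') := by
  induction h generalizing U e with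
  | inc r s T =>
    have h1 := hU.inc (r := r) hc
    refine ⟨hQ, _, h1, probe_run M f (fun _ => e) hM (v := s r) (setCol_putBit _ _ _ _)
      (setCol_id _ _) (fun k hk => ?_) ?_ h1.mark fun p h =>
        ⟨⟨hOk p, hU.inv hQ⟩, ⟨hOk p, h1.inv hQ⟩, ⟨hOk p, h1.inv hQ⟩⟩⟩
    · simp [hU.reg r hc, hk]
    · simp [hU.reg r hc]
  | dec r s T =>
    have h1 := hU.dec (r := r) hc
    refine ⟨hQ, _, h1, probe_run M f (fun _ => e) hM (v := s r) (setCol_id _ _)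
      (setCol_putBit _ _ _ _) (fun k hk => ?_) ?_ h1.mark fun p h =>
        ⟨⟨hOk p, hU.inv hQ⟩, ⟨hOk p, hU.inv hQ⟩, ⟨hOk p, h1.inv hQ⟩⟩⟩
    · simp [hU.reg r hc, hk]
    · simp [hU.reg r hc]
  | write r t b s T hT =>
    have h1 := hU.write t (s r) b
    refine ⟨hT, _, h1, probe_run M f (fun _ => e) hM (v := s r) (setCol_putBit _ _ _ _)
      (setCol_id _ _) (fun k hk => ?_) ?_ h1.mark fun p h =>
        ⟨⟨hOk p, hU.inv hQ⟩, ⟨hOk p, h1.inv hT⟩, ⟨hOk p, h1.inv hT⟩⟩⟩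
    · simp [hU.reg r hc, hk]
    · simp [hU.reg r hc]
  | seq h₁ h₂ ih₁ ih₂ =>
    obtain ⟨q1, U1, e1, r1⟩ := ih₁ hc.1 hQ (fun p => f (.inl p)) _ (fun p b => hM (.inl p) b)
      (fun p => hOk _) hU
    obtain ⟨q2, U2, e2, r2⟩ := ih₂ hc.2 q1 (fun p => f (.inr p)) _ (fun p b => hM (.inr p) b)
      (fun p => hOk _) e1
    exact ⟨q2, U2, e2, r1.trans r2⟩
  | @test_true k a c s T s' T' hk h ih =>
    obtain ⟨v, g1, g2, g3⟩ := Src.track_val hU hc.1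
    have r1 := probe_run (Good := fun d => Ok d.1.1 ∧ EncInv x Q d.2) M
      (fun p => f (.inl p)) _ (fun p b => hM (.inl p) b) (setCol_id _ _)
      (setCol_id _ _) g1 g2 hU.mark
      (fun p h => ⟨⟨hOk _, hU.inv hQ⟩, ⟨hOk _, hU.inv hQ⟩, ⟨hOk _, hU.inv hQ⟩⟩)
    beta_reduce at r1
    rw [g3, hk, if_pos rfl] at r1
    obtain ⟨q2, U2, e2, r2⟩ := ih hc.2.1 hQ (fun p => f (.inr (.inl p))) _
      (fun p b => hM (.inr (.inl p)) b) (fun p => hOk _) hU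
    exact ⟨q2, U2, e2, r1.trans r2⟩
  | @test_false k a c s T s' T' hk h ih =>
    obtain ⟨v, g1, g2, g3⟩ := Src.track_val hU hc.1
    have r1 := probe_run (Good := fun d => Ok d.1.1 ∧ EncInv x Q d.2) M
      (fun p => f (.inl p)) _ (fun p b => hM (.inl p) b) (setCol_id _ _)
      (setCol_id _ _) g1 g2 hU.mark
      (fun p h => ⟨⟨hOk _, hU.inv hQ⟩, ⟨hOk _, hU.inv hQ⟩, ⟨hOk _, hU.inv hQ⟩⟩)
    beta_reduce at r1
    rw [g3, hk, if_neg (by simp)] at r1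
    obtain ⟨q2, U2, e2, r2⟩ := ih hc.2.2 hQ (fun p => f (.inr (.inr p))) _
      (fun p b => hM (.inr (.inr p)) b) (fun p => hOk _) hU
    exact ⟨q2, U2, e2, r1.trans r2⟩
  | @loop_zero r a s T hr =>
    have r1 := probe_run (Good := fun d => Ok d.1.1 ∧ EncInv x Q d.2) M
      (fun p => f (.inl p)) _ (fun p b => hM (.inl p) b) (v := 0)
      (setCol_id _ _) (setCol_id _ _) (by simp) rfl hU.mark
      (fun p h => ⟨⟨hOk _, hU.inv hQ⟩, ⟨hOk _, hU.inv hQ⟩, ⟨hOk _, hU.inv hQ⟩⟩)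
    beta_reduce at r1
    rw [hU.reg r hc.1, if_neg (by simp [hr])] at r1
    exact ⟨hQ, U, hU, r1⟩
  | @loop_pos r a s T s₁ T₁ s' T' hr h₁ h₂ ih₁ ih₂ =>
    have r1 := probe_run (Good := fun d => Ok d.1.1 ∧ EncInv x Q d.2) M
      (fun p => f (.inl p)) _ (fun p b => hM (.inl p) b) (v := 0)
      (setCol_id _ _) (setCol_id _ _) (by simp) rfl hU.mark
      (fun p h => ⟨⟨hOk _, hU.inv hQ⟩, ⟨hOk _, hU.inv hQ⟩, ⟨hOk _, hU.inv hQ⟩⟩)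
    beta_reduce at r1
    rw [hU.reg r hc.1, if_pos (by simpa using hr)] at r1
    obtain ⟨q2, U2, e2, r2⟩ := ih₁ hc.2 hQ (fun p => f (.inr p)) _
      (fun p b => hM (.inr p) b) (fun p => hOk _) hU
    obtain ⟨q3, U3, e3, r3⟩ := ih₂ hc q2 f e hM hOk e2
    exact ⟨q3, U3, e3, (r1.trans r2).trans r3⟩

end Compile
end ITTM

namespace ITTM

open Function

namespace Cmd

variable {K : ℕ}

/-- All input offsets mentioned are `< B`. -/
def Off (B : ℕ) : Cmd K → Prop
  | inc _ => True
  | dec _ => True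
  | write _ _ _ => True
  | seq a b => a.Off B ∧ b.Off B
  | test (.input _ j) a b => j < B ∧ a.Off B ∧ b.Off B
  | test (.pos _) a b => a.Off B ∧ b.Off B
  | test (.tape _ _) a b => a.Off B ∧ b.Off B
  | loop _ a => a.Off B

/-- A strict bound on the registers mentioned. -/
def bound : Cmd K → ℕ
  | inc r => r + 1
  | dec r => r + 1
  | write r _ _ => r + 1
  | seq a b => max a.bound b.bound
  | test (.input r _) a b => max (r + 1) (max a.bound b.bound)
  | test (.pos r) a b => max (r + 1) (max a.bound b.bound)
  | test (.tape r _) a b => max (r + 1) (max a.bound b.bound)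
  | loop r a => max (r + 1) a.bound

theorem below_of_off {B N : ℕ} : ∀ {c : Cmd K}, c.bound ≤ N → c.Off B → c.Below N B
  | inc _, h, _ => h
  | dec _, h, _ => h
  | write _ _ _, h, _ => h
  | seq _ _, h, h' =>
    ⟨below_of_off ((le_max_left _ _).trans h) h'.1, below_of_off ((le_max_right _ _).trans h) h'.2⟩
  | test (.input _ _) _ _, h, h' => by
    simp only [bound, sup_le_iff] at h
    exact ⟨⟨h.1, h'.1⟩, below_of_off h.2.1 h'.2.1, below_of_off h.2.2 h'.2.2⟩
  | test (.pos _) _ _, h, h' => by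
    simp only [bound, sup_le_iff] at h
    exact ⟨h.1, below_of_off h.2.1 h'.1, below_of_off h.2.2 h'.2⟩
  | test (.tape _ _) _ _, h, h' => by
    simp only [bound, sup_le_iff] at h
    exact ⟨h.1, below_of_off h.2.1 h'.1, below_of_off h.2.2 h'.2⟩
  | loop _ _, h, h' => by
    simp only [bound, sup_le_iff] at h
    exact ⟨h.1, below_of_off h.2 h'⟩

theorem Off.mono {B B' : ℕ} (hB : B ≤ B') : ∀ {c : Cmd K}, c.Off B → c.Off B'
  | inc _, _ => trivial
  | dec _, _ => trivial
  | write _ _ _, _ => trivial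
  | seq _ _, h => ⟨h.1.mono hB, h.2.mono hB⟩
  | test (.input _ _) _ _, h => ⟨h.1.trans_le hB, h.2.1.mono hB, h.2.2.mono hB⟩
  | test (.pos _) _ _, h => ⟨h.1.mono hB, h.2.mono hB⟩
  | test (.tape _ _) _ _, h => ⟨h.1.mono hB, h.2.mono hB⟩
  | loop _ a, h => Off.mono (c := a) hB h

/-- Set a register to zero. -/
def clear (r : ℕ) : Cmd K := loop r (dec r)

/-- Add register `a` to register `b`, using the zero register `t`. -/
def copy (a b t : ℕ) : Cmd K :=
  seq (loop a (seq (dec a) (seq (inc b) (inc t)))) (loop t (seq (dec t) (inc a)))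

/-- Add register `a` to register `b`, emptying `a`. -/
def move (a b : ℕ) : Cmd K := loop a (seq (dec a) (inc b))

/-- Set `n` registers starting at `r` to zero. -/
def clearRange (r : ℕ) : ℕ → Cmd K
  | 0 => dec r
  | n + 1 => seq (clearRange r n) (clear (r + n))

end Cmd

section Lib

variable {K : ℕ} {B : ℕ} {x : R} {Q : (Fin K × ℕ → Bool) → Prop} {T T' : Fin K × ℕ → Bool}
  {s s' s'' : ℕ → ℕ} {c c' : Cmd K}

theorem Exec.of_eq (h : Exec B x Q c s T s' T') (hs : s' = s'') : Exec B x Q c s T s'' T' := hs ▸ h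

theorem Exec.loop_iterate {r n : ℕ} (S : ℕ → ℕ → ℕ)
    (h : ∀ k < n, Exec B x Q c (S k) T (S (k + 1)) T)
    (hp : ∀ k < n, 0 < S k r) (h0 : S n r = 0) : Exec B x Q (.loop r c) (S 0) T (S n) T := by
  suffices ∀ m ≤ n, Exec B x Q (.loop r c) (S (n - m)) T (S n) T by
    simpa using this n le_rfl
  intro m
  induction m with
  | zero => exact fun _ => .loop_zero h0
  | succ m ih =>
    intro hm
    refine .loop_pos (hp _ (by omega)) (h _ (by omega)) ?_
    rw [show n - (m + 1) + 1 = n - m by omega]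
    exact ih (by omega)

theorem Exec.clear (r : ℕ) (s : ℕ → ℕ) : Exec B x Q (.clear r) s T (update s r 0) T := by
  have := Exec.loop_iterate (B := B) (x := x) (Q := Q) (T := T) (c := .dec r) (r := r) (n := s r)
    (fun k => update s r (s r - k)) (fun k hk => (Exec.dec r _ T).of_eq (by simp; congr 1))
    (fun k hk => by simpa using hk) (by simp)
  simpa [Cmd.clear] using this

theorem Exec.move {a b : ℕ} (hab : a ≠ b) (s : ℕ → ℕ) :
    Exec B x Q (.move a b) s T (update (update s a 0) b (s b + s a)) T := by
  have := Exec.loop_iterate (B := B) (x := x) (Q := Q) (T := T) (c := .seq (.dec a) (.inc b))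
    (r := a) (n := s a) (fun k => update (update s a (s a - k)) b (s b + k))
    (fun k hk => (Exec.seq (.dec a _ T) (.inc b _ T)).of_eq (by
      funext r; simp only [update_apply]; split_ifs <;> simp_all <;> omega))
    (fun k hk => by simp [hab, hk]) (by simp [hab])
  simpa [Cmd.move] using this

theorem Exec.copy {a b t : ℕ} (hab : a ≠ b) (hat : a ≠ t) (hbt : b ≠ t) (s : ℕ → ℕ) (ht : s t = 0) :
    Exec B x Q (.copy a b t) s T (update s b (s b + s a)) T := by
  have h1 := Exec.loop_iterate (B := B) (x := x) (Q := Q) (T := T)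
    (c := .seq (.dec a) (.seq (.inc b) (.inc t)))
    (r := a) (n := s a) (fun k => update (update (update s a (s a - k)) b (s b + k)) t k)
    (fun k hk => (Exec.seq (.dec a _ T) (.seq (.inc b _ T) (.inc t _ T))).of_eq (by
      funext r; simp only [update_apply]; split_ifs <;> simp_all <;> omega))
    (fun k hk => by simp [hab, hat, hk]) (by simp [hab, hat])
  have h2 := Exec.loop_iterate (B := B) (x := x) (Q := Q) (T := T)
    (c := .seq (.dec t) (.inc a))
    (r := t) (n := s a) (fun k => update (update (update s a k) b (s b + s a)) t (s a - k))
    (fun k hk => (Exec.seq (.dec t _ T) (.inc a _ T)).of_eq (by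
      funext r; simp only [update_apply]; split_ifs <;> simp_all <;> omega))
    (fun k hk => by simp [hk]) (by simp)
  have e0 : update (update (update s a (s a - 0)) b (s b + 0)) t 0 = s := by
    funext r; simp only [update_apply]; split_ifs <;> simp_all
  have e1 : update (update (update s a (s a - s a)) b (s b + s a)) t (s a) =
      update (update (update s a 0) b (s b + s a)) t (s a - 0) := by simp
  rw [e0, e1] at h1
  refine (h1.seq h2).of_eq ?_
  funext r; simp only [update_apply]; split_ifs <;> simp_all

theorem Exec.clearRange (r n : ℕ) (s : ℕ → ℕ) :
    Exec B x Q (.clearRange r n) s T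
      (fun i => if r ≤ i ∧ i < r + n then 0 else if i = r then s r - 1 else s i) T := by
  induction n with
  | zero =>
    refine (Exec.dec r s T).of_eq ?_
    funext i
    rw [if_neg (by omega)]
    simp only [update_apply]
  | succ n ih =>
    refine (Exec.seq ih (.clear (r + n) _)).of_eq ?_
    funext i
    simp only [update_apply]
    split_ifs <;> first | rfl | omega

theorem Cmd.off_clearRange (r n : ℕ) : (Cmd.clearRange r n : Cmd K).Off 0 := by
  induction n with
  | zero => trivial
  | succ n ih => exact ⟨ih, trivial⟩

theorem Cmd.off_clear (r : ℕ) : (Cmd.clear r : Cmd K).Off 0 := trivial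

theorem Cmd.off_copy (a b t : ℕ) : (Cmd.copy a b t : Cmd K).Off 0 :=
  ⟨⟨trivial, trivial, trivial⟩, trivial, trivial⟩

theorem Cmd.off_move (a b : ℕ) : (Cmd.move a b : Cmd K).Off 0 := ⟨trivial, trivial⟩

theorem prec_step_registers (s : ℕ → ℕ) {dst base : ℕ} (hd : dst < base) (h : s (base + 2) = 0)
    (a b k n : ℕ) :
    (let S := fun k v => update (update (update s base (n - k)) (base + 1) k) dst v
    let s₁ := update (S k b) base (S k b base - 1)
    let s₂ := update (update s₁ (base + 2) a) dst 0
    let s₃ := update (update s₂ (base + 2) 0) dst (s₂ dst + s₂ (base + 2))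
    update s₃ (base + 1) (s₃ (base + 1) + 1) = S (k + 1) a) := by
  have h1 : dst ≠ base + 1 := by omega
  have h2 : dst ≠ base + 2 := by omega
  have h3 : dst ≠ base := by omega
  funext r
  by_cases hr : r = dst
  · subst hr; simp [h1, h2.symm]
  by_cases hr : r = base + 1
  · subst hr; simp [h1.symm]
  by_cases hr : r = base + 2
  · subst hr; simp [h2.symm, h]
  by_cases hr : r = base
  · subst hr; simp [h3.symm, Nat.sub_sub]
  simp [*]

/-- Primitive recursive functions are computed by structured programs with scratch registers from
`base` on. -/
theorem exists_cmd_of_primrec' {n : ℕ} {f : List.Vector ℕ n → ℕ} (hf : Nat.Primrec' f) :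
    ∀ (src : Fin n → ℕ) (dst base : ℕ), dst < base → (∀ i, src i < base) → (∀ i, src i ≠ dst) →
      ∃ c : Cmd K, c.Off 0 ∧ ∀ B x Q T s, s dst = 0 → (∀ r, base ≤ r → s r = 0) →
        Exec B x Q c s T (update s dst (f (List.Vector.ofFn fun i => s (src i)))) T := by
  induction hf with
  | zero =>
    intro src dst base hd hs hne
    refine ⟨.dec base, trivial, fun B x Q T s h0 hz => (Exec.dec base s T).of_eq ?_⟩
    have hb := hz base le_rfl
    rw [update_eq_self_iff.2 (by rw [hb]), update_eq_self_iff.2 h0.symm]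
  | succ =>
    intro src dst base hd hs hne
    refine ⟨.seq (.copy (src 0) dst base) (.inc dst), ⟨Cmd.off_copy _ _ _, trivial⟩,
      fun B x Q T s h0 hz => (Exec.seq (.copy (hne 0) (hs 0).ne hd.ne s (hz base le_rfl))
        (.inc dst _ T)).of_eq ?_⟩
    simp [h0]
  | get i =>
    intro src dst base hd hs hne
    refine ⟨.copy (src i) dst base, Cmd.off_copy _ _ _,
      fun B x Q T s h0 hz => (Exec.copy (hne i) (hs i).ne hd.ne s (hz base le_rfl)).of_eq ?_⟩
    simp [h0]
  | @comp n m f g hf hg ihf ihg =>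
    intro src dst base hd hs hne
    have key : ∀ k ≤ m, ∃ c : Cmd K, c.Off 0 ∧ ∀ B x Q T s, (∀ r, base ≤ r → s r = 0) →
        Exec B x Q c s T (fun r => if h : base ≤ r ∧ r < base + k ∧ r - base < m then
          g ⟨r - base, h.2.2⟩ (List.Vector.ofFn fun i => s (src i)) else s r) T := by
      intro k
      induction k with
      | zero =>
        refine fun _ => ⟨.dec base, trivial, fun B x Q T s hz => (Exec.dec base s T).of_eq ?_⟩
        funext r
        rw [dif_neg (by omega), update_apply]
        split_ifs with h
        · rw [h, hz base le_rfl]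
        · rfl
      | succ k ih =>
        intro hk
        obtain ⟨c, hc, hc'⟩ := ih (by omega)
        obtain ⟨d, hd, hd'⟩ := ihg ⟨k, hk⟩ src (base + k) (base + m) (by omega)
          (fun i => (hs i).trans_le (by omega)) (fun i => by have := hs i; omega)
        refine ⟨.seq c d, ⟨hc, hd⟩, fun B x Q T s hz =>
          ((hc' B x Q T s hz).seq (hd' B x Q T _ ?_ ?_)).of_eq ?_⟩
        · rw [dif_neg (by omega), hz _ (by omega)]
        · intro r hr
          rw [dif_neg (by omega), hz _ (by omega)]
        · funext r
          have : (fun i => if h : base ≤ src i ∧ src i < base + k ∧ src i - base < m then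
              g ⟨src i - base, h.2.2⟩ (List.Vector.ofFn fun i => s (src i)) else s (src i)) =
              fun i => s (src i) := by
            funext i
            rw [dif_neg]
            have := hs i
            omega
          rw [this, update_apply]
          by_cases h : r = base + k
          · subst h
            rw [if_pos rfl, dif_pos ⟨by omega, by omega, by omega⟩]
            congr
            omega
          · rw [if_neg h]
            by_cases h' : base ≤ r ∧ r < base + k ∧ r - base < m
            · rw [dif_pos h', dif_pos ⟨h'.1, by omega, h'.2.2⟩]
            · rw [dif_neg h', dif_neg (by omega)]
    obtain ⟨c, hc, hc'⟩ := key m le_rfl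
    obtain ⟨d, hd', hd''⟩ := ihf (fun i => base + i) dst (base + m) (by omega)
      (fun i => by have := i.2; omega) (fun i => by omega)
    refine ⟨.seq c (.seq d (.clearRange base m)), ⟨hc, hd', Cmd.off_clearRange _ _⟩,
      fun B x Q T s h0 hz => ((hc' B x Q T s hz).seq ((hd'' B x Q T _ ?_ ?_).seq
        (.clearRange _ _ _))).of_eq ?_⟩
    · rw [dif_neg (by omega), h0]
    · intro r hr
      rw [dif_neg (by omega), hz _ (by omega)]
    · have e : (List.Vector.ofFn fun i : Fin m => if h : base ≤ base + i.1 ∧ base + i.1 < base + m ∧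
          base + i.1 - base < m then
          g ⟨base + i - base, h.2.2⟩ (List.Vector.ofFn fun i => s (src i)) else s (base + i)) =
          List.Vector.ofFn fun i => g i (List.Vector.ofFn fun i => s (src i)) := by
        congr
        funext i
        have := i.2
        rw [dif_pos ⟨by omega, by omega, by omega⟩]
        congr
        omega
      rw [e]
      funext r
      simp only [update_apply]
      by_cases h1 : base ≤ r ∧ r < base + m
      · rw [if_pos h1, if_neg (by omega), hz _ h1.1]
      rw [if_neg h1]
      by_cases h2 : r = base
      · subst h2
        rw [if_pos rfl, if_neg (by omega), if_neg (by omega), dif_neg (by omega), hz _ le_rfl]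
      rw [if_neg h2]
      split_ifs with h3 h4
      · rfl
      · omega
      · rfl
  | @prec n f g hf hg ihf ihg =>
    intro src dst base hd hs hne
    obtain ⟨c, hc, hc'⟩ := ihf (fun i => src i.succ) dst (base + 3) (by omega)
      (fun i => (hs _).trans (by omega)) (fun i => hne _)
    obtain ⟨d, hd', hd''⟩ := ihg (Fin.cons (base + 1) (Fin.cons dst fun i => src i.succ)) (base + 2)
      (base + 3) (by omega)
      (fun i => by
        refine Fin.cases (by simp) (fun i => Fin.cases (by simp; omega) (fun i => ?_) i) i
        simpa using (hs i.succ).trans (by omega))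
      (fun i => by
        refine Fin.cases (by simp) (fun i => Fin.cases (by simp; omega) (fun i => ?_) i) i
        simpa using ((hs i.succ).trans (by omega : base < base + 2)).ne)
    refine ⟨.seq (.copy (src 0) base (base + 1)) (.seq c (.seq (.loop base (.seq (.dec base)
      (.seq d (.seq (.clear dst) (.seq (.move (base + 2) dst) (.inc (base + 1)))))))
      (.clear (base + 1)))), ⟨Cmd.off_copy _ _ _, hc, ⟨trivial, hd', Cmd.off_clear _,
        Cmd.off_move _ _, trivial⟩, trivial⟩, fun B x Q T s h0 hz => ?_⟩
    have hs0 := (hs 0).ne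
    have h1 : Exec B x Q (.copy (src 0) base (base + 1)) s T (update s base (s (src 0))) T := by
      have := Exec.copy (B := B) (x := x) (Q := Q) (T := T) hs0
        (by have := hs 0; omega : src 0 ≠ base + 1)
        (by omega) s (hz _ (by omega))
      rwa [hz base le_rfl, Nat.zero_add] at this
    let V : List.Vector ℕ n := List.Vector.ofFn fun i => s (src i.succ)
    let F : ℕ → ℕ := fun k => k.rec (f V) fun y IH => g (y ::ᵥ IH ::ᵥ V)
    let S : ℕ → ℕ → ℕ := fun k =>
      update (update (update s base (s (src 0) - k)) (base + 1) k) dst (F k)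
    have h2 : Exec B x Q c (update s base (s (src 0))) T (S 0) T := by
      refine (hc' B x Q T _ ?_ ?_).of_eq ?_
      · rw [update_of_ne hd.ne, h0]
      · intro r hr
        rw [update_of_ne (by omega), hz r (by omega)]
      · have : (fun i : Fin n => update s base (s (src 0)) (src i.succ)) =
            fun i => s (src i.succ) := by
          funext i
          rw [update_of_ne (hs _).ne]
        rw [this]
        show _ = update (update (update s base (s (src 0) - 0)) (base + 1) 0) dst (f V)
        congr 1
        rw [Nat.sub_zero]
        refine (update_eq_self_iff.2 ?_).symm
        rw [update_of_ne (by omega), hz _ (by omega)]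
    have h3 := Exec.loop_iterate (B := B) (x := x) (Q := Q) (T := T) (r := base) (n := s (src 0))
      (c := (.seq (.dec base) (.seq d (.seq (.clear dst) (.seq (.move (base + 2) dst)
        (.inc (base + 1))))))) S (fun k hk => by
        refine (Exec.seq (.dec base _ T) (.seq (hd'' B x Q T _ ?_ ?_) (.seq (.clear dst _)
          (.seq (.move (by omega) _) (.inc (base + 1) _ T))))).of_eq ?_
        · simp only [S]
          rw [update_of_ne (by omega), update_of_ne (by omega), update_of_ne (by omega),
            update_of_ne (by omega), hz _ (by omega)]
        · intro r hr
          simp only [S]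
          rw [update_of_ne (by omega), update_of_ne (by omega), update_of_ne (by omega),
            update_of_ne (by omega), hz _ (by omega)]
        · have : (List.Vector.ofFn fun i => update (S k) base (S k base - 1)
              ((Fin.cons (base + 1) (Fin.cons dst fun i => src i.succ) : Fin (n + 2) → ℕ) i)) =
              k ::ᵥ F k ::ᵥ V := by
            rw [List.Vector.ofFn, List.Vector.ofFn]
            congr 1
            · simp only [S, Fin.cons_zero]
              rw [update_of_ne (by omega), update_of_ne (by omega), update_self]
            congr 1
            · simp only [S, Fin.cons_zero, Fin.cons_succ]
              rw [update_of_ne (by omega), update_self]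
            simp only [V]
            congr 1
            funext i
            simp only [S, Fin.cons_succ]
            have := hs i.succ
            have := hne i.succ
            rw [update_of_ne (by omega), update_of_ne (by omega), update_of_ne (by omega),
              update_of_ne (by omega)]
          rw [this]
          have hF : F (k + 1) = g (k ::ᵥ F k ::ᵥ V) := rfl
          rw [← hF]
          exact prec_step_registers s hd (hz (base + 2) (by omega)) _ _ _ _)
      (fun k hk => by
        simp only [S]
        rw [update_of_ne (by omega), update_of_ne (by omega), update_self]
        omega) (by
        simp only [S]
        rw [update_of_ne (by omega), update_of_ne (by omega), update_self]
        omega)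
    refine (h1.seq (h2.seq (h3.seq (.clear (base + 1) _)))).of_eq ?_
    have hF : F (s (src 0)) = Nat.rec (f (List.Vector.ofFn fun i => s (src i)).tail)
        (fun y IH => g (y ::ᵥ IH ::ᵥ (List.Vector.ofFn fun i => s (src i)).tail))
        (List.Vector.ofFn fun i => s (src i)).head := by
      simp only [List.Vector.ofFn, List.Vector.tail_cons, List.Vector.head_cons]
      rfl
    refine Eq.trans ?_ (congrArg (update s dst) hF)
    simp only [S]
    generalize F (s (src 0)) = v
    have z0 := hz base le_rfl
    have z1 := hz (base + 1) (by omega)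
    clear * - z0 z1 hd
    have hd' : dst ≠ base + 1 := by omega
    funext r
    simp only [update_apply]
    split_ifs <;> simp_all

end Lib

section FlatRead

variable {K : ℕ} {B : ℕ} {x : R} {Q : (Fin K × ℕ → Bool) → Prop} {T T' : Fin K × ℕ → Bool}

namespace Cmd

/-- Test whether register `r` is smaller than `m`; then add the corresponding input bit to `o` and
decrement `e`; otherwise subtract `m` from `r` and increment `q`. -/
def readChain (B r q e o : ℕ) : ℕ → Cmd K
  | 0 => inc q
  | m + 1 => test (.pos r) (seq (dec r) (readChain B r q e o m))
      (test (.input q (B - (m + 1))) (seq (inc o) (dec e)) (dec e))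

/-- Read the input at the position held in `r`. -/
def flatRead (B r q e o : ℕ) : Cmd K :=
  seq (inc e) (seq (loop e (readChain B r q e o B)) (clear q))

theorem off_readChain {r q e o : ℕ} (hB : 0 < B) : ∀ m, (readChain B r q e o m : Cmd K).Off B
  | 0 => trivial
  | m + 1 => ⟨⟨trivial, off_readChain hB m⟩, by omega, ⟨trivial, trivial⟩, trivial⟩

theorem off_flatRead {r q e o : ℕ} (hB : 0 < B) : (flatRead B r q e o : Cmd K).Off B :=
  ⟨trivial, off_readChain (K := K) hB B, trivial⟩

theorem bound_readChain {r q e o N : ℕ} (hr : r < N) (hq : q < N) (he : e < N) (ho : o < N) :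
    ∀ m, (readChain B r q e o m : Cmd K).bound ≤ N
  | 0 => hq
  | m + 1 => by
    have := bound_readChain hr hq he ho m
    simp only [readChain, bound, sup_le_iff]
    omega

theorem bound_flatRead {r q e o N : ℕ} (hr : r < N) (hq : q < N) (he : e < N) (ho : o < N) :
    (flatRead B r q e o : Cmd K).bound ≤ N := by
  have := bound_readChain (K := K) (B := B) hr hq he ho B
  simp only [flatRead, clear, bound, sup_le_iff]
  omega

end Cmd

theorem Exec.readChain_ge {r q e o : ℕ} (hrq : r ≠ q) :
    ∀ m s, m ≤ s r → Exec B x Q (.readChain B r q e o m) s T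
      (update (update s r (s r - m)) q (s q + 1)) T
  | 0, s, _ => (Exec.inc q s T).of_eq (by simp)
  | m + 1, s, h => by
    refine (Exec.test_true (by simp [Src.val]; omega) (.seq (.dec r s T)
      (Exec.readChain_ge hrq m _ (by simp; omega)))).of_eq ?_
    funext i
    simp only [update_apply]
    split_ifs <;> simp_all
    omega

theorem Exec.readChain_lt {r q e o : ℕ} (hrq : r ≠ q) (hre : r ≠ e) (hro : r ≠ o) (heo : e ≠ o) :
    ∀ m s, s r < m → m ≤ B → Exec B x Q (.readChain B r q e o m) s T
      (update (update (update s r 0) e (s e - 1)) o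
        (s o + (x (B * s q + (B - m) + s r)).toNat)) T
  | m + 1, s, h, hm => by
    by_cases h0 : 0 < s r
    · refine (Exec.test_true (by simpa [Src.val] using h0) (.seq (.dec r s T)
        (Exec.readChain_lt hrq hre hro heo m _ (by simp; omega) (by omega)))).of_eq ?_
      have e1 : B * s q + (B - m) + (s r - 1) = B * s q + (B - (m + 1)) + s r := by omega
      funext i
      simp only [update_apply, if_neg hrq.symm, if_neg hre.symm, if_neg hro.symm, if_pos, e1]
      split_ifs <;> simp_all
    · have h0 : s r = 0 := by omega
      rw [h0, Nat.add_zero]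
      refine Exec.test_false (by simp [Src.val, h0]) ?_
      cases hx : x (B * s q + (B - (m + 1)))
      · refine (Exec.test_false (k := .input q _) hx (.dec e s T)).of_eq ?_
        funext i
        simp only [update_apply]
        split_ifs <;> simp_all
      · refine (Exec.test_true (k := .input q _) hx (.seq (.inc o s T) (.dec e _ T))).of_eq ?_
        funext i
        simp only [update_apply]
        split_ifs <;> simp_all

theorem Exec.flatRead {r q e o : ℕ} (hB : 0 < B) (hrq : r ≠ q) (hre : r ≠ e) (hro : r ≠ o)
    (heo : e ≠ o) (hqe : q ≠ e) (hqo : q ≠ o) (s : ℕ → ℕ) (hq : s q = 0) (he : s e = 0)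
    (ho : s o = 0) :
    Exec B x Q (.flatRead B r q e o) s T (update (update s r 0) o (x (s r)).toNat) T := by
  have key : ∀ n s, s r = n → s e = 1 → s o = 0 → ∃ v,
      Exec B x Q (.loop e (.readChain B r q e o B)) s T
        (update (update (update (update s r 0) e 0) o (x (B * s q + n)).toNat) q v) T := by
    intro n
    induction n using Nat.strong_induction_on with
    | _ n ih =>
      intro s hn he ho
      by_cases h : n < B
      · refine ⟨s q, (Exec.loop_pos (by omega) (.readChain_lt hrq hre hro heo B s (by omega) le_rfl)
          (.loop_zero ?_)).of_eq ?_⟩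
        · simp [heo, he]
        · simp only [Nat.sub_self, Nat.add_zero, hn]
          funext i
          simp only [update_apply]
          split_ifs <;> simp_all
      · obtain ⟨v, hv⟩ := ih (n - B) (by omega) (update (update s r (s r - B)) q (s q + 1))
          (by simp [hrq, hn]) (by simp [hqe.symm, hre.symm, he]) (by simp [hqo.symm, hro.symm, ho])
        refine ⟨v, (Exec.loop_pos (by omega) (.readChain_ge hrq B s (by omega)) hv).of_eq ?_⟩
        have e1 : B * (s q + 1) + (n - B) = B * s q + n := by rw [mul_add]; omega
        rw [update_self, e1]
        funext i
        simp only [update_apply]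
        split_ifs <;> simp_all
  obtain ⟨v, hv⟩ := key (s r) (update s e (s e + 1)) (by simp [hre]) (by simp [he])
    (by simp [heo.symm, ho])
  refine ((Exec.inc e s T).seq (hv.seq (.clear q _))).of_eq ?_
  rw [update_of_ne hqe, hq, mul_zero, zero_add]
  funext i
  simp only [update_apply]
  split_ifs <;> simp_all

end FlatRead

/-! ### Programs with primitive recursive transition functions -/

/-- A program that at each step reads the input at `iaddr` and the `K` tracks at `addr`, both of
which are functions of its state, and rewrites the tracks at `addr`. -/
structure Prog (K : ℕ) (σ : Type) where
  addr : σ → ℕ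
  iaddr : σ → ℕ
  next : σ → Bool → (Fin K → Bool) → σ
  out : σ → Bool → (Fin K → Bool) → Fin K → Bool
  lim : σ

/-- The transfinite system generated by a program on a given input. -/
def Prog.sys {K : ℕ} {σ : Type} (P : Prog K σ) (w : R) : Sys σ (Fin K × ℕ) where
  next c := (P.next c.1 (w (P.iaddr c.1)) fun t => c.2 (t, P.addr c.1),
    fun y => if y.2 = P.addr c.1 then
      P.out c.1 (w (P.iaddr c.1)) (fun t => c.2 (t, P.addr c.1)) y.1 else c.2 y)
  lim := P.lim

/-- All components of a program are primitive recursive. -/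
structure Prog.Effective {K : ℕ} {σ : Type} [Primcodable σ] (P : Prog K σ) : Prop where
  addr : Primrec P.addr
  iaddr : Primrec P.iaddr
  next : Primrec fun v : σ × Bool × (Fin K → Bool) => P.next v.1 v.2.1 v.2.2
  out : Primrec fun v : σ × Bool × (Fin K → Bool) => P.out v.1 v.2.1 v.2.2

section Body

variable {K : ℕ} {σ : Type} [Primcodable σ]

theorem exists_primrec'_step {G : σ → Bool → (Fin K → Bool) → ℕ}
    (hG : Primrec fun v : σ × Bool × (Fin K → Bool) => G v.1 v.2.1 v.2.2) :
    ∃ F : List.Vector ℕ (K + 2) → ℕ, Nat.Primrec' F ∧ ∀ s b c,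
      F (Encodable.encode s ::ᵥ b.toNat ::ᵥ List.Vector.ofFn fun t => (c t).toNat) = G s b c := by
  have hpos : Primrec fun n : ℕ => decide (0 < n) :=
    (Primrec.nat_lt.comp (Primrec.const 0) Primrec.id).decide
  have h1 : Primrec fun v : List.Vector ℕ (K + 2) × σ => decide (0 < v.1.tail.head) :=
    hpos.comp (Primrec.vector_head.comp (Primrec.vector_tail.comp Primrec.fst))
  have h2 : Primrec₂ fun (v : List.Vector ℕ (K + 2) × σ) t => decide (0 < v.1.tail.tail.get t) :=
    hpos.comp (Primrec.vector_get.comp (Primrec.vector_tail.comp (Primrec.vector_tail.comp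
      (Primrec.fst.comp Primrec.fst))) Primrec.snd)
  have h3 : Primrec₂ fun (v : List.Vector ℕ (K + 2)) s => G s (decide (0 < v.tail.head)) fun t =>
      decide (0 < v.tail.tail.get t) :=
    hG.comp (Primrec.snd.pair (h1.pair (Primrec.fin_curry.2 h2)))
  have h4 : Primrec fun v : List.Vector ℕ (K + 2) =>
      (Option.casesOn (Encodable.decode (α := σ) v.head) 0 fun s =>
        G s (decide (0 < v.tail.head)) fun t => decide (0 < v.tail.tail.get t) : ℕ) :=
    Primrec.option_casesOn (f := fun _ => 0) (Primrec.decode.comp .vector_head)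
      (Primrec.const 0) h3
  refine ⟨_, Nat.Primrec'.prim_iff.2 h4, fun s b c => ?_⟩
  have : ∀ b : Bool, decide (0 < b.toNat) = b := by decide
  simp [this]

/-- Register contents during the execution of a step. -/
def stepRegs (n h a i o y : ℕ) (c : ℕ → ℕ) : ℕ → ℕ
  | 0 => n
  | 1 => h
  | 2 => a
  | 3 => i
  | 4 => 0
  | 5 => 0
  | 6 => o
  | 7 => y
  | t + 8 => c t

theorem stepRegs_ext {n h a i o y : ℕ} {c : ℕ → ℕ} {r : ℕ → ℕ} (h0 : r 0 = n) (h1 : r 1 = h)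
    (h2 : r 2 = a) (h3 : r 3 = i) (h4 : r 4 = 0) (h5 : r 5 = 0) (h6 : r 6 = o) (h7 : r 7 = y)
    (h8 : ∀ t, r (t + 8) = c t) : r = stepRegs n h a i o y c := by
  funext t
  match t with
  | 0 | 1 | 2 | 3 | 4 | 5 | 6 | 7 => assumption
  | t + 8 => exact h8 t

theorem exists_cmd_state {f : σ → ℕ} (hf : Primrec f) (dst base : ℕ) (h0 : 0 < dst)
    (hd : dst < base) : ∃ c : Cmd K, c.Off 0 ∧ ∀ B x Q T r s, r 0 = Encodable.encode s →
      r dst = 0 → (∀ i, base ≤ i → r i = 0) → Exec B x Q c r T (update r dst (f s)) T := by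
  have hF : Nat.Primrec' fun v : List.Vector ℕ 1 =>
      (Option.casesOn (Encodable.decode (α := σ) v.head) 0 f : ℕ) :=
    Nat.Primrec'.prim_iff.2 (Primrec.option_casesOn (Primrec.decode.comp .vector_head)
      (Primrec.const 0) (hf.comp Primrec.snd))
  obtain ⟨c, hc, h⟩ := exists_cmd_of_primrec' (K := K) hF (fun _ => 0) dst base hd
    (fun _ => by omega) (fun _ => h0.ne)
  refine ⟨c, hc, fun B x Q T r s h1 h2 h3 => (h B x Q T r h2 h3).of_eq ?_⟩
  simp [List.Vector.ofFn, h1]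

/-- Bits held in registers. -/
def bitRegs (k : ℕ) (c : Fin K → Bool) (t : ℕ) : ℕ :=
  if h : t < K ∧ t < k then (c ⟨t, h.1⟩).toNat else 0

theorem exists_cmd_step {G : σ → Bool → (Fin K → Bool) → ℕ}
    (hG : Primrec fun v : σ × Bool × (Fin K → Bool) => G v.1 v.2.1 v.2.2) :
    ∃ c : Cmd K, c.Off 0 ∧ ∀ B x Q T a s b d,
      Exec B x Q c (stepRegs (Encodable.encode s) 0 a 0 (Bool.toNat b) 0 (bitRegs K d)) T
        (stepRegs (Encodable.encode s) 0 a 0 (Bool.toNat b) (G s b d) (bitRegs K d)) T := by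
  obtain ⟨F, hF, hFG⟩ := exists_primrec'_step hG
  obtain ⟨c, hc, h⟩ := exists_cmd_of_primrec' (K := K) hF
    (Fin.cons 0 (Fin.cons 6 fun t => t + 8)) 7 (8 + K) (by omega)
    (fun i => by
      refine Fin.cases (by simp) (fun i => Fin.cases (by simp; omega) (fun i => ?_) i) i
      simp; omega)
    (fun i => by
      refine Fin.cases (by simp) (fun i => Fin.cases (by simp) (fun i => ?_) i) i
      simp)
  refine ⟨c, hc, fun B x Q T a s b d => (h B x Q T _ rfl ?_).of_eq ?_⟩
  · intro r hr
    obtain ⟨t, rfl⟩ : ∃ t, r = t + 8 := ⟨r - 8, by omega⟩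
    simp only [stepRegs, bitRegs]
    rw [dif_neg (by omega)]
  · refine stepRegs_ext rfl rfl rfl rfl rfl rfl rfl ?_ fun t => rfl
    rw [update_self, ← hFG]
    congr 1
    rw [List.Vector.ofFn, List.Vector.ofFn]
    congr 1
    congr 1
    congr 1
    funext t
    simp [stepRegs, bitRegs]

/-- The tracks after the first `k` of them have been rewritten at position `a`. -/
def partialWrite (k a : ℕ) (d : Fin K → Bool) (T : Fin K × ℕ → Bool) : Fin K × ℕ → Bool :=
  fun y => if y.2 = a ∧ y.1.1 < k then d y.1 else T y

theorem exists_cmd_reads (k : ℕ) (hk : k ≤ K) :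
    ∃ c : Cmd K, c.Off 0 ∧ ∀ B x Q T n a o, Exec B x Q c (stepRegs n 0 a 0 o 0 fun _ => 0) T
      (stepRegs n 0 a 0 o 0 (bitRegs k fun t => T (t, a))) T := by
  induction k with
  | zero =>
    refine ⟨.dec 7, trivial, fun B x Q T n a o => (Exec.dec 7 _ T).of_eq ?_⟩
    exact stepRegs_ext rfl rfl rfl rfl rfl rfl rfl rfl fun t => by simp [stepRegs, bitRegs]
  | succ k ih =>
    obtain ⟨c, hc, h⟩ := ih (by omega)
    refine ⟨.seq c (.test (.tape 2 ⟨k, hk⟩) (.inc (k + 8)) (.dec 7)), ⟨hc, trivial, trivial⟩,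
      fun B x Q T n a o => (h B x Q T n a o).seq ?_⟩
    cases hT : T (⟨k, hk⟩, a)
    · refine (Exec.test_false (by exact hT) (Exec.dec 7 _ T)).of_eq ?_
      refine stepRegs_ext rfl rfl rfl rfl rfl rfl rfl rfl fun t => ?_
      rw [update_of_ne (by omega)]
      simp only [stepRegs, bitRegs]
      by_cases h : t = k
      · subst h
        rw [dif_neg (by omega), dif_pos ⟨hk, by omega⟩, hT]
        rfl
      · simp [show t < k + 1 ↔ t < k by omega]
    · refine (Exec.test_true (by exact hT) (Exec.inc (k + 8) _ T)).of_eq ?_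
      refine stepRegs_ext ?_ ?_ ?_ ?_ ?_ ?_ ?_ ?_ fun t => ?_ <;> try rw [update_of_ne (by omega)]; rfl
      by_cases h : t = k
      · subst h
        rw [update_self]
        simp only [stepRegs, bitRegs]
        rw [dif_neg (by omega), dif_pos ⟨hk, by omega⟩, hT]
        rfl
      · rw [update_of_ne (by omega)]
        simp [stepRegs, bitRegs, show t < k + 1 ↔ t < k by omega]

theorem update_partialWrite {k a : ℕ} (hk : k < K) (d : Fin K → Bool) (T : Fin K × ℕ → Bool) :
    update (partialWrite k a d T) (⟨k, hk⟩, a) (d ⟨k, hk⟩) = partialWrite (k + 1) a d T := by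
  funext ⟨t, n⟩
  simp only [update_apply, partialWrite, Prod.mk.injEq, Fin.ext_iff]
  by_cases h : t.1 = k
  · subst h
    simp
  · simp [h, show t.1 < k + 1 ↔ t.1 < k by omega]

theorem exists_cmd_writes {P : Prog K σ} (hP : P.Effective) (k : ℕ) (hk : k ≤ K) :
    ∃ c : Cmd K, c.Off 0 ∧ ∀ (B x Q T a s b d),
      (∀ j ≤ k, Q (partialWrite j a (P.out s b d) T)) →
      Exec B x Q c (stepRegs (Encodable.encode s) 0 a 0 (Bool.toNat b) 0 (bitRegs K d)) T
        (stepRegs (Encodable.encode s) 0 a 0 (Bool.toNat b) 0 (bitRegs K d))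
        (partialWrite k a (P.out s b d) T) := by
  induction k with
  | zero =>
    refine ⟨.dec 7, trivial, fun B x Q T a s b d hQ => ?_⟩
    have : partialWrite 0 a (P.out s b d) T = T := by
      funext y
      simp [partialWrite]
    rw [this]
    exact (Exec.dec 7 _ T).of_eq (stepRegs_ext rfl rfl rfl rfl rfl rfl rfl rfl fun t => rfl)
  | succ k ih =>
    obtain ⟨c, hc, h⟩ := ih (by omega)
    have hG : Primrec fun v : σ × Bool × (Fin K → Bool) =>
        Encodable.encode (P.out v.1 v.2.1 v.2.2 ⟨k, hk⟩) :=
      Primrec.encode.comp (Primrec.fin_app.comp hP.out (Primrec.const _))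
    obtain ⟨c', hc', h'⟩ := exists_cmd_step
      (G := fun s b d => Encodable.encode (P.out s b d ⟨k, hk⟩)) hG
    refine ⟨.seq c (.seq c' (.test (.pos 7) (.seq (.write 2 ⟨k, hk⟩ true) (.dec 7))
      (.write 2 ⟨k, hk⟩ false))), ⟨hc, hc', ⟨trivial, trivial⟩, trivial⟩,
      fun B x Q T a s b d hQ =>
        (h B x Q T a s b d fun j hj => hQ j (by omega)).seq ((h' B x Q _ a s b d).seq ?_)⟩
    have hQ' := hQ (k + 1) le_rfl
    rw [← update_partialWrite hk] at hQ' ⊢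
    cases ho : P.out s b d ⟨k, hk⟩
    · rw [ho] at hQ'
      exact Exec.test_false (by simp [Src.val, stepRegs]) (.write 2 _ false _ _ hQ')
    · rw [ho] at hQ'
      exact Exec.test_true (by simp [Src.val, stepRegs])
        ((Exec.write 2 _ true _ _ hQ').seq ((Exec.dec 7 _ _).of_eq
          (stepRegs_ext rfl rfl rfl rfl rfl rfl rfl rfl fun t => rfl)))

/-- The registers between steps: the state, and whether it is the halting one. -/
noncomputable def mainRegs (halt s : σ) : ℕ → ℕ :=
  stepRegs (Encodable.encode s) (if s = halt then 1 else 0) 0 0 0 0 fun _ => 0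

theorem exists_cmd_body {P : Prog K σ} (hP : P.Effective) (halt : σ) :
    ∃ (N : ℕ) (c : ℕ → Cmd K), 8 ≤ N ∧ (∀ B, 0 < B → (c B).Below N B) ∧
      ∀ B, 0 < B → ∀ w Q s T, s ≠ halt →
      (∀ T', (∀ y, T' y = T y ∨ T' y = ((P.sys w).next (s, T)).2 y) → Q T') →
      Exec B w Q (c B) (mainRegs halt s) T (mainRegs halt ((P.sys w).next (s, T)).1)
        ((P.sys w).next (s, T)).2 := by
  have hhalt : Primrec fun s : σ => if s = halt then 1 else 0 :=
    Primrec.ite (Primrec.eq.comp Primrec.id (Primrec.const halt)) (Primrec.const 1)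
      (Primrec.const 0)
  obtain ⟨c₁, o₁, h₁⟩ := exists_cmd_state (K := K) hP.addr 2 8 (by omega) (by omega)
  obtain ⟨c₂, o₂, h₂⟩ := exists_cmd_state (K := K) hP.iaddr 3 8 (by omega) (by omega)
  obtain ⟨c₃, o₃, h₃⟩ := exists_cmd_reads K le_rfl
  obtain ⟨c₄, o₄, h₄⟩ := exists_cmd_writes hP K le_rfl
  obtain ⟨c₅, o₅, h₅⟩ := exists_cmd_step (G := fun s b d => Encodable.encode (P.next s b d))
    (Primrec.encode.comp hP.next)
  obtain ⟨c₆, o₆, h₆⟩ := exists_cmd_state (K := K) hhalt 1 8 (by omega) (by omega)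
  let pre : Cmd K := .seq c₁ c₂
  let post : Cmd K := .seq c₃ (.seq c₄ (.seq c₅ (.seq (.clear 0) (.seq (.move 7 0)
    (.seq (.clear 2) (.seq (.clear 6) (.seq (.clearRange 8 K) c₆)))))))
  have opre : pre.Off 0 := ⟨o₁, o₂⟩
  have opost : post.Off 0 := ⟨o₃, o₄, o₅, Cmd.off_clear _, Cmd.off_move _ _, Cmd.off_clear _,
    Cmd.off_clear _, Cmd.off_clearRange _ _, o₆⟩
  refine ⟨max 8 (max pre.bound post.bound),
    fun B => .seq pre (.seq (.flatRead B 3 4 5 6) post), le_max_left _ _, fun B hB =>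
      Cmd.below_of_off ?_ ⟨opre.mono (Nat.zero_le _),
        Cmd.off_flatRead hB, opost.mono (Nat.zero_le _)⟩, ?_⟩
  · have := Cmd.bound_flatRead (K := K) (B := B) (r := 3) (q := 4) (e := 5) (o := 6) (N := 8)
      (by omega) (by omega) (by omega) (by omega)
    simp only [Cmd.bound]
    omega
  · intro B hB w Q s T hs hQ
    have hout : partialWrite K (P.addr s) (P.out s (w (P.iaddr s)) fun t => T (t, P.addr s)) T =
        ((P.sys w).next (s, T)).2 := by
      funext y
      simp [partialWrite, Prog.sys]
    rw [← hout] at hQ ⊢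
    have z8 : ∀ i, 8 ≤ i → mainRegs halt s i = 0 := by
      intro i hi
      obtain ⟨t, rfl⟩ : ∃ t, i = t + 8 := ⟨i - 8, by omega⟩
      rfl
    have e₁ : Exec B w Q c₁ (mainRegs halt s) T
        (stepRegs (Encodable.encode s) 0 (P.addr s) 0 0 0 fun _ => 0) T :=
      (h₁ B w Q T _ s rfl rfl z8).of_eq
        (stepRegs_ext rfl (if_neg hs) rfl rfl rfl rfl rfl rfl fun t => rfl)
    have e₂ : Exec B w Q c₂ (stepRegs (Encodable.encode s) 0 (P.addr s) 0 0 0 fun _ => 0) T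
        (stepRegs (Encodable.encode s) 0 (P.addr s) (P.iaddr s) 0 0 fun _ => 0) T :=
      (h₂ B w Q T _ s rfl rfl (fun i hi => by
        obtain ⟨t, rfl⟩ : ∃ t, i = t + 8 := ⟨i - 8, by omega⟩
        rfl)).of_eq (stepRegs_ext rfl rfl rfl rfl rfl rfl rfl rfl fun t => rfl)
    have e₃ : Exec B w Q (.flatRead B 3 4 5 6)
        (stepRegs (Encodable.encode s) 0 (P.addr s) (P.iaddr s) 0 0 fun _ => 0) T
        (stepRegs (Encodable.encode s) 0 (P.addr s) 0 (w (P.iaddr s)).toNat 0 fun _ => 0) T :=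
      (Exec.flatRead hB (by omega) (by omega) (by omega) (by omega) (by omega) (by omega) _ rfl
        rfl rfl).of_eq (stepRegs_ext rfl rfl rfl rfl rfl rfl rfl rfl fun t => rfl)
    refine (e₁.seq e₂).seq (e₃.seq ((h₃ B w Q T _ _ _).seq ((h₄ B w Q T _ _ _ _ ?_).seq
      ((h₅ B w Q _ _ _ _ _).seq ((Exec.clear 0 _).seq ((Exec.move (by omega) _).seq
        ((Exec.clear 2 _).seq ((Exec.clear 6 _).seq ((Exec.clearRange 8 K _).seq
          ((h₆ B w Q _ _ (P.next s (w (P.iaddr s)) fun t => T (t, P.addr s)) ?_ ?_ ?_).of_eq ?_))))))))))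
    · intro j hj
      refine hQ _ fun y => ?_
      simp only [partialWrite]
      by_cases h : y.2 = P.addr s ∧ y.1.1 < j
      · right
        rw [if_pos h, if_pos ⟨h.1, y.1.2⟩]
      · left
        rw [if_neg h]
    · simp [stepRegs]
    · simp [stepRegs]
    · intro i hi
      obtain ⟨t, rfl⟩ : ∃ t, i = t + 8 := ⟨i - 8, by omega⟩
      by_cases ht : t < K
      · rw [if_pos (by omega)]
      rw [if_neg (by omega)]
      simp [stepRegs, bitRegs, ht]
      rintro rfl
      rw [dif_neg ht]
    · refine stepRegs_ext ?_ ?_ ?_ ?_ ?_ ?_ ?_ ?_ fun t => ?_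
      all_goals try (simp [stepRegs, update_apply, Prog.sys]; done)
      rw [update_of_ne (by omega)]
      by_cases ht : t < K
      · rw [if_pos (by omega)]
      rw [if_neg (by omega)]
      simp [stepRegs, bitRegs, ht]
      rintro rfl
      rw [dif_neg ht]

end Body
end ITTM

namespace ITTM

open Function Order Relation

/-- Control states of the machine running a structured program as the body of its main loop. -/
inductive Host (π : Type)
  | start
  | lim
  | wipe
  | check
  | body (p : π)
  | halt

instance {π : Type} [Finite π] : Finite (Host π) :=
  Finite.of_surjective (α := Fin 5 ⊕ π)
    (Sum.elim (fun i => match i with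
        | 0 => .start | 1 => .lim | 2 => .wipe | 3 => .check | 4 => .halt)
      .body) (by
      rintro (_ | _ | _ | _ | p | _)
      exacts [⟨.inl 0, rfl⟩, ⟨.inl 1, rfl⟩, ⟨.inl 2, rfl⟩, ⟨.inl 3, rfl⟩,
        ⟨.inr p, rfl⟩, ⟨.inl 4, rfl⟩])

section Host

variable {K N : ℕ}

/-- The tracks holding registers. -/
def IsReg (K N : ℕ) (k : Fin 3 × Fin (width K N)) : Prop := ∃ r < N, k = regTrack K N r

/-- The machine running `c` as the body of its main loop. At a limit stage it first spends `ω` steps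
on wiping the registers. -/
noncomputable def hostHM (N : ℕ) (c : Cmd K) : HM (Host c.Pos) (Fin 3 × Fin (width K N)) where
  δ
    | .start, b => (.check, update (update b (markTrack K N) true) (flagTrack K N) true, false)
    | .lim, b => if b (flagTrack K N) then
        (.wipe, fun k => if IsReg K N k ∨ k = flagTrack K N then false else b k, true) else
        (.check, update (update b (flagTrack K N) true) (regTrack K N 0) true, false)
    | .wipe, b => (.wipe, fun k => if IsReg K N k then false else b k, true)
    | .check, b => (if b (regTrack K N 1) then .halt else .body c.entry, b, false)
    | .body p, b => c.table N Host.body Host.check p b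
    | .halt, b => (.halt, b, false)
  lim := .lim

theorem not_isReg_data (t : Fin K) : ¬ IsReg K N (dataTrack K N t) := by
  rintro ⟨r, hr, h⟩
  exact data_ne_reg hr t h

theorem not_isReg_mark : ¬ IsReg K N (markTrack K N) := by
  rintro ⟨r, hr, h⟩
  exact mark_ne_reg hr h

theorem not_isReg_input (j : Fin (width K N)) : ¬ IsReg K N (0, j) := by
  rintro ⟨r, hr, h⟩
  exact absurd (congrArg Prod.fst h) (by simp [regTrack, auxTrack])

/-- The tracks after wiping the first `n` columns. -/
noncomputable def wiped (n : ℕ) (U : (Fin 3 × Fin (width K N)) × ℕ → Bool) :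
    (Fin 3 × Fin (width K N)) × ℕ → Bool :=
  fun y => if (y.2 < n ∧ IsReg K N y.1) ∨ y = (flagTrack K N, 0) then false else U y

theorem host_run_wipe (c : Cmd K) {U : (Fin 3 × Fin (width K N)) × ℕ → Bool}
    (hU : U (flagTrack K N, 0) = true) (n : ℕ) :
    (hostHM N c).sys.run ((.lim, 0), U) ((n + 1 : ℕ) : Ordinal) =
      ((.wipe, n + 1), wiped (n + 1) U) := by
  induction n with
  | zero =>
    rw [Nat.zero_add, Nat.cast_one, ← zero_add (1 : Ordinal), Sys.run_add_one, Sys.run_zero,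
      HM.sys_next]
    simp only [hostHM, hU, if_true]
    refine Prod.ext rfl (funext fun y => ?_)
    obtain ⟨k, n⟩ := y
    by_cases hn : n = 0
    · subst hn
      simp [wiped]
    · simp [wiped, hn]
  | succ n ih =>
    rw [Nat.cast_add, Nat.cast_one, Sys.run_add_one, ih, HM.sys_next]
    simp only [hostHM, if_true]
    refine Prod.ext rfl (funext fun y => ?_)
    obtain ⟨k, m⟩ := y
    by_cases hm : m = n + 1
    · subst hm
      simp [wiped]
    · simp only [hm, if_false, wiped]
      have : m < n + 1 + 1 ↔ m < n + 1 := by omega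
      simp only [this]

theorem host_run_omega (c : Cmd K) {U : (Fin 3 × Fin (width K N)) × ℕ → Bool}
    (hU : U (flagTrack K N, 0) = true) :
    (hostHM N c).sys.run ((.lim, 0), U) Ordinal.omega0 = ((.lim, 0),
      fun y => if IsReg K N y.1 ∨ y = (flagTrack K N, 0) then false else U y) := by
  refine Prod.ext (Sys.run_limit_fst _ _ Ordinal.isSuccLimit_omega0) (funext fun y => ?_)
  refine Sys.run_limit_const _ _ Ordinal.isSuccLimit_omega0 (β := ((y.2 + 1 : ℕ) : Ordinal))
    (Ordinal.natCast_lt_omega0 _) fun γ h1 h2 => ?_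
  obtain ⟨m, rfl⟩ := Ordinal.lt_omega0.1 h2
  have h1 : y.2 + 1 ≤ m := by exact_mod_cast h1
  obtain ⟨m, rfl⟩ : ∃ k, m = k + 1 := ⟨m - 1, by omega⟩
  rw [host_run_wipe c hU]
  simp only [wiped, show y.2 < m + 1 by omega, true_and]

variable {σ : Type} [Primcodable σ]

/-- The representation of configurations of a program by configurations of the host machine. -/
def HostRel (N : ℕ) (c : Cmd K) (w : R) (halt : σ) (a : σ × (Fin K × ℕ → Bool))
    (b : (Host c.Pos × ℕ) × ((Fin 3 × Fin (width K N)) × ℕ → Bool)) : Prop :=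
  b.1 = (.check, 0) ∧ Enc w (mainRegs halt a.1) a.2 b.2

theorem host_simulation {P : Prog K σ} {halt : σ} {c : Cmd K} (w : R) (hN : 8 ≤ N)
    (hlim : Encodable.encode P.lim = 1) (hl : P.lim ≠ halt) (hc : c.Below N (width K N))
    (hexec : ∀ Q s T, s ≠ halt →
      (∀ T', (∀ y, T' y = T y ∨ T' y = ((P.sys w).next (s, T)).2 y) → Q T') →
      Exec (width K N) w Q c (mainRegs halt s) T (mainRegs halt ((P.sys w).next (s, T)).1)
        ((P.sys w).next (s, T)).2) :
    Sys.Simulation (P.sys w) (hostHM N c).sys (· = halt) (fun s => s.1 = .halt)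
      (HostRel N c w halt) (fun y => (dataTrack K N y.1, y.2))
      {y | y.1.1 = 0 ∨ y.1 = markTrack K N}
      (fun y => if y.1.1 = 0 then w (width K N * y.2 + y.1.2) else decide (y.2 = 0))
      {(flagTrack K N, 0)} where
  tape a b h y := h.2.data _ _
  flag a b h y hy := by rw [Set.mem_singleton_iff.1 hy]; exact h.2.flag
  step := by
    rintro ⟨s, T⟩ ⟨_, U⟩ ⟨rfl, hU⟩ hs
    have hz : ∀ (d : (Fin 3 × Fin (width K N)) × ℕ → Bool) (Q), EncInv w Q d →
        ∀ z ∈ {y : (Fin 3 × Fin (width K N)) × ℕ | y.1.1 = 0 ∨ y.1 = markTrack K N},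
        d z = if z.1.1 = 0 then w (width K N * z.2 + z.1.2) else decide (z.2 = 0) := by
      rintro d Q hd ⟨⟨i, j⟩, n⟩ (h | h)
      · simp only at h
        subst h
        rw [if_pos rfl, hd.input]
      · simp only at h
        rw [h, if_neg (by simp [markTrack, auxTrack]), hd.mark]
    let Q : (Fin K × ℕ → Bool) → Prop := fun T' => ∀ y, T' y = T y ∨
      T' y = ((P.sys w).next (s, T)).2 y
    obtain ⟨-, U', hU', hstep⟩ := (hexec Q s T hs fun T' h => h).exists_steps (M := hostHM N c)
      (Ok := (· ≠ .halt)) hc (fun y => .inl rfl) Host.body Host.check (fun p b => rfl)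
      (fun p => by simp) hU
    refine ⟨((.check, 0), U'), ⟨rfl, hU'⟩, TransGen.head' ⟨⟨by simp, fun y => .inl (hU.data _ _),
      hz _ Q (hU.inv fun y => .inl rfl)⟩, ?_⟩ (ReflTransGen.mono (fun d d' h => ⟨⟨h.1.1,
        fun y => h.1.2.data y, hz _ Q h.1.2⟩, h.2⟩) _ _ hstep)⟩
    rw [HM.sys_next_same _ _ (.body c.entry) _ _ false]
    · simp
    · have : U (regTrack K N 1, 0) = false := by
        rw [show U (regTrack K N 1, 0) = decide (0 < mainRegs halt s 1) from hU.reg 1 (by omega) 0]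
        have hs : s ≠ halt := hs
        simp [mainRegs, stepRegs, hs]
      simp [hostHM, this]
  limit T U hT hZ hF := by
    have hF := hF _ rfl
    have hmark : ∀ n, U (markTrack K N, n) = decide (n = 0) := fun n =>
      (hZ _ (.inr rfl)).trans (if_neg (by simp [markTrack, auxTrack]))
    have hinput : ∀ j n, U ((0, j), n) = w (width K N * n + j) := fun j n =>
      (hZ _ (.inl rfl)).trans (if_pos rfl)
    let W : (Fin 3 × Fin (width K N)) × ℕ → Bool := fun y =>
      if IsReg K N y.1 ∨ y = (flagTrack K N, 0) then false else U y
    have hW := host_run_omega (N := N) c hF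
    refine ⟨Ordinal.omega0 + 1, ?_, fun ξ hξ => ?_⟩
    · show HostRel _ _ _ _ _ ((hostHM N c).sys.run ((.lim, 0), U) _)
      rw [Sys.run_add_one, hW, HM.sys_next]
      have h0 : regTrack K N 0 ≠ flagTrack K N := (flag_ne_reg (by omega)).symm
      simp only [hostHM, or_true, if_true, Bool.false_eq_true, if_false]
      refine ⟨rfl, ?_, ?_, ?_, ?_, ?_⟩
      · intro j n
        have h1 : ((0, j) : Fin 3 × Fin (width K N)) ≠ flagTrack K N := by
          simp [flagTrack, auxTrack]
        have h2 : ((0, j) : Fin 3 × Fin (width K N)) ≠ regTrack K N 0 := by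
          simp [regTrack, auxTrack]
        by_cases hn : n = 0
        · subst hn
          simp [h1, h2, not_isReg_input, hinput]
        · simp [hn, not_isReg_input, hinput]
      · intro n
        by_cases hn : n = 0
        · subst hn
          simp [mark_ne_flag, mark_ne_reg (show 0 < N by omega), not_isReg_mark, hmark]
        · simp [hn, not_isReg_mark, hmark]
      · simp [h0.symm]
      · intro t n
        by_cases hn : n = 0
        · subst hn
          simp [(flag_ne_data t).symm, data_ne_reg (show 0 < N by omega), not_isReg_data, hT (t, 0)]
        · simp [hn, not_isReg_data, hT (t, n)]
      · intro r hr n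
        have hreg : IsReg K N (regTrack K N r) := ⟨r, hr, rfl⟩
        have hr0 : mainRegs halt (P.sys w).lim r = if r = 0 then 1 else 0 := by
          match r with
          | 0 => exact hlim
          | 1 => exact if_neg hl
          | 2 | 3 | 4 | 5 | 6 | 7 | t + 8 => rfl
        by_cases hn : n = 0
        · subst hn
          by_cases h : r = 0
          · subst h
            simp [hr0]
          · have : regTrack K N r ≠ regTrack K N 0 := fun h' => h ((reg_inj hr (by omega)).1 h')
            simp [this, hreg, hr0, h, (flag_ne_reg hr).symm]
        · rw [hr0]
          split_ifs <;> simp [hn, hreg]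
    · have key : ∃ s n V, (hostHM N c).sys.run ((.lim, 0), U) ξ = ((s, n), V) ∧ s ≠ .halt ∧
          ∀ k m, ¬ IsReg K N k → k ≠ flagTrack K N → V (k, m) = U (k, m) := by
        rcases (Order.lt_add_one_iff.1 hξ).lt_or_eq with h | rfl
        · obtain ⟨n, rfl⟩ := Ordinal.lt_omega0.1 h
          cases n with
          | zero => exact ⟨.lim, 0, U, by simp, by simp, fun _ _ _ _ => rfl⟩
          | succ n =>
            refine ⟨_, _, _, host_run_wipe c hF n, by simp, fun k m h1 h2 => ?_⟩
            simp [wiped, h1, h2]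
        · refine ⟨_, _, _, hW, by simp, fun k m h1 h2 => ?_⟩
          simp [h1, h2]
      obtain ⟨s, n, V, h1, h2, h3⟩ := key
      change (¬ ((hostHM N c).sys.run ((.lim, 0), U) ξ).1.1 = .halt ∧
        (∀ y, ((hostHM N c).sys.run ((.lim, 0), U) ξ).2 _ = _) ∧
        ∀ z ∈ _, ((hostHM N c).sys.run ((.lim, 0), U) ξ).2 z = _)
      rw [h1]
      refine ⟨h2, fun y => ?_, ?_⟩
      · exact (h3 _ _ (not_isReg_data _) (flag_ne_data _).symm).trans (hT y)
      · rintro ⟨k, m⟩ hz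
        refine (h3 k m ?_ ?_).trans (hZ _ hz)
        · rcases hz with h | h
          · obtain ⟨i, j⟩ := k
            simp only at h
            subst h
            exact not_isReg_input j
          · simp only at h
            rw [h]
            exact not_isReg_mark
        · rcases hz with h | h
          · rintro rfl
            simp [flagTrack, auxTrack] at h
          · simp only at h
            rw [h]
            exact mark_ne_flag

/-- Every effective program is simulated by a machine. -/
theorem Prog.Effective.exists_machine {P : Prog K σ} (hP : P.Effective) (start halt : σ)
    (hstart : Encodable.encode start = 0) (hlim : Encodable.encode P.lim = 1)
    (hs : start ≠ halt) (hl : P.lim ≠ halt) :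
    ∃ M : Machine, ∀ w, Sys.Slower (P.sys w) (· = halt) (start, fun _ => false)
      M.toHM.sys (fun s => s.1 = M.halt) ((M.start, 0), HM.inputTape 0 w) := by
  obtain ⟨N, c, hN, hc, hexec⟩ := exists_cmd_body hP halt
  have hw : 0 < width K N := by unfold width; omega
  have : NeZero (width K N) := ⟨hw.ne'⟩
  obtain ⟨M, hM⟩ := HM.exists_machine_slower (hostHM N (c (width K N))) .start .halt
  refine ⟨M, fun w => Sys.Slower.trans ?_ (hM w)⟩
  refine (host_simulation w hN hlim hl (hc _ hw) (hexec _ hw w)).slower (δ := 1) ?_ ?_ ?_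
  · rw [← zero_add (1 : Ordinal), Sys.run_add_one, Sys.run_zero, HM.sys_next]
    simp only [hostHM, Bool.false_eq_true, if_false]
    refine ⟨rfl, ?_, ?_, ?_, ?_, ?_⟩
    · intro j n
      have h1 : ((0, j) : Fin 3 × Fin (width K N)) ≠ flagTrack K N := by
        simp [flagTrack, auxTrack]
      have h2 : ((0, j) : Fin 3 × Fin (width K N)) ≠ markTrack K N := by
        simp [markTrack, auxTrack]
      by_cases hn : n = 0
      · subst hn
        simp [h1, h2]
      · simp [hn]
    · intro n
      by_cases hn : n = 0
      · subst hn
        simp [mark_ne_flag]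
      · simp [hn, markTrack, auxTrack]
    · simp
    · intro t n
      by_cases hn : n = 0
      · subst hn
        have h1 : (dataTrack K N t).1 ≠ 0 := by simp [dataTrack, auxTrack]
        simp [(flag_ne_data t).symm, (mark_ne_data t).symm, h1]
      · simp [hn, dataTrack, auxTrack]
    · intro r hr n
      have hr0 : mainRegs halt start r = 0 := by
        match r with
        | 0 => exact hstart
        | 1 => exact if_neg hs
        | 2 | 3 | 4 | 5 | 6 | 7 | t + 8 => rfl
      simp only [hr0]
      by_cases hn : n = 0
      · subst hn
        have h1 : (regTrack K N r).1 ≠ 0 := by simp [regTrack, auxTrack]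
        simp [(flag_ne_reg hr).symm, (mark_ne_reg hr).symm, h1]
      · simp [hn, regTrack, auxTrack]
  · intro ξ hξ
    rw [Order.lt_one_iff.1 hξ, Sys.run_zero]
    simp
  · rintro ⟨s, T⟩ ⟨_, U⟩ ⟨rfl, hU⟩ rfl
    refine ⟨((.halt, 0), U), rfl, .single ⟨by simp, ?_⟩⟩
    rw [HM.sys_next_same _ _ .halt _ _ false]
    · simp
    · have : U (regTrack K N 1, 0) = true := by
        rw [show U (regTrack K N 1, 0) = decide (0 < mainRegs s s 1) from hU.reg 1 (by omega) 0]
        simp [mainRegs, stepRegs]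
      simp [hostHM, this]

end Host
end ITTM

namespace ITTM

section Exact

open Encodable

/-- An encoding whose decoding function accepts only codes. -/
class ExactEncodable (α : Type) [Encodable α] : Prop where
  encode_eq : ∀ n (a : α), decode n = some a → encode a = n

theorem encode_eq_of_decode {α : Type} [Encodable α] [ExactEncodable α] {n : ℕ} {a : α}
    (h : decode n = some a) : encode a = n := ExactEncodable.encode_eq n a h

theorem ExactEncodable.ofEquiv {α β : Type} (i : Encodable α) (h : ExactEncodable α) (e : β ≃ α) :
    @ExactEncodable β (Encodable.ofEquiv α e) := by
  let _ := Encodable.ofEquiv α e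
  refine ⟨fun n b h => ?_⟩
  rw [decode_ofEquiv, Option.map_eq_some_iff] at h
  obtain ⟨a, h1, rfl⟩ := h
  rw [encode_ofEquiv, e.apply_symm_apply, encode_eq_of_decode h1]

variable {α β : Type} [Encodable α] [Encodable β]

instance : ExactEncodable ℕ := ⟨fun n a h => by simpa [eq_comm] using h⟩

instance : ExactEncodable Bool := ⟨fun n a h => by
  match n, a with
  | 0, false | 1, true => rfl
  | 0, true | 1, false => simp [decode_zero] at h
  | n + 2, _ => rw [decode_ge_two _ (by omega)] at h; simp at h⟩

instance {γ : α → Type} [∀ a, Encodable (γ a)] [ExactEncodable α] [∀ a, ExactEncodable (γ a)] :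
    ExactEncodable (Sigma γ) := ⟨fun n ⟨a, b⟩ h => by
  simp only [decode_sigma_val, Option.bind_eq_some_iff, Option.map_eq_some_iff] at h
  obtain ⟨a', h1, b', h2, h3⟩ := h
  cases h3
  rw [encode_sigma_val, encode_eq_of_decode h1, encode_eq_of_decode h2, Nat.pair_unpair]⟩

instance [ExactEncodable α] [ExactEncodable β] : ExactEncodable (α × β) := ⟨fun n ⟨a, b⟩ h => by
  simp only [decode_prod_val, Option.bind_eq_some_iff, Option.map_eq_some_iff] at h
  obtain ⟨a', h1, b', h2, h3⟩ := h
  cases h3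
  rw [encode_prod_val, encode_eq_of_decode h1, encode_eq_of_decode h2, Nat.pair_unpair]⟩

theorem ExactEncodable.subtype {α : Type} (i : Encodable α) (h : ExactEncodable α) (p : α → Prop)
    [DecidablePred p] : ExactEncodable (Subtype p) := ⟨fun n ⟨a, ha⟩ h => by
  change decodeSubtype n = _ at h
  simp only [decodeSubtype, Option.bind_eq_some_iff] at h
  obtain ⟨a', h1, h2⟩ := h
  split_ifs at h2 with h3
  cases h2
  exact (encode_eq_of_decode h1 :)⟩

instance [ExactEncodable α] : ExactEncodable (List α) := ⟨fun n => by
  induction n using Nat.strong_induction_on with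
  | _ n ih =>
    intro l h
    cases n with
    | zero => simp_all
    | succ n =>
      rw [decode_list_succ] at h
      obtain ⟨f, h1, h2⟩ := Option.bind_eq_some_iff.1 h
      obtain ⟨a, h3, rfl⟩ := Option.map_eq_some_iff.1 h1
      obtain ⟨l', h4, rfl⟩ := Option.map_eq_some_iff.1 h2
      rw [encode_list_cons, encode_eq_of_decode h3,
        ih _ (Nat.lt_succ_of_le (Nat.unpair_right_le n)) _ h4, Nat.pair_unpair]⟩

instance (n : ℕ) : ExactEncodable (Fin n) := .ofEquiv _ (.subtype _ inferInstance _) _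

theorem ExactEncodable.finArrow [ExactEncodable α] (n : ℕ) :
    @ExactEncodable (Fin n → α) Encodable.finArrow :=
  .ofEquiv _ (.subtype _ inferInstance _) _

theorem ExactEncodable.finPi {α : Type} (i : Encodable α) (h : ExactEncodable α) (n : ℕ) :
    @ExactEncodable (Fin n → α) (Encodable.finPi n fun _ => α) :=
  .ofEquiv _ (.subtype _ (.finArrow (α := Σ _ : Fin n, α) n) _) _

instance : ExactEncodable (Fin 3 → Bool) := .finPi _ inferInstance _

instance [Fintype α] [ExactEncodable β] : ExactEncodable (α → β) :=
  .ofEquiv _ (.finPi _ inferInstance _) _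

instance : ExactEncodable Machine := .ofEquiv _ inferInstance _

/-- The code of a list only depends on the codes of its entries. -/
theorem encode_list_eq_map (l : List α) : encode l = encode (l.map encode) := by
  induction l with
  | nil => rfl
  | cons a l ih => simp [ih]

theorem encode_finArrow_eq {n : ℕ} (f : Fin n → α) :
    @encode (Fin n → α) Encodable.finArrow f = encode (List.ofFn f) := by
  rw [← List.Vector.toList_ofFn]
  rfl

theorem encode_arrow_eq [Fintype α] {f : α → β} {K : List ℕ} (hK : (sortedUniv α).map encode = K)
    {F : ℕ → ℕ} (hF : ∀ a, F (encode a) = encode (f a)) :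
    encode f = encode (K.map fun n => Nat.pair (K.idxOf n) (F n)) := by
  have h1 : encode f =
      encode (List.ofFn fun i =>
        (⟨i, f (fintypeEquivFin.symm i)⟩ : Σ _ : Fin (Fintype.card α), β)) :=
    encode_finArrow_eq fun i => (⟨i, f (fintypeEquivFin.symm i)⟩ : Σ _ : Fin (Fintype.card α), β)
  have hn : K.Nodup := hK ▸ (sortedUniv_nodup α).map encode_injective
  rw [h1, encode_list_eq_map]
  congr 1
  refine List.ext_getElem (by simp [← hK]) fun i h2 h3 => ?_
  have h3 : i < K.length := by simpa using h3
  have h5 : i < (sortedUniv α).length := by simpa [← hK] using h3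
  have h4 : (Equiv.cast (congrArg Fin (length_sortedUniv α))).symm ⟨i, by simpa using h5⟩ =
      (⟨i, h5⟩ : Fin (sortedUniv α).length) := by
    rw [Equiv.symm_apply_eq, Equiv.cast_apply]
    have : ∀ {m n : ℕ} (h : m = n) (hi : i < m) (hi' : i < n),
      (⟨i, hi'⟩ : Fin n) = cast (congrArg Fin h) ⟨i, hi⟩ := by rintro m _ rfl hi hi'; rfl
    exact this (length_sortedUniv α) _ _
  have h6 : K[i] = encode (sortedUniv α)[i] := by simp [← hK]
  rw [List.getElem_map, List.getElem_map, hn.idxOf_getElem, h6, hF]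
  simp [fintypeEquivFin, h4]
  rfl

theorem sortedUniv_map_encode [Fintype α] {B : ℕ} (hB : ∀ a : α, encode a < B) :
    (sortedUniv α).map encode = (List.range B).filter fun n => n ∈ Set.range (encode : α → ℕ) := by
  have h1 : ((sortedUniv α).map encode).Pairwise (· < ·) := by
    rw [List.pairwise_map]
    have h2 := (Finset.pairwise_sort (Finset.univ : Finset α) (Encodable.encode' α ⁻¹'o (· ≤ ·)))
    refine (h2.and (sortedUniv_nodup α)).imp fun h =>
      lt_of_le_of_ne h.1 fun h' => h.2 (encode_injective h')
  refine List.Perm.eq_of_pairwise (le := (· < ·)) (fun a b _ _ h h' => absurd h' h.asymm) h1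
    (List.pairwise_lt_range.filter _) ?_
  rw [List.perm_ext_iff_of_nodup (h1.imp ne_of_lt) (List.nodup_range.filter _)]
  intro n
  simp only [List.mem_map, mem_sortedUniv, true_and, List.mem_filter, List.mem_range, Set.mem_range,
    decide_eq_true_eq]
  exact ⟨fun h => ⟨h.elim fun a h => h ▸ hB a, h⟩, fun h => h.2⟩

end Exact

section Decode

open Encodable

theorem primrec_of_eventually_const {σ : Type} [Primcodable σ] {f : ℕ → σ} {B : ℕ} {d : σ}
    (h : ∀ n, B ≤ n → f n = d) : Primrec f := by
  refine ((Primrec.list_getD d).comp (Primrec.const ((List.range B).map f)) Primrec.id).of_eq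
    fun n => ?_
  rcases lt_or_ge n B with hn | hn
  · simp [List.getD_eq_getElem?_getD, hn]
  · simp [List.getD_eq_getElem?_getD, hn, h n hn]

/-- The code of a triple of bits inside codes of machines. -/
def bitsCode (b : Fin 3 → Bool) : ℕ := @encode (Fin 3 → Bool) (Encodable.finPi 3 fun _ => Bool) b

/-- The triple of bits with a given code. -/
def bitsOf (n : ℕ) : Fin 3 → Bool :=
  (@decode (Fin 3 → Bool) (Encodable.finPi 3 fun _ => Bool) n).getD fun _ => false

theorem bitsOf_bitsCode (b : Fin 3 → Bool) : bitsOf (bitsCode b) = b := by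
  simp [bitsOf, bitsCode]

/-- A strict bound on the codes of triples of bits. -/
noncomputable def bitsBound : ℕ := (Finset.univ.sup bitsCode) + 1

theorem bitsCode_lt (b : Fin 3 → Bool) : bitsCode b < bitsBound :=
  Nat.lt_succ_of_le (Finset.le_sup (Finset.mem_univ b))

theorem primrec_bitsCode : Primrec bitsCode := Primrec.dom_finite _

theorem primrec_bitsOf : Primrec bitsOf := by
  refine primrec_of_eventually_const (B := bitsBound) (d := fun _ => false) fun n hn => ?_
  cases h : @decode (Fin 3 → Bool) (Encodable.finPi 3 fun _ => Bool) n with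
  | none => simp [bitsOf, h]
  | some b =>
    have h1 : bitsCode b = n :=
      (ExactEncodable.finPi (α := Bool) _ inferInstance 3).encode_eq n b h
    exact absurd (bitsCode_lt b) (by omega)

/-- The codes of the arguments of the transition table of a machine with `Q + 1` states. -/
noncomputable def argCodes (Q : ℕ) : List ℕ :=
  (List.range (Nat.pair (Q + 1) bitsBound)).filterMap fun n =>
    if n.unpair.1 ≤ Q ∧ bitsCode (bitsOf n.unpair.2) = n.unpair.2 then some n else none

theorem sortedUniv_eq_argCodes (Q : ℕ) :
    (sortedUniv (Fin (Q + 1) × (Fin 3 → Bool))).map encode = argCodes Q := by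
  rw [sortedUniv_map_encode (B := Nat.pair (Q + 1) bitsBound), argCodes]
  · rw [← List.filterMap_eq_filter]
    refine List.filterMap_congr fun n _ => ?_
    have : n ∈ Set.range (encode : Fin (Q + 1) × (Fin 3 → Bool) → ℕ) ↔
        n.unpair.1 ≤ Q ∧ bitsCode (bitsOf n.unpair.2) = n.unpair.2 := by
      constructor
      · rintro ⟨⟨q, b⟩, rfl⟩
        rw [encode_prod_val, Nat.unpair_pair]
        refine ⟨Nat.le_of_lt_succ q.2, ?_⟩
        change bitsCode (bitsOf (bitsCode b)) = bitsCode b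
        rw [bitsOf_bitsCode]
      · rintro ⟨h1, h2⟩
        refine ⟨(⟨_, Nat.lt_succ_of_le h1⟩, bitsOf n.unpair.2), ?_⟩
        rw [encode_prod_val]
        change Nat.pair n.unpair.1 (bitsCode (bitsOf n.unpair.2)) = n
        rw [h2, Nat.pair_unpair]
    by_cases h : n.unpair.1 ≤ Q ∧ bitsCode (bitsOf n.unpair.2) = n.unpair.2
    · simp [Option.guard, this, h]
    · simp only [Option.guard, this, h]; simp
  · rintro ⟨q, b⟩
    rw [encode_prod_val]
    exact (Nat.pair_lt_pair_left _ q.2).trans (Nat.pair_lt_pair_right _ (bitsCode_lt b))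

theorem primrec_argCodes : Primrec argCodes := by
  have h1 : Primrec fun v : ℕ × ℕ => v.2.unpair.2 :=
    Primrec.snd.comp (Primrec.unpair.comp Primrec.snd)
  have h2 : Primrec fun v : ℕ × ℕ => v.2.unpair.1 :=
    Primrec.fst.comp (Primrec.unpair.comp Primrec.snd)
  have h3 : Primrec₂ fun Q n : ℕ =>
      if n.unpair.1 ≤ Q ∧ bitsCode (bitsOf n.unpair.2) = n.unpair.2 then some n else none :=
    Primrec.ite ((Primrec.nat_le.comp h2 Primrec.fst).and
      (Primrec.eq.comp (primrec_bitsCode.comp (primrec_bitsOf.comp h1)) h1))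
      (Primrec.option_some.comp Primrec.snd) (Primrec.const none)
  exact Primrec.listFilterMap (Primrec.list_range.comp (Primrec₂.natPair.comp
    (Primrec.succ.comp Primrec.id) (Primrec.const bitsBound))) h3

/-- The code of an entry of a transition table with `Q + 1` states. -/
def entryCode (Q : ℕ) (e : ℕ × (Fin 3 → Bool) × Bool) : ℕ :=
  Nat.pair (min e.1 Q) (Nat.pair (bitsCode e.2.1) (encode e.2.2))

/-- The entry of a transition table with a given code. -/
def entryOf (n : ℕ) : ℕ × (Fin 3 → Bool) × Bool :=
  (n.unpair.1, bitsOf n.unpair.2.unpair.1, decide (0 < n.unpair.2.unpair.2))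

theorem encode_entry {Q : ℕ} (e : ℕ × (Fin 3 → Bool) × Bool) (h : min e.1 Q < Q + 1) :
    encode ((⟨min e.1 Q, h⟩, e.2) : Fin (Q + 1) × (Fin 3 → Bool) × Bool) = entryCode Q e := rfl

theorem entryOf_encode {Q : ℕ} (e : Fin (Q + 1) × (Fin 3 → Bool) × Bool) :
    entryOf (encode e) = ((e.1 : ℕ), e.2) := by
  obtain ⟨⟨q, hq⟩, b, d⟩ := e
  have h : encode ((⟨q, hq⟩, b, d) : Fin (Q + 1) × (Fin 3 → Bool) × Bool) =
    Nat.pair q (Nat.pair (bitsCode b) (encode d)) := rfl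
  rw [h]
  cases d <;> simp [entryOf, bitsOf_bitsCode]

/-- The machine with `Q + 1` states described by numerical data. -/
def mkMachine (Q s l h : ℕ) (t : ℕ → (Fin 3 → Bool) → ℕ × (Fin 3 → Bool) × Bool) : Machine where
  Q := Q
  start := ⟨min s Q, Nat.lt_succ_of_le (min_le_right _ _)⟩
  limit := ⟨min l Q, Nat.lt_succ_of_le (min_le_right _ _)⟩
  halt := ⟨min h Q, Nat.lt_succ_of_le (min_le_right _ _)⟩
  trans a := (⟨min (t a.1 a.2).1 Q, Nat.lt_succ_of_le (min_le_right _ _)⟩, (t a.1 a.2).2)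

theorem mkMachine_eq (M : Machine) {t : ℕ → (Fin 3 → Bool) → ℕ × (Fin 3 → Bool) × Bool}
    (ht : ∀ (q : Fin (M.Q + 1)) b, t q b = ((M.trans (q, b)).1.val, (M.trans (q, b)).2)) :
    mkMachine M.Q M.start M.limit M.halt t = M := by
  obtain ⟨Q, s, l, h, f⟩ := M
  have hle : ∀ i : Fin (Q + 1), min i.val Q = i := fun i => min_eq_left (Nat.le_of_lt_succ i.2)
  simp only [mkMachine, ht, hle]

theorem encode_machine (M : Machine) : encode M = Nat.pair M.Q (Nat.pair
    (Nat.pair M.start (Nat.pair M.limit M.halt)) (encode M.trans)) := rfl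

theorem encode_mkMachine (Q s l h : ℕ) (t : ℕ → (Fin 3 → Bool) → ℕ × (Fin 3 → Bool) × Bool) :
    encode (mkMachine Q s l h t) = Nat.pair Q (Nat.pair
      (Nat.pair (min s Q) (Nat.pair (min l Q) (min h Q)))
      (encode ((argCodes Q).map fun n => Nat.pair ((argCodes Q).idxOf n)
        (entryCode Q (t n.unpair.1 (bitsOf n.unpair.2)))))) := by
  have hF : ∀ a : Fin (Q + 1) × (Fin 3 → Bool),
      entryCode Q (t (encode a).unpair.1 (bitsOf (encode a).unpair.2)) =
        encode ((⟨min (t a.1 a.2).1 Q, Nat.lt_succ_of_le (min_le_right _ _)⟩, (t a.1 a.2).2) :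
          Fin (Q + 1) × (Fin 3 → Bool) × Bool) := by
    rintro ⟨q, b⟩
    have h1 : encode ((q, b) : Fin (Q + 1) × (Fin 3 → Bool)) = Nat.pair q (bitsCode b) := rfl
    rw [encode_entry, h1, Nat.unpair_pair, bitsOf_bitsCode]
  rw [encode_machine]
  congr 2
  exact encode_arrow_eq (sortedUniv_eq_argCodes Q)
    (F := fun n => entryCode Q (t n.unpair.1 (bitsOf n.unpair.2))) hF

/-- The code found in a table `L` at the argument with code `n`. -/
noncomputable def lookup (Q : ℕ) (L : List ℕ) (n : ℕ) : ℕ :=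
  (L.getD ((argCodes Q).idxOf n) 0).unpair.2

theorem lookup_encode {Q : ℕ}
    (f : Fin (Q + 1) × (Fin 3 → Bool) → Fin (Q + 1) × (Fin 3 → Bool) × Bool)
    (a : Fin (Q + 1) × (Fin 3 → Bool)) :
    lookup Q (Denumerable.ofNat (List ℕ) (encode f)) (encode a) = encode (f a) := by
  rw [encode_arrow_eq (f := f) (sortedUniv_eq_argCodes Q)
    (F := fun n => ((decode n).map fun a => encode (f a)).getD 0) fun a => by simp,
    Denumerable.ofNat_encode, lookup]
  have h : encode a ∈ argCodes Q := by
    rw [← sortedUniv_eq_argCodes]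
    exact List.mem_map_of_mem (mem_sortedUniv a)
  have h' := List.idxOf_lt_length_iff.2 h
  rw [List.getD_eq_getElem _ _ (by simpa using h'), List.getElem_map, List.getElem_idxOf]
  simp

/-- The entry of the table listed by the code `p` for state `q` and bits `b`. -/
noncomputable def codeTrans (p q : ℕ) (b : Fin 3 → Bool) : ℕ × (Fin 3 → Bool) × Bool :=
  entryOf (lookup p.unpair.1 (Denumerable.ofNat (List ℕ) p.unpair.2.unpair.2)
    (Nat.pair q (bitsCode b)))

/-- The machine read off from a purported code. -/
noncomputable def readMachine (p : ℕ) : Machine :=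
  mkMachine p.unpair.1 p.unpair.2.unpair.1.unpair.1 p.unpair.2.unpair.1.unpair.2.unpair.1
    p.unpair.2.unpair.1.unpair.2.unpair.2 (codeTrans p)

theorem readMachine_encode (M : Machine) : readMachine (encode M) = M := by
  have h : ∀ (q : Fin (M.Q + 1)) b, codeTrans (encode M) q b =
      ((M.trans (q, b)).1.val, (M.trans (q, b)).2) := by
    intro q b
    rw [codeTrans, encode_machine]
    simp only [Nat.unpair_pair]
    rw [← entryOf_encode, ← lookup_encode]
    rfl
  conv_rhs => rw [← mkMachine_eq M h]
  rw [readMachine]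
  simp [encode_machine]

theorem prog_eq (p : ℕ) :
    prog p = if encode (readMachine p) = p then readMachine p else default := by
  split_ifs with h
  · rw [prog]
    conv_lhs => rw [← h]
    simp
  · rw [prog]
    cases hp : (decode p : Option Machine) with
    | none => rfl
    | some M =>
      obtain rfl := encode_eq_of_decode hp
      exact absurd (congrArg encode (readMachine_encode M)) h

theorem primrec_entryOf : Primrec entryOf := by
  have h1 : Primrec fun n : ℕ => n.unpair.1 := Primrec.fst.comp Primrec.unpair
  have h2 : Primrec fun n : ℕ => n.unpair.2 := Primrec.snd.comp Primrec.unpair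
  exact h1.pair ((primrec_bitsOf.comp (h1.comp h2)).pair
    (PrimrecPred.decide (Primrec.nat_lt.comp (Primrec.const 0) (h2.comp h2))))

theorem primrec_entryCode :
    Primrec fun v : ℕ × ℕ × (Fin 3 → Bool) × Bool => entryCode v.1 v.2 := by
  have h : Primrec fun v : ℕ × ℕ × (Fin 3 → Bool) × Bool => v.2.2 := Primrec.snd.comp Primrec.snd
  exact Primrec₂.natPair.comp
    (Primrec.nat_min.comp (Primrec.fst.comp Primrec.snd) Primrec.fst)
    (Primrec₂.natPair.comp (primrec_bitsCode.comp (Primrec.fst.comp h))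
      (Primrec.encode.comp (Primrec.snd.comp h)))

theorem primrec_codeTrans :
    Primrec fun v : ℕ × ℕ × (Fin 3 → Bool) => codeTrans v.1 v.2.1 v.2.2 := by
  have h1 : Primrec fun n : ℕ => n.unpair.1 := Primrec.fst.comp Primrec.unpair
  have h2 : Primrec fun n : ℕ => n.unpair.2 := Primrec.snd.comp Primrec.unpair
  have hq : Primrec fun v : ℕ × ℕ × (Fin 3 → Bool) => Nat.pair v.2.1 (bitsCode v.2.2) :=
    Primrec₂.natPair.comp (Primrec.fst.comp Primrec.snd)
      (primrec_bitsCode.comp (Primrec.snd.comp Primrec.snd))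
  exact primrec_entryOf.comp (h2.comp ((Primrec.list_getD 0).comp
    ((Primrec.ofNat (List ℕ)).comp (h2.comp (h2.comp Primrec.fst)))
    (Primrec.list_idxOf.comp hq (primrec_argCodes.comp (h1.comp Primrec.fst)))))

attribute [irreducible] codeTrans entryCode bitsOf

theorem primrec_encode_readMachine : Primrec fun p => encode (readMachine p) := by
  have h1 : Primrec fun n : ℕ => n.unpair.1 := Primrec.fst.comp Primrec.unpair
  have h2 : Primrec fun n : ℕ => n.unpair.2 := Primrec.snd.comp Primrec.unpair
  have hb : Primrec fun p : ℕ => p.unpair.2.unpair.1 := h1.comp h2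
  have hK : Primrec fun p : ℕ => argCodes p.unpair.1 := primrec_argCodes.comp h1
  have harg : Primrec fun v : ℕ × ℕ => (v.1, v.2.unpair.1, bitsOf v.2.unpair.2) :=
    Primrec.fst.pair ((h1.comp Primrec.snd).pair (primrec_bitsOf.comp (h2.comp Primrec.snd)))
  have htr : Primrec fun v : ℕ × ℕ => codeTrans v.1 v.2.unpair.1 (bitsOf v.2.unpair.2) :=
    primrec_codeTrans.comp harg
  have ht : Primrec fun v : ℕ × ℕ =>
      entryCode v.1.unpair.1 (codeTrans v.1 v.2.unpair.1 (bitsOf v.2.unpair.2)) :=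
    primrec_entryCode.comp ((h1.comp Primrec.fst).pair htr)
  have hT : Primrec fun p : ℕ => (argCodes p.unpair.1).map fun n =>
      Nat.pair ((argCodes p.unpair.1).idxOf n)
        (entryCode p.unpair.1 (codeTrans p n.unpair.1 (bitsOf n.unpair.2))) :=
    Primrec.list_map hK (Primrec₂.natPair.comp
      (Primrec.list_idxOf.comp Primrec.snd (hK.comp Primrec.fst)) ht)
  have hE : Primrec fun p : ℕ => encode ((argCodes p.unpair.1).map fun n =>
      Nat.pair ((argCodes p.unpair.1).idxOf n)
        (entryCode p.unpair.1 (codeTrans p n.unpair.1 (bitsOf n.unpair.2)))) :=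
    Primrec.encode.comp hT
  have hS : Primrec fun p : ℕ => Nat.pair (min p.unpair.2.unpair.1.unpair.1 p.unpair.1)
      (Nat.pair (min p.unpair.2.unpair.1.unpair.2.unpair.1 p.unpair.1)
        (min p.unpair.2.unpair.1.unpair.2.unpair.2 p.unpair.1)) :=
    Primrec₂.natPair.comp (Primrec.nat_min.comp (h1.comp hb) h1) (Primrec₂.natPair.comp
      (Primrec.nat_min.comp (h1.comp (h2.comp hb)) h1)
      (Primrec.nat_min.comp (h2.comp (h2.comp hb)) h1))
  have hall := Primrec₂.natPair.comp h1 (Primrec₂.natPair.comp hS hE)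
  refine hall.of_eq fun p => ?_
  rw [readMachine, encode_mkMachine]

/-- The data of the machine `prog p`, as primitive recursive functions of `p`. -/
theorem exists_primrec_prog : ∃ (st li ha : ℕ → ℕ)
    (tr : ℕ → ℕ → (Fin 3 → Bool) → ℕ × (Fin 3 → Bool) × Bool),
    Primrec st ∧ Primrec li ∧ Primrec ha ∧
    (Primrec fun v : ℕ × ℕ × (Fin 3 → Bool) => tr v.1 v.2.1 v.2.2) ∧
    ∀ p, st p = (prog p).start ∧ li p = (prog p).limit ∧ ha p = (prog p).halt ∧
      ∀ (q : Fin ((prog p).Q + 1)) b,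
        tr p q b = (((prog p).trans (q, b)).1.val, ((prog p).trans (q, b)).2) := by
  have h1 : Primrec fun n : ℕ => n.unpair.1 := Primrec.fst.comp Primrec.unpair
  have h2 : Primrec fun n : ℕ => n.unpair.2 := Primrec.snd.comp Primrec.unpair
  have hb : Primrec fun p : ℕ => p.unpair.2.unpair.1 := h1.comp h2
  have hc : PrimrecPred fun p => encode (readMachine p) = p :=
    Primrec.eq.comp primrec_encode_readMachine Primrec.id
  refine ⟨fun p => if encode (readMachine p) = p then
      min p.unpair.2.unpair.1.unpair.1 p.unpair.1 else 0,
    fun p => if encode (readMachine p) = p then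
      min p.unpair.2.unpair.1.unpair.2.unpair.1 p.unpair.1 else 0,
    fun p => if encode (readMachine p) = p then
      min p.unpair.2.unpair.1.unpair.2.unpair.2 p.unpair.1 else 0,
    fun p q b => if encode (readMachine p) = p then
      (min (codeTrans p q b).1 p.unpair.1, (codeTrans p q b).2) else (0, fun _ => false, true),
    Primrec.ite hc (Primrec.nat_min.comp (h1.comp hb) h1) (Primrec.const 0),
    Primrec.ite hc (Primrec.nat_min.comp (h1.comp (h2.comp hb)) h1) (Primrec.const 0),
    Primrec.ite hc (Primrec.nat_min.comp (h2.comp (h2.comp hb)) h1) (Primrec.const 0),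
    Primrec.ite (hc.comp Primrec.fst) ((Primrec.nat_min.comp (Primrec.fst.comp primrec_codeTrans)
      (h1.comp Primrec.fst)).pair (Primrec.snd.comp primrec_codeTrans)) (Primrec.const _),
    fun p => ?_⟩
  have h := prog_eq p
  by_cases hp : encode (readMachine p) = p
  · rw [if_pos hp] at h
    simp only [if_pos hp]
    rw [h]
    exact ⟨rfl, rfl, rfl, fun q b => rfl⟩
  · rw [if_neg hp] at h
    simp only [if_neg hp]
    rw [h]
    exact ⟨rfl, rfl, rfl, fun q b => rfl⟩

end Decode
end ITTM

namespace ITTM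

open Order

namespace Sys

variable {S X : Type} {B : Sys S X} {Good : S × (X → Bool) → Prop} {b b' b'' : S × (X → Bool)}
  {δ δ' : Ordinal.{0}}

/-- The run from `b` arrives at `b'` after `δ` stages, through configurations satisfying `Good`. -/
def Reach (B : Sys S X) (Good : S × (X → Bool) → Prop) (δ : Ordinal.{0}) (b b' : S × (X → Bool)) :
    Prop :=
  B.run b δ = b' ∧ ∀ ξ < δ, Good (B.run b ξ)

theorem Reach.trans (h : B.Reach Good δ b b') (h' : B.Reach Good δ' b' b'') :
    B.Reach Good (δ + δ') b b'' := by
  refine ⟨by rw [run_add, h.1, h'.1], fun ξ hξ => ?_⟩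
  rcases lt_or_ge ξ δ with hlt | hge
  · exact h.2 ξ hlt
  · obtain ⟨ζ, rfl⟩ := exists_add_of_le hge
    rw [run_add, h.1]
    exact h'.2 ζ (by simpa using hξ)

theorem Reach.step (h : Good b) (h' : B.next b = b') : B.Reach Good 1 b b' := by
  refine ⟨by rw [← zero_add (1 : Ordinal), run_add_one, run_zero, h'], fun ξ hξ => ?_⟩
  rw [Order.lt_one_iff.1 hξ, run_zero]
  exact h

theorem Reach.chain (f : ℕ → S × (X → Bool)) (n : ℕ) (hG : ∀ k < n, Good (f k))
    (h : ∀ k < n, B.next (f k) = f (k + 1)) : B.Reach Good n (f 0) (f n) := by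
  induction n with
  | zero => exact ⟨by simp, by simp⟩
  | succ n ih =>
    rw [Nat.cast_succ]
    exact (ih (fun k hk => hG k (by omega)) fun k hk => h k (by omega)).trans
      (.step (hG n (by omega)) (h n (by omega)))

/-- An infinite chain of steps during which every cell stabilises. -/
theorem Reach.omega (f : ℕ → S × (X → Bool)) (T : X → Bool) (hG : ∀ k, Good (f k))
    (h : ∀ k, B.next (f k) = f (k + 1)) (hT : ∀ x, ∃ n, ∀ k, n ≤ k → (f k).2 x = T x) :
    B.Reach Good Ordinal.omega0 (f 0) (B.lim, T) := by
  have hf : ∀ k : ℕ, B.run (f 0) k = f k := fun k =>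
    (Reach.chain (Good := Good) f k (fun k _ => hG k) fun k _ => h k).1
  refine ⟨Prod.ext (run_limit_fst _ _ Ordinal.isSuccLimit_omega0) (funext fun x => ?_),
    fun ξ hξ => ?_⟩
  · obtain ⟨n, hn⟩ := hT x
    refine run_limit_const _ _ Ordinal.isSuccLimit_omega0 (Ordinal.natCast_lt_omega0 n)
      fun γ h1 h2 => ?_
    obtain ⟨k, rfl⟩ := Ordinal.lt_omega0.1 h2
    rw [hf]
    exact hn k (by exact_mod_cast h1)
  · obtain ⟨k, rfl⟩ := Ordinal.lt_omega0.1 hξ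
    rw [hf]
    exact hG k

/-- A property preserved by steps and at limits holds throughout a run. -/
theorem run_invariant {Inv : S × (X → Bool) → Prop} (h0 : Inv b)
    (hn : ∀ c, Inv c → Inv (B.next c))
    (hl : ∀ α, IsSuccLimit α → (∀ β < α, Inv (B.run b β)) → Inv (B.run b α)) (α : Ordinal) :
    Inv (B.run b α) := by
  induction α using Ordinal.limitRecOn with
  | zero => simpa using h0
  | add_one α ih => rw [run_add_one]; exact hn _ ih
  | limit α hα ih => exact hl α hα ih

end Sys

/-- The cells that hold the three tapes of a simulated machine in row `r`. -/
def rowCell (r : ℕ) (x : Fin 3 × ℕ) : Fin 5 × ℕ := (Fin.castLE (by omega) x.1, Nat.pair r x.2)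

/-- Overwrite the first three of five bits. -/
def mergeBits (c : Fin 5 → Bool) (d : Fin 3 → Bool) (t : Fin 5) : Bool :=
  if h : t.val < 3 then d ⟨t, h⟩ else c t

theorem rowCell_ne (r : ℕ) (x : Fin 3 × ℕ) {t : Fin 5} (ht : 3 ≤ t.val) (n : ℕ) :
    (t, n) ≠ rowCell r x := by
  intro h
  have h1 : t.val = x.1.val := congrArg (fun y : Fin 5 × ℕ => y.1.val) h
  have h2 := x.1.2
  omega

/-- The relation between a configuration of a machine and a configuration of a system that
simulates it in row `r`. -/
def RowRel {σ : Type} (M : Machine) (r : ℕ) (s : ℕ → ℕ → σ) (v : Fin 5 × ℕ → Bool)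
    (a : (Fin (M.Q + 1) × ℕ) × (Fin 3 × ℕ → Bool)) (b : σ × (Fin 5 × ℕ → Bool)) : Prop :=
  b.1 = s a.1.1 a.1.2 ∧ (∀ x, b.2 (rowCell r x) = a.2 x) ∧
    (∀ y, (∀ x, y ≠ rowCell r x) → y ≠ (4, 0) → b.2 y = v y) ∧ b.2 (4, 0) = true

/-- A system that steps through the table of `M` on row `r`, and that at limit stages recovers
its control state by counting up to `k`, simulates `M`. -/
theorem row_simulation {σ : Type} (B : Sys σ (Fin 5 × ℕ)) (halt : σ) (M : Machine) (r : ℕ)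
    (s : ℕ → ℕ → σ) (cnt : ℕ → σ) (res : σ) (k : ℕ) (v : Fin 5 × ℕ → Bool)
    (hs : ∀ (q : Fin (M.Q + 1)) h T, q ≠ M.halt → B.next (s q h, T) =
      (s (M.trans (q, fun i => T (rowCell r (i, h)))).1
        (if (M.trans (q, fun i => T (rowCell r (i, h)))).2.2 then h + 1 else h - 1),
        fun y => if y.2 = Nat.pair r h then
          mergeBits (fun t => T (t, Nat.pair r h))
            (M.trans (q, fun i => T (rowCell r (i, h)))).2.1 y.1 else T y))
    (hlim : ∀ T, T (4, 0) = true → (∀ y, (∀ x, y ≠ rowCell r x) → y ≠ (4, 0) → T y = v y) →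
      B.next (B.lim, T) = (cnt 0, Function.update T (4, 0) false))
    (hcnt : ∀ T, (∀ y, (∀ x, y ≠ rowCell r x) → y ≠ (4, 0) → T y = v y) →
      (∀ j < k, B.next (cnt j, T) = (cnt (j + 1), T)) ∧ B.next (cnt k, T) = (res, T))
    (hres : ∀ T, B.next (res, T) = (s M.limit 0, Function.update T (4, 0) true))
    (h1 : ∀ q h, s q h ≠ halt) (h2 : B.lim ≠ halt) (h3 : ∀ j, cnt j ≠ halt) (h4 : res ≠ halt) :
    Sys.Simulation M.toHM.sys B (fun c => c.1 = M.halt) (· = halt) (RowRel M r s v) (rowCell r)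
      {y | (∀ x, y ≠ rowCell r x) ∧ y ≠ (4, 0)} v {(4, 0)} where
  tape a b h := h.2.1
  flag a b h y hy := by rw [hy]; exact h.2.2.2
  step := by
    rintro ⟨⟨q, h⟩, T⟩ ⟨s', T'⟩ ⟨rfl, hr, hz, hg⟩ hq
    simp only at hr hz hg hq
    refine ⟨_, ?_, .single ⟨⟨h1 _ _, fun x => .inl (hr x), fun z hz' => hz z hz'.1 hz'.2⟩, rfl⟩⟩
    have hT : (fun i => T' (rowCell r (i, h))) = fun i => T (i, h) := funext fun i => hr _
    rw [hs q h T' hq, hT]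
    refine ⟨rfl, fun x => ?_, fun y hy hy' => ?_, ?_⟩
    · by_cases hx : x.2 = h
      · obtain ⟨i, n⟩ := x
        obtain rfl : n = h := hx
        simp [rowCell, HM.sys_next, mergeBits, Machine.toHM]
      · have hx' : (rowCell r x).2 ≠ Nat.pair r h := by simpa [rowCell] using hx
        simp only [HM.sys_next, if_neg hx', if_neg hx]
        exact hr x
    · rw [← hz y hy hy']
      simp only
      split_ifs with hy2
      · rw [mergeBits, dif_neg, ← hy2]
        intro hlt
        exact hy (⟨y.1, hlt⟩, h) (Prod.ext rfl hy2)
      · rfl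
    · simp only
      split_ifs with hy2
      · rw [mergeBits, dif_neg (by decide), ← hy2]
        exact hg
      · exact hg
  limit := by
    intro T T' hr hz hp
    have hg : T' (4, 0) = true := hp _ rfl
    set U := Function.update T' (4, 0) false with hU
    have hUne : ∀ y, y ≠ (4, 0) → U y = T' y := fun y hy => Function.update_of_ne hy _ _
    have hUz : ∀ y, (∀ x, y ≠ rowCell r x) → y ≠ (4, 0) → U y = v y := fun y hy hy' =>
      (hUne y hy').trans (hz y ⟨hy, hy'⟩)
    have hUr : ∀ x, U (rowCell r x) = T x := fun x =>
      (hUne _ (rowCell_ne _ _ (by decide) _).symm).trans (hr x)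
    let Good : σ × (Fin 5 × ℕ → Bool) → Prop := fun d => d.1 ≠ halt ∧
      (∀ x, d.2 (rowCell r x) = T x) ∧
      ∀ z ∈ {y | (∀ x, y ≠ rowCell r x) ∧ y ≠ ((4, 0) : Fin 5 × ℕ)}, d.2 z = v z
    have e1 : B.Reach Good 1 (B.lim, T') (cnt 0, U) :=
      .step ⟨h2, hr, hz⟩ (hlim T' hg fun y hy hy' => hz y ⟨hy, hy'⟩)
    have e2 : B.Reach Good k (cnt 0, U) (cnt k, U) :=
      .chain (fun j => (cnt j, U)) k (fun j _ => ⟨h3 j, hUr, fun z hz' => hUz z hz'.1 hz'.2⟩)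
        (hcnt U hUz).1
    have e3 : B.Reach Good 1 (cnt k, U) (res, U) :=
      .step ⟨h3 k, hUr, fun z hz' => hUz z hz'.1 hz'.2⟩ (hcnt U hUz).2
    have e4 : B.Reach Good 1 (res, U) (s M.limit 0, T') := by
      refine .step ⟨h4, hUr, fun z hz' => hUz z hz'.1 hz'.2⟩ ?_
      rw [hres, hU, Function.update_idem, ← hg, Function.update_eq_self]
    obtain ⟨e, e'⟩ := ((e1.trans e2).trans e3).trans e4
    refine ⟨_, ?_, e'⟩
    rw [e]
    exact ⟨rfl, hr, fun y hy hy' => hz y ⟨hy, hy'⟩, hg⟩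

/-- Control states of the programs below: a tag followed by parameters. -/
abbrev Ctl := ℕ × ℕ × ℕ × ℕ

theorem Ctl.encode_start : Encodable.encode ((0, 0, 0, 0) : Ctl) = 0 := by
  simp [Nat.pair]

theorem Ctl.encode_lim : Encodable.encode ((0, 0, 0, 1) : Ctl) = 1 := by
  simp [Nat.pair]

/-- Numerical presentation of the tables of all programs. -/
structure Tables where
  st : ℕ → ℕ
  li : ℕ → ℕ
  ha : ℕ → ℕ
  tr : ℕ → ℕ → (Fin 3 → Bool) → ℕ × (Fin 3 → Bool) × Bool
  primrec_st : Primrec st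
  primrec_li : Primrec li
  primrec_ha : Primrec ha
  primrec_tr : Primrec fun v : ℕ × ℕ × (Fin 3 → Bool) => tr v.1 v.2.1 v.2.2
  st_eq : ∀ p, st p = (prog p).start
  li_eq : ∀ p, li p = (prog p).limit
  ha_eq : ∀ p, ha p = (prog p).halt
  tr_eq : ∀ p (q : Fin ((prog p).Q + 1)) b,
    tr p q b = (((prog p).trans (q, b)).1.val, ((prog p).trans (q, b)).2)

theorem nonempty_tables : Nonempty Tables := by
  obtain ⟨st, li, ha, tr, h1, h2, h3, h4, h5⟩ := exists_primrec_prog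
  exact ⟨⟨st, li, ha, tr, h1, h2, h3, h4, fun p => (h5 p).1, fun p => (h5 p).2.1,
    fun p => (h5 p).2.2.1, fun p => (h5 p).2.2.2⟩⟩

/-- The first three of five bits. -/
def simBits (c : Fin 5 → Bool) (i : Fin 3) : Bool := c (Fin.castLE (by omega) i)

namespace Tables

variable (Θ : Tables)

/-- One simulated step of program `p`; `k` is the number of the task. -/
def simStep (k p q h : ℕ) (c : Fin 5 → Bool) : Ctl × (Fin 5 → Bool) :=
  ((6, k, (Θ.tr p q (simBits c)).1,
    if (Θ.tr p q (simBits c)).2.2 = true then h + 1 else h - 1),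
    mergeBits c (Θ.tr p q (simBits c)).2.1)

theorem primrec_simStep : Primrec fun v : ℕ × ℕ × ℕ × ℕ × (Fin 5 → Bool) =>
    Θ.simStep v.1 v.2.1 v.2.2.1 v.2.2.2.1 v.2.2.2.2 := by
  have h1 : Primrec fun v : ℕ × ℕ × ℕ × ℕ × (Fin 5 → Bool) => v.2.2.2.2 :=
    Primrec.snd.comp (Primrec.snd.comp (Primrec.snd.comp Primrec.snd))
  have hh : Primrec fun v : ℕ × ℕ × ℕ × ℕ × (Fin 5 → Bool) => v.2.2.2.1 :=
    Primrec.fst.comp (Primrec.snd.comp (Primrec.snd.comp Primrec.snd))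
  have hb : Primrec simBits := Primrec.dom_finite _
  have ht : Primrec fun v : ℕ × ℕ × ℕ × ℕ × (Fin 5 → Bool) =>
      Θ.tr v.2.1 v.2.2.1 (simBits v.2.2.2.2) :=
    (Θ.primrec_tr.comp ((Primrec.fst.comp Primrec.snd).pair
      ((Primrec.fst.comp (Primrec.snd.comp Primrec.snd)).pair (hb.comp h1)))).of_eq fun _ => rfl
  have hm : Primrec fun v : (Fin 5 → Bool) × (Fin 3 → Bool) => mergeBits v.1 v.2 :=
    Primrec.dom_finite _
  have hc := Primrec.ite (Primrec.eq.comp (Primrec.snd.comp (Primrec.snd.comp ht))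
    (Primrec.const true)) (Primrec.succ.comp hh) (Primrec.pred.comp hh)
  have hout := hm.comp (h1.pair (Primrec.fst.comp (Primrec.snd.comp ht)))
  exact (((Primrec.const 6).pair (Primrec.fst.pair ((Primrec.fst.comp ht).pair hc))).pair
    hout).of_eq fun _ => rfl

/-- One step of the universal program. The bits with index a multiple of `e` of the input list the
number of a program; the other bits are the input to it. Track 3 holds, in cell 0, the mark that
the input is ill-formed, and track 4, in cell 0, the mark that a simulation is under way. -/
def univStep (e : ℕ) (s : Ctl) (x : Bool) (c : Fin 5 → Bool) : Ctl × (Fin 5 → Bool) :=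
  if s.1 = 0 then
    if s.2.2.2 = 0 then ((4, 0, 2, 0), c)
    else if c 3 = true then ((3, 0, 0, 0), c)
    else ((4, 0, if c 4 = true then 1 else 0, 0), Function.update c 4 false)
  else if s.1 = 2 then
    if s.2.2.1 % e = 0 then
      if x = decide (s.2.2.1 < e * s.2.1) then ((2, s.2.1, s.2.2.1 + 1, 0), c)
      else ((3, 0, 0, 0), c)
    else ((2, s.2.1, s.2.2.1 + 1, 0), Function.update c 0 x)
  else if s.1 = 3 then ((3, 0, 0, 0), Function.update c 3 true)
  else if s.1 = 4 then
    if x = true then ((4, s.2.1 + 1, s.2.2.1, 0), c)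
    else if s.2.2.1 = 2 then ((2, s.2.1, 0, 0), c)
    else ((5, s.2.1, s.2.2.1, 0), c)
  else if s.1 = 5 then
    ((6, s.2.1, if s.2.2.1 = 0 then Θ.st s.2.1 else Θ.li s.2.1, 0), Function.update c 4 true)
  else if s.1 = 6 then
    if s.2.2.1 = Θ.ha s.2.1 then ((1, 0, 0, 0), c)
    else Θ.simStep s.2.1 s.2.1 s.2.2.1 s.2.2.2 c
  else (s, c)

theorem primrec_update (i : Fin 5) :
    Primrec fun v : (Fin 5 → Bool) × Bool => (Function.update v.1 i v.2 : Fin 5 → Bool) :=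
  Primrec.dom_finite _

theorem primrec_univStep (e : ℕ) : Primrec fun v : Ctl × Bool × (Fin 5 → Bool) =>
    Θ.univStep e v.1 v.2.1 v.2.2 := by
  have s0 : Primrec fun v : Ctl × Bool × (Fin 5 → Bool) => v.1.1 := Primrec.fst.comp Primrec.fst
  have s' : Primrec fun v : Ctl × Bool × (Fin 5 → Bool) => v.1.2 := Primrec.snd.comp Primrec.fst
  have s1 : Primrec fun v : Ctl × Bool × (Fin 5 → Bool) => v.1.2.1 := Primrec.fst.comp s'
  have s2 : Primrec fun v : Ctl × Bool × (Fin 5 → Bool) => v.1.2.2.1 :=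
    Primrec.fst.comp (Primrec.snd.comp s')
  have s3 : Primrec fun v : Ctl × Bool × (Fin 5 → Bool) => v.1.2.2.2 :=
    Primrec.snd.comp (Primrec.snd.comp s')
  have hx : Primrec fun v : Ctl × Bool × (Fin 5 → Bool) => v.2.1 := Primrec.fst.comp Primrec.snd
  have hc : Primrec fun v : Ctl × Bool × (Fin 5 → Bool) => v.2.2 := Primrec.snd.comp Primrec.snd
  have hb (i : Fin 5) : Primrec fun v : Ctl × Bool × (Fin 5 → Bool) => v.2.2 i :=
    (Primrec.dom_finite fun c : Fin 5 → Bool => c i).comp hc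
  have tag (n : ℕ) : PrimrecPred fun v : Ctl × Bool × (Fin 5 → Bool) => v.1.1 = n :=
    Primrec.eq.comp s0 (Primrec.const n)
  have bit {f : Ctl × Bool × (Fin 5 → Bool) → Bool} (hf : Primrec f) :
      PrimrecPred fun v => f v = true := Primrec.eq.comp hf (Primrec.const true)
  have zro {f : Ctl × Bool × (Fin 5 → Bool) → ℕ} (n : ℕ) (hf : Primrec f) :
      PrimrecPred fun v => f v = n := Primrec.eq.comp hf (Primrec.const n)
  have up (i : Fin 5) {f : Ctl × Bool × (Fin 5 → Bool) → Bool} (hf : Primrec f) :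
      Primrec fun v => (Function.update v.2.2 i (f v) : Fin 5 → Bool) :=
    ((primrec_update i).comp (hc.pair hf)).of_eq fun _ => rfl
  have k0 := Primrec.const (α := Ctl × Bool × (Fin 5 → Bool)) (0 : ℕ)
  have dead := Primrec.const (α := Ctl × Bool × (Fin 5 → Bool)) ((3, 0, 0, 0) : Ctl)
  have nxt : Primrec fun v : Ctl × Bool × (Fin 5 → Bool) =>
      ((2, v.1.2.1, v.1.2.2.1 + 1, 0) : Ctl) :=
    (Primrec.const 2).pair (s1.pair ((Primrec.succ.comp s2).pair k0))
  have h6 := Primrec.ite (tag 6) (Primrec.ite (Primrec.eq.comp s2 (Θ.primrec_ha.comp s1))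
    ((Primrec.const ((1, 0, 0, 0) : Ctl)).pair hc) (Θ.primrec_simStep.comp
      (s1.pair (s1.pair (s2.pair (s3.pair hc)))))) (Primrec.fst.pair hc)
  have h5 := Primrec.ite (tag 5) (((Primrec.const 6).pair (s1.pair (Primrec.pair
    (Primrec.ite (zro 0 s2) (Θ.primrec_st.comp s1) (Θ.primrec_li.comp s1)) k0))).pair
      (up 4 (Primrec.const true))) h6
  have h4 := Primrec.ite (tag 4) (Primrec.ite (bit hx)
    (((Primrec.const 4).pair ((Primrec.succ.comp s1).pair (s2.pair k0))).pair hc)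
    (Primrec.ite (zro 2 s2) (((Primrec.const 2).pair (s1.pair (k0.pair k0))).pair hc)
      (((Primrec.const 5).pair (s1.pair (s2.pair k0))).pair hc))) h5
  have h3 := Primrec.ite (tag 3) (dead.pair (up 3 (Primrec.const true))) h4
  have h2 := Primrec.ite (tag 2) (Primrec.ite (zro 0 (Primrec.nat_mod.comp s2 (Primrec.const e)))
    (Primrec.ite (Primrec.eq.comp hx (Primrec.nat_lt.comp s2
      (Primrec.nat_mul.comp (Primrec.const e) s1)).decide) (nxt.pair hc) (dead.pair hc))
    (nxt.pair (up 0 hx))) h3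
  have h0 := Primrec.ite (tag 0) (Primrec.ite (zro 0 s3)
    ((Primrec.const ((4, 0, 2, 0) : Ctl)).pair hc)
    (Primrec.ite (bit (hb 3)) (dead.pair hc) (Primrec.pair ((Primrec.const 4).pair (k0.pair
      (Primrec.pair (Primrec.ite (bit (hb 4)) (Primrec.const 1) k0) k0)))
        (up 4 (Primrec.const false))))) h2
  exact h0.of_eq fun _ => rfl

/-- The universal program. -/
def univProg (e : ℕ) : Prog 5 Ctl where
  addr s := if s.1 = 2 then Nat.pair 0 (s.2.2.1 / 2) else if s.1 = 6 then Nat.pair 0 s.2.2.2 else 0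
  iaddr s := if s.1 = 2 then s.2.2.1 else e * s.2.1
  next s x c := (Θ.univStep e s x c).1
  out s x c := (Θ.univStep e s x c).2
  lim := (0, 0, 0, 1)

theorem univProg_effective (e : ℕ) : (Θ.univProg e).Effective where
  addr := by
    have s2 : Primrec fun s : Ctl => s.2.2.1 := Primrec.fst.comp (Primrec.snd.comp Primrec.snd)
    have s3 : Primrec fun s : Ctl => s.2.2.2 := Primrec.snd.comp (Primrec.snd.comp Primrec.snd)
    exact Primrec.ite (Primrec.eq.comp Primrec.fst (Primrec.const 2))
      (Primrec₂.natPair.comp (Primrec.const 0) (Primrec.nat_div.comp s2 (Primrec.const 2)))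
      (Primrec.ite (Primrec.eq.comp Primrec.fst (Primrec.const 6))
        (Primrec₂.natPair.comp (Primrec.const 0) s3) (Primrec.const 0))
  iaddr := by
    have s2 : Primrec fun s : Ctl => s.2.2.1 := Primrec.fst.comp (Primrec.snd.comp Primrec.snd)
    exact Primrec.ite (Primrec.eq.comp Primrec.fst (Primrec.const 2)) s2
      (Primrec.nat_mul.comp (Primrec.const e) (Primrec.fst.comp Primrec.snd))
  next := Primrec.fst.comp (Θ.primrec_univStep e)
  out := Primrec.snd.comp (Θ.primrec_univStep e)

end Tables

section ProgSteps

variable {K : ℕ} {σ : Type} {P : Prog K σ} {w : R} {s s' : σ} {T : Fin K × ℕ → Bool}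

theorem Prog.sys_next_same {a i : ℕ} (ha : P.addr s = a) (hi : P.iaddr s = i)
    (h : P.next s (w i) (fun t => T (t, a)) = s')
    (ho : P.out s (w i) (fun t => T (t, a)) = fun t => T (t, a)) :
    (P.sys w).next (s, T) = (s', T) := by
  subst ha hi
  refine Prod.ext h (funext fun y => ?_)
  simp only [Prog.sys]
  split_ifs with hy
  · rw [ho, ← hy]
  · rfl

theorem Prog.sys_next_update {a i : ℕ} (ha : P.addr s = a) (hi : P.iaddr s = i) {j : Fin K}
    {x : Bool} (h : P.next s (w i) (fun t => T (t, a)) = s')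
    (ho : P.out s (w i) (fun t => T (t, a)) = Function.update (fun t => T (t, a)) j x) :
    (P.sys w).next (s, T) = (s', Function.update T (j, a) x) := by
  subst ha hi
  refine Prod.ext h (funext fun y => ?_)
  simp only [Prog.sys]
  split_ifs with hy
  · obtain ⟨t, n⟩ := y
    obtain rfl : n = _ := hy
    rw [ho]
    by_cases ht : t = j
    · subst ht; simp
    · rw [Function.update_of_ne ht, Function.update_of_ne (by simp [ht])]
  · rw [Function.update_of_ne]
    rintro rfl
    exact hy rfl

end ProgSteps

namespace Tables

variable (Θ : Tables) {e : ℕ} {w : R} {T : Fin 5 × ℕ → Bool}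

theorem univ_start : ((Θ.univProg e).sys w).next ((0, 0, 0, 0), T) = ((4, 0, 2, 0), T) :=
  Prog.sys_next_same rfl rfl rfl rfl

theorem univ_lim (h3 : T (3, 0) = false) :
    ((Θ.univProg e).sys w).next ((0, 0, 0, 1), T) =
      ((4, 0, if T (4, 0) = true then 1 else 0, 0), Function.update T (4, 0) false) := by
  refine Prog.sys_next_update rfl rfl ?_ ?_ <;> simp [univProg, univStep, h3]

theorem univ_lim_dead (h3 : T (3, 0) = true) :
    ((Θ.univProg e).sys w).next ((0, 0, 0, 1), T) = ((3, 0, 0, 0), T) := by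
  refine Prog.sys_next_same rfl rfl ?_ ?_ <;> simp [univProg, univStep, h3]

theorem univ_dead : ((Θ.univProg e).sys w).next ((3, 0, 0, 0), T) =
    ((3, 0, 0, 0), Function.update T (3, 0) true) :=
  Prog.sys_next_update rfl rfl rfl rfl

theorem univ_count {k f : ℕ} (h : w (e * k) = true) :
    ((Θ.univProg e).sys w).next ((4, k, f, 0), T) = ((4, k + 1, f, 0), T) := by
  refine Prog.sys_next_same (a := 0) (i := e * k) rfl rfl ?_ ?_ <;> simp [univProg, univStep, h]

theorem univ_count_end {k f : ℕ} (h : w (e * k) = false) (hf : f ≠ 2) :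
    ((Θ.univProg e).sys w).next ((4, k, f, 0), T) = ((5, k, f, 0), T) := by
  refine Prog.sys_next_same (a := 0) (i := e * k) rfl rfl ?_ ?_ <;> simp [univProg, univStep, h, hf]

theorem univ_count_copy {k : ℕ} (h : w (e * k) = false) :
    ((Θ.univProg e).sys w).next ((4, k, 2, 0), T) = ((2, k, 0, 0), T) := by
  refine Prog.sys_next_same (a := 0) (i := e * k) rfl rfl ?_ ?_ <;> simp [univProg, univStep, h]

theorem univ_restore {k f : ℕ} : ((Θ.univProg e).sys w).next ((5, k, f, 0), T) =
    ((6, k, if f = 0 then Θ.st k else Θ.li k, 0), Function.update T (4, 0) true) :=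
  Prog.sys_next_update (a := 0) (i := e * k) rfl rfl rfl rfl

theorem univ_check {k i : ℕ} (hi : i % e = 0) (h : w i = decide (i < e * k)) :
    ((Θ.univProg e).sys w).next ((2, k, i, 0), T) = ((2, k, i + 1, 0), T) := by
  refine Prog.sys_next_same (a := Nat.pair 0 (i / 2)) (i := i) rfl rfl ?_ ?_ <;>
    simp [univProg, univStep, h, hi]

theorem univ_check_dead {k i : ℕ} (hi : i % e = 0) (h : w i ≠ decide (i < e * k)) :
    ((Θ.univProg e).sys w).next ((2, k, i, 0), T) = ((3, 0, 0, 0), T) := by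
  refine Prog.sys_next_same (a := Nat.pair 0 (i / 2)) (i := i) rfl rfl ?_ ?_ <;>
    simp [univProg, univStep, h, hi]

theorem univ_copy {k i : ℕ} (hi : i % e ≠ 0) :
    ((Θ.univProg e).sys w).next ((2, k, i, 0), T) =
      ((2, k, i + 1, 0), Function.update T (0, Nat.pair 0 (i / 2)) (w i)) := by
  refine Prog.sys_next_update (a := Nat.pair 0 (i / 2)) (i := i) rfl rfl ?_ ?_ <;>
    simp [univProg, univStep, hi]

theorem univ_sim_halt {k h : ℕ} :
    ((Θ.univProg e).sys w).next ((6, k, Θ.ha k, h), T) = ((1, 0, 0, 0), T) := by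
  refine Prog.sys_next_same (a := Nat.pair 0 h) (i := e * k) rfl rfl ?_ ?_ <;>
    simp [univProg, univStep]

theorem simStep_eq (k p h : ℕ) (q : Fin ((prog p).Q + 1)) (c : Fin 5 → Bool) :
    Θ.simStep k p q h c = ((6, k, (((prog p).trans (q, simBits c)).1 : ℕ),
      if ((prog p).trans (q, simBits c)).2.2 then h + 1 else h - 1),
      mergeBits c ((prog p).trans (q, simBits c)).2.1) := by
  rw [simStep, Θ.tr_eq]

theorem univ_sim {k h : ℕ} (q : Fin ((prog k).Q + 1)) (hq : q ≠ (prog k).halt) :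
    ((Θ.univProg e).sys w).next ((6, k, q, h), T) =
      ((6, k, (((prog k).trans (q, fun i => T (rowCell 0 (i, h)))).1 : ℕ),
        if ((prog k).trans (q, fun i => T (rowCell 0 (i, h)))).2.2 then h + 1 else h - 1),
        fun y => if y.2 = Nat.pair 0 h then mergeBits (fun t => T (t, Nat.pair 0 h))
          ((prog k).trans (q, fun i => T (rowCell 0 (i, h)))).2.1 y.1 else T y) := by
  have hq' : (q : ℕ) ≠ Θ.ha k := by rwa [Θ.ha_eq, Ne, ← Fin.ext_iff]
  have hstep : ∀ x c, Θ.univStep e (6, k, q, h) x c = Θ.simStep k k q h c := by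
    intro x c
    simp [univStep, hq']
  simp only [Prog.sys, univProg, hstep, simStep_eq]
  rfl

/-- The simulation of program `k` by the universal program. -/
theorem univ_simulation (e k : ℕ) (w : R) (hw : ∀ i < k, w (e * i) = true)
    (hw' : w (e * k) = false) (v : Fin 5 × ℕ → Bool) (hv : v (3, 0) = false) :
    Sys.Simulation (prog k).toHM.sys ((Θ.univProg e).sys w) (fun c => c.1 = (prog k).halt)
      (· = (1, 0, 0, 0)) (RowRel (prog k) 0 (fun q h => (6, k, q, h)) v) (rowCell 0)
      {y | (∀ x, y ≠ rowCell 0 x) ∧ y ≠ (4, 0)} v {(4, 0)} := by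
  refine row_simulation _ _ (prog k) 0 _ (fun j => (4, j, 1, 0)) (5, k, 1, 0) k v
    (fun q h T hq => Θ.univ_sim q hq) (fun T hT hz => ?_) (fun T _ => ⟨fun j hj =>
      Θ.univ_count (hw j hj), Θ.univ_count_end hw' (by simp)⟩) (fun T => ?_) (by simp)
    (by simp [Prog.sys, univProg]) (by simp) (by simp)
  · have h3 : T (3, 0) = false := by
      rw [← hv]
      exact hz _ (fun x => rowCell_ne _ _ (by decide) _) (by simp)
    have := Θ.univ_lim (e := e) (w := w) h3
    rwa [if_pos hT] at this
  · rw [univ_restore, if_neg (by simp), Θ.li_eq]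

end Tables

theorem Sys.FirstHit.unique {S X : Type} {A : Sys S X} {hA : S → Prop} {a : S × (X → Bool)}
    {α β : Ordinal.{0}} (h : A.FirstHit hA a α) (h' : A.FirstHit hA a β) : α = β := by
  rcases lt_trichotomy α β with hlt | rfl | hlt
  · exact absurd h.1 (h'.2 α hlt)
  · rfl
  · exact absurd h'.1 (h.2 β hlt)

theorem Sys.Slower.exists_iff {S X S' X' : Type} {A : Sys S X} {B : Sys S' X'} {hA : S → Prop}
    {hB : S' → Prop} {a : S × (X → Bool)} {b : S' × (X' → Bool)} (h : Slower A hA a B hB b) :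
    (∃ α, hA (A.run a α).1) ↔ ∃ α, hB (B.run b α).1 := by
  constructor
  · rintro ⟨α, hα⟩
    obtain ⟨β, hβ⟩ := exists_firstHit hα
    obtain ⟨γ, -, hγ⟩ := h.1 β hβ
    exact ⟨γ, hγ.1⟩
  · rintro ⟨α, hα⟩
    by_contra hne
    exact h.2 (fun β hβ => hne ⟨β, hβ⟩) α hα

theorem Machine.halts_iff_run (M : Machine) (x : R) : M.halts x ↔
    ∃ α, (M.toHM.sys.run ((M.start, 0), HM.inputTape 0 x) α).1.1 = M.halt :=
  exists_congr fun α => M.haltedAt_iff x α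

/-- Contents of the tapes after the universal program has copied `j` bits of its input. -/
noncomputable def copyTape (e : ℕ) (w : R) (j : ℕ) : Fin 5 × ℕ → Bool := fun y =>
  decide (∃ n, y = (0, Nat.pair 0 n) ∧ 2 * n + 1 < j ∧ (2 * n + 1) % e ≠ 0 ∧ w (2 * n + 1) = true)

theorem copyTape_zero (e : ℕ) (w : R) : copyTape e w 0 = fun _ => false := by
  funext y; simp [copyTape]

theorem copyTape_check {e : ℕ} {w : R} {i : ℕ} (hi : i % e = 0) :
    copyTape e w (i + 1) = copyTape e w i := by
  funext y
  refine decide_eq_decide.2 (exists_congr fun n => and_congr_right fun _ =>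
    ⟨fun h => ⟨lt_of_le_of_ne (by omega) ?_, h.2⟩, fun h => ⟨by omega, h.2⟩⟩)
  rintro rfl
  exact h.2.1 hi

theorem copyTape_copy {e : ℕ} (he : e = 1 ∨ e = 2) {w : R} {i : ℕ} (hi : i % e ≠ 0) :
    copyTape e w (i + 1) = Function.update (copyTape e w i) (0, Nat.pair 0 (i / 2)) (w i) := by
  obtain ⟨m, rfl⟩ : ∃ m, i = 2 * m + 1 := by
    rcases he with rfl | rfl
    · omega
    · exact ⟨i / 2, by omega⟩
  have hm : (2 * m + 1) / 2 = m := by omega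
  rw [hm]
  funext y
  by_cases hy : y = (0, Nat.pair 0 m)
  · subst hy
    rw [Function.update_self, copyTape, Bool.eq_iff_iff, decide_eq_true_iff]
    constructor
    · rintro ⟨n, h1, -, -, h4⟩
      obtain rfl : m = n := by simpa using h1
      exact h4
    · exact fun h => ⟨m, rfl, by omega, hi, h⟩
  · rw [Function.update_of_ne hy]
    refine decide_eq_decide.2 (exists_congr fun n => and_congr_right fun h0 =>
      ⟨fun h => ⟨lt_of_le_of_ne (by omega) ?_, h.2⟩, fun h => ⟨by omega, h.2⟩⟩)
    intro h1
    exact hy (by rw [h0, show n = m by omega])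

/-- The bits of an input of the universal program that are passed on to the simulated program. -/
def passedInput (e : ℕ) (w : R) : R := fun n => decide ((2 * n + 1) % e ≠ 0 ∧ w (2 * n + 1) = true)

namespace Tables

variable (Θ : Tables) {e : ℕ} {w : R}

theorem univ_reach_copy {p : ℕ} (hw : ∀ i < p, w (e * i) = true) (hw' : w (e * p) = false) :
    ∃ δ, ((Θ.univProg e).sys w).Reach (fun c => c.1 ≠ (1, 0, 0, 0)) δ
      ((0, 0, 0, 0), fun _ => false) ((2, p, 0, 0), copyTape e w 0) := by
  rw [copyTape_zero]
  have e1 : ((Θ.univProg e).sys w).Reach (fun c => c.1 ≠ (1, 0, 0, 0)) p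
      ((4, 0, 2, 0), fun _ => false) ((4, p, 2, 0), fun _ => false) :=
    .chain (fun j => ((4, j, 2, 0), fun _ => false)) p (by simp) fun j hj => Θ.univ_count (hw j hj)
  exact ⟨_, ((Sys.Reach.step (by simp) Θ.univ_start).trans e1).trans
    (.step (by simp) (Θ.univ_count_copy hw'))⟩

theorem univ_copy_step (he : e = 1 ∨ e = 2) {p i : ℕ}
    (hi : i % e = 0 → w i = decide (i < e * p)) :
    ((Θ.univProg e).sys w).next ((2, p, i, 0), copyTape e w i) =
      ((2, p, i + 1, 0), copyTape e w (i + 1)) := by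
  by_cases h : i % e = 0
  · rw [Θ.univ_check h (hi h), copyTape_check h]
  · rw [Θ.univ_copy h, copyTape_copy he h]

theorem decide_mul_lt {e : ℕ} (he : e = 1 ∨ e = 2) (i p : ℕ) :
    decide (e * i < e * p) = decide (i < p) :=
  decide_eq_decide.2 (Nat.mul_lt_mul_left (by omega))

theorem univ_slower (he : e = 1 ∨ e = 2) {p : ℕ} (hw : ∀ i, w (e * i) = decide (i < p)) :
    Sys.Slower (prog p).toHM.sys (fun c => c.1 = (prog p).halt)
      (((prog p).start, 0), HM.inputTape 0 (passedInput e w)) ((Θ.univProg e).sys w)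
      (· = (1, 0, 0, 0)) ((0, 0, 0, 0), fun _ => false) := by
  have hw1 : ∀ i < p, w (e * i) = true := fun i hi => by simp [hw, hi]
  have hw2 : w (e * p) = false := by simp [hw]
  set B := (Θ.univProg e).sys w with hB
  set T : Fin 5 × ℕ → Bool := fun y => decide (∃ n, y = (0, Nat.pair 0 n) ∧
    (2 * n + 1) % e ≠ 0 ∧ w (2 * n + 1) = true) with hT
  have hT3 : ∀ t : Fin 5, t ≠ 0 → ∀ n, T (t, n) = false := fun t ht n => by simp [hT, ht]
  let Good : Ctl × (Fin 5 × ℕ → Bool) → Prop := fun c => c.1 ≠ (1, 0, 0, 0)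
  obtain ⟨δ, e1⟩ := Θ.univ_reach_copy hw1 hw2
  have e2 : B.Reach Good Ordinal.omega0 ((2, p, 0, 0), copyTape e w 0) ((0, 0, 0, 1), T) := by
    refine .omega (fun i => ((2, p, i, 0), copyTape e w i)) T (by simp [Good]) (fun i => ?_)
      fun y => ⟨2 * y.2.unpair.2 + 2, fun i hi => ?_⟩
    · refine Θ.univ_copy_step he fun hi => ?_
      obtain ⟨j, rfl⟩ := Nat.dvd_of_mod_eq_zero hi
      rw [hw, decide_mul_lt he]
    · refine decide_eq_decide.2 (exists_congr fun n => and_congr_right fun h0 =>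
        ⟨fun h => h.2, fun h => ⟨?_, h⟩⟩)
      rw [h0] at hi
      simp only [Nat.unpair_pair] at hi
      omega
  have e3 : B.Reach Good 1 ((0, 0, 0, 1), T) ((4, 0, 0, 0), T) := by
    refine .step (by simp [Good]) ((Θ.univ_lim (hT3 3 (by simp) 0)).trans ?_)
    rw [hT3 4 (by simp) 0, if_neg (by simp), ← hT3 4 (by simp) 0, Function.update_eq_self]
  have e4 : B.Reach Good p ((4, 0, 0, 0), T) ((4, p, 0, 0), T) :=
    .chain (fun j => ((4, j, 0, 0), T)) p (by simp [Good]) fun j hj => Θ.univ_count (hw1 j hj)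
  have e5 : B.Reach Good 1 ((4, p, 0, 0), T) ((5, p, 0, 0), T) :=
    .step (by simp [Good]) (Θ.univ_count_end hw2 (by simp))
  have e6 : B.Reach Good 1 ((5, p, 0, 0), T) ((6, p, (prog p).start, 0),
      Function.update T (4, 0) true) :=
    .step (by simp [Good]) (by rw [hB, univ_restore, if_pos rfl, Θ.st_eq])
  have er := ((((e1.trans e2).trans e3).trans e4).trans e5).trans e6
  refine (Θ.univ_simulation e p w hw1 hw2 (fun _ => false) rfl).slower (by
    rw [er.1]
    refine ⟨rfl, fun x => ?_, fun y hy hy' => ?_, by simp⟩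
    · simp only
      rw [Function.update_of_ne (rowCell_ne _ _ (by decide) _).symm]
      obtain ⟨i, n⟩ := x
      by_cases hi : i = 0
      · subst hi
        simp only [HM.inputTape, if_true, passedInput, hT]
        refine decide_eq_decide.2 ⟨?_, fun h => ⟨n, rfl, h⟩⟩
        rintro ⟨m, h1, h2⟩
        obtain rfl : n = m := by simpa [rowCell] using h1
        exact h2
      · rw [HM.inputTape, if_neg hi]
        exact hT3 _ (fun h => hi (Fin.ext (congrArg (fun t : Fin 5 => t.val) h :))) _
    · simp only
      rw [Function.update_of_ne hy', hT]
      refine decide_eq_false ?_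
      rintro ⟨n, h1, -⟩
      exact hy (0, n) h1) er.2 ?_
  rintro ⟨⟨q, h⟩, U⟩ ⟨b1, b2⟩ ⟨rfl, -, -, -⟩ hq
  simp only at hq
  refine ⟨((1, 0, 0, 0), b2), rfl, .single ⟨by simp, ?_⟩⟩
  rw [hq, ← Θ.ha_eq]
  exact Θ.univ_sim_halt

theorem univ_not_halts (he : e = 1 ∨ e = 2) (hw : ¬ ∃ p, ∀ i, w (e * i) = decide (i < p))
    (α : Ordinal) : (((Θ.univProg e).sys w).run ((0, 0, 0, 0), fun _ => false) α).1 ≠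
      (1, 0, 0, 0) := by
  by_cases h0 : ∃ p, w (e * p) = false
  · set p := Nat.find h0
    have hp : w (e * p) = false := Nat.find_spec h0
    have hp' : ∀ i < p, w (e * i) = true := fun i hi => by simpa using Nat.find_min h0 hi
    have h1 : ∃ i, i % e = 0 ∧ w i ≠ decide (i < e * p) := by
      by_contra! h
      exact hw ⟨p, fun i => by rw [h _ (Nat.mul_mod_right e i), decide_mul_lt he]⟩
    set i := Nat.find h1
    have hi : i % e = 0 ∧ w i ≠ decide (i < e * p) := Nat.find_spec h1
    have hi' : ∀ j < i, j % e = 0 → w j = decide (j < e * p) := fun j hj hj' => by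
      by_contra h
      exact Nat.find_min h1 hj ⟨hj', h⟩
    obtain ⟨δ, e1⟩ := Θ.univ_reach_copy hp' hp
    have e2 := Sys.Reach.chain (B := (Θ.univProg e).sys w) (Good := fun c => c.1 ≠ (1, 0, 0, 0))
      (fun j => ((2, p, j, 0), copyTape e w j)) i (by simp)
      fun j hj => Θ.univ_copy_step he (hi' j hj)
    have e3 := (e1.trans e2).trans (.step (by simp) (Θ.univ_check_dead hi.1 hi.2))
    have e4 := e3.trans (.step (by simp) Θ.univ_dead)
    rcases lt_or_ge α (δ + i + 1 + 1) with hα | hα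
    · exact e4.2 α hα
    · obtain ⟨β, rfl⟩ := exists_add_of_le hα
      rw [Sys.run_add, e4.1]
      have key := Sys.run_invariant (B := (Θ.univProg e).sys w)
        (b := ((3, 0, 0, 0), Function.update (copyTape e w i) (3, 0) true))
        (Inv := fun c => (c.1 = (3, 0, 0, 0) ∨ c.1 = (0, 0, 0, 1)) ∧ c.2 (3, 0) = true)
        (by simp) (by
          rintro ⟨s, T⟩ ⟨rfl | rfl, h3⟩
          · rw [univ_dead]; simp
          · rw [Θ.univ_lim_dead h3]; exact ⟨.inl rfl, h3⟩)
        (fun γ hγ h => ⟨.inr (Sys.run_limit_fst _ _ hγ), Sys.run_limit_const _ _ hγ hγ.bot_lt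
          fun ξ _ hξ => (h ξ hξ).2⟩) β
      rcases key.1 with h | h <;> simp [h]
  · have h1 : ∀ i, w (e * i) = true := fun i => by
      by_contra h
      exact h0 ⟨i, by simpa using h⟩
    have key := Sys.run_invariant (B := (Θ.univProg e).sys w) (b := ((0, 0, 0, 0), fun _ => false))
      (Inv := fun c => (c.1 = (0, 0, 0, 0) ∨ c.1 = (0, 0, 0, 1) ∨ ∃ j f, c.1 = (4, j, f, 0)) ∧
        ∀ y, c.2 y = false)
      (by simp) (by
        rintro ⟨s, T⟩ ⟨rfl | rfl | ⟨j, f, rfl⟩, hT⟩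
        · rw [univ_start]; exact ⟨by simp, hT⟩
        · rw [Θ.univ_lim (hT _), Function.update_eq_self_iff.2 (hT (4, 0)).symm]
          exact ⟨by simp, hT⟩
        · rw [Θ.univ_count (h1 j)]; exact ⟨by simp, hT⟩)
      (fun γ hγ h => ⟨.inr (.inl (Sys.run_limit_fst _ _ hγ)), fun y =>
        Sys.run_limit_const _ _ hγ hγ.bot_lt fun ξ _ hξ => (h ξ hξ).2 y⟩) α
    rcases key.1 with h | h | ⟨j, f, h⟩ <;> simp [h]

end Tables

/-- The universal sets are semi-decidable. -/
theorem exists_universal {e : ℕ} (he : e = 1 ∨ e = 2) : ∃ M : Machine, ∀ w, M.halts w ↔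
    ∃ p, (∀ i, w (e * i) = decide (i < p)) ∧ (prog p).halts (passedInput e w) := by
  obtain ⟨Θ⟩ := nonempty_tables
  obtain ⟨M, hM⟩ := (Θ.univProg_effective e).exists_machine (0, 0, 0, 0) (1, 0, 0, 0)
    Ctl.encode_start Ctl.encode_lim (by simp) (by simp [Tables.univProg])
  refine ⟨M, fun w => ?_⟩
  rw [Machine.halts_iff_run, ← (hM w).exists_iff]
  by_cases hw : ∃ p, ∀ i, w (e * i) = decide (i < p)
  · obtain ⟨p, hp⟩ := hw
    rw [← (Θ.univ_slower he hp).exists_iff, ← Machine.halts_iff_run]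
    refine ⟨fun h => ⟨p, hp, h⟩, fun ⟨p', hp', h⟩ => ?_⟩
    have hpp : ∀ i, i < p ↔ i < p' := fun i => by simpa using (hp i).symm.trans (hp' i)
    obtain rfl : p = p' := le_antisymm (le_of_forall_lt fun i hi => (hpp i).1 hi)
      (le_of_forall_lt fun i hi => (hpp i).2 hi)
    exact h
  · exact iff_of_false (fun ⟨α, hα⟩ => Θ.univ_not_halts he hw α hα)
      fun ⟨p, hp, _⟩ => hw ⟨p, hp⟩

theorem ittmSemiDecidable_haltSet : ITTMSemiDecidable haltSet := by
  obtain ⟨M, hM⟩ := exists_universal (e := 1) (.inl rfl)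
  refine ⟨M, Set.ext fun w => ?_⟩
  have hpass : passedInput 1 w = zeroR := by
    funext n; simp [passedInput, zeroR, Nat.mod_one]
  rw [Set.mem_ofPred_eq, hM, hpass]
  refine exists_congr fun p => and_congr_left fun _ => ?_
  simp [natR, funext_iff]

theorem ittmSemiDecidable_HaltSet : ITTMSemiDecidable HaltSet := by
  obtain ⟨M, hM⟩ := exists_universal (e := 2) (.inr rfl)
  refine ⟨M, Set.ext fun w => ?_⟩
  rw [Set.mem_ofPred_eq, hM]
  refine exists_congr fun p => ⟨?_, ?_⟩
  · rintro ⟨x, rfl, h⟩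
    have hpass : passedInput 2 (pairR (natR p) x) = x := by
      funext n
      have h1 : (2 * n + 1) % 2 = 1 := by omega
      have h2 : (2 * n + 1) / 2 = n := by omega
      simp [passedInput, pairR, h1, h2]
    rw [hpass]
    exact ⟨fun i => by simp [pairR, natR], h⟩
  · rintro ⟨h1, h2⟩
    refine ⟨_, funext fun n => ?_, h2⟩
    rcases Nat.even_or_odd' n with ⟨m, rfl | rfl⟩
    · simp [pairR, natR, h1]
    · have h3 : (2 * m + 1) % 2 = 1 := by omega
      have h4 : (2 * m + 1) / 2 = m := by omega
      simp [pairR, passedInput, h3, h4]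

/-- The program simulated in task `k`: program `m` in even tasks, program `k / 2` in odd ones. -/
def taskProg (m k : ℕ) : ℕ := if k % 2 = 0 then m else k / 2

theorem primrec_taskProg (m : ℕ) : Primrec (taskProg m) :=
  Primrec.ite (Primrec.eq.comp (Primrec.nat_mod.comp Primrec.id (Primrec.const 2))
    (Primrec.const 0)) (Primrec.const m) (Primrec.nat_div.comp Primrec.id (Primrec.const 2))

namespace Tables

variable (Θ : Tables)

/-- One step of the diagonal program. Task `2 * p` runs program `m` on the code of `p`, in row
`2 * p`; if the output is nonzero, task `2 * p + 1` runs program `p` on the zero input. Track 3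
marks the finished tasks, and track 4, in cell 0, marks that the program has not yet passed through
all tasks. -/
def diagStep (m : ℕ) (s : Ctl) (c : Fin 5 → Bool) : Ctl × (Fin 5 → Bool) :=
  if s.1 = 0 then
    if s.2.2.2 = 0 then ((7, 0, 0, 0), Function.update c 4 true)
    else if c 4 = true then ((4, 0, 0, 0), Function.update c 4 false)
    else ((1, 0, 0, 0), c)
  else if s.1 = 4 then
    if c 3 = true then ((4, s.2.1 + 1, 0, 0), c) else ((5, s.2.1, 0, 0), c)
  else if s.1 = 5 then ((6, s.2.1, Θ.li (taskProg m s.2.1), 0), Function.update c 4 true)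
  else if s.1 = 6 then
    if s.2.2.1 = Θ.ha (taskProg m s.2.1) then ((8, s.2.1, 0, 0), c)
    else Θ.simStep s.2.1 (taskProg m s.2.1) s.2.2.1 s.2.2.2 c
  else if s.1 = 7 then
    if s.2.1 % 2 = 0 then ((9, s.2.1, 0, 0), c)
    else if c 2 = true then ((6, s.2.1, Θ.st (taskProg m s.2.1), 0), c)
    else ((8, s.2.1, 0, 0), c)
  else if s.1 = 8 then ((7, s.2.1 + 1, 0, 0), Function.update c 3 true)
  else if s.1 = 9 then
    if s.2.2.1 < s.2.1 / 2 then ((9, s.2.1, s.2.2.1 + 1, 0), Function.update c 0 true)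
    else ((6, s.2.1, Θ.st (taskProg m s.2.1), 0), c)
  else (s, c)

theorem primrec_diagStep (m : ℕ) : Primrec fun v : Ctl × Bool × (Fin 5 → Bool) =>
    Θ.diagStep m v.1 v.2.2 := by
  have s0 : Primrec fun v : Ctl × Bool × (Fin 5 → Bool) => v.1.1 := Primrec.fst.comp Primrec.fst
  have s' : Primrec fun v : Ctl × Bool × (Fin 5 → Bool) => v.1.2 := Primrec.snd.comp Primrec.fst
  have s1 : Primrec fun v : Ctl × Bool × (Fin 5 → Bool) => v.1.2.1 := Primrec.fst.comp s'
  have s2 : Primrec fun v : Ctl × Bool × (Fin 5 → Bool) => v.1.2.2.1 :=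
    Primrec.fst.comp (Primrec.snd.comp s')
  have s3 : Primrec fun v : Ctl × Bool × (Fin 5 → Bool) => v.1.2.2.2 :=
    Primrec.snd.comp (Primrec.snd.comp s')
  have hc : Primrec fun v : Ctl × Bool × (Fin 5 → Bool) => v.2.2 := Primrec.snd.comp Primrec.snd
  have bit (i : Fin 5) : PrimrecPred fun v : Ctl × Bool × (Fin 5 → Bool) => v.2.2 i = true :=
    Primrec.eq.comp ((Primrec.dom_finite fun c : Fin 5 → Bool => c i).comp hc) (Primrec.const true)
  have tag (n : ℕ) : PrimrecPred fun v : Ctl × Bool × (Fin 5 → Bool) => v.1.1 = n :=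
    Primrec.eq.comp s0 (Primrec.const n)
  have zro {f : Ctl × Bool × (Fin 5 → Bool) → ℕ} (hf : Primrec f) :
      PrimrecPred fun v => f v = 0 := Primrec.eq.comp hf (Primrec.const 0)
  have up (i : Fin 5) (x : Bool) : Primrec fun v : Ctl × Bool × (Fin 5 → Bool) =>
      (Function.update v.2.2 i x : Fin 5 → Bool) :=
    ((primrec_update i).comp (hc.pair (Primrec.const x))).of_eq fun _ => rfl
  have k0 := Primrec.const (α := Ctl × Bool × (Fin 5 → Bool)) (0 : ℕ)
  have tp := (primrec_taskProg m).comp s1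
  have begun := (Primrec.const 6).pair (s1.pair ((Θ.primrec_st.comp tp).pair k0))
  have finish := ((Primrec.const 8).pair (s1.pair (k0.pair k0))).pair hc
  have h9 := Primrec.ite (tag 9) (Primrec.ite (Primrec.nat_lt.comp s2
    (Primrec.nat_div.comp s1 (Primrec.const 2)))
    (((Primrec.const 9).pair (s1.pair ((Primrec.succ.comp s2).pair k0))).pair (up 0 true))
    (begun.pair hc)) (Primrec.fst.pair hc)
  have h8 := Primrec.ite (tag 8) (((Primrec.const 7).pair
    ((Primrec.succ.comp s1).pair (k0.pair k0))).pair (up 3 true)) h9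
  have h7 := Primrec.ite (tag 7) (Primrec.ite (zro (Primrec.nat_mod.comp s1 (Primrec.const 2)))
    (((Primrec.const 9).pair (s1.pair (k0.pair k0))).pair hc)
    (Primrec.ite (bit 2) (begun.pair hc) finish)) h8
  have h6 := Primrec.ite (tag 6) (Primrec.ite (Primrec.eq.comp s2 (Θ.primrec_ha.comp tp))
    finish (Θ.primrec_simStep.comp (s1.pair (tp.pair (s2.pair (s3.pair hc)))))) h7
  have h5 := Primrec.ite (tag 5) (((Primrec.const 6).pair (s1.pair
    ((Θ.primrec_li.comp tp).pair k0))).pair (up 4 true)) h6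
  have h4 := Primrec.ite (tag 4) (Primrec.ite (bit 3)
    (((Primrec.const 4).pair ((Primrec.succ.comp s1).pair (k0.pair k0))).pair hc)
    (((Primrec.const 5).pair (s1.pair (k0.pair k0))).pair hc)) h5
  have h0 := Primrec.ite (tag 0) (Primrec.ite (zro s3)
    ((Primrec.const ((7, 0, 0, 0) : Ctl)).pair (up 4 true))
    (Primrec.ite (bit 4) ((Primrec.const ((4, 0, 0, 0) : Ctl)).pair (up 4 false))
      ((Primrec.const ((1, 0, 0, 0) : Ctl)).pair hc))) h4
  exact h0.of_eq fun _ => rfl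

/-- The diagonal program: it halts, but only after every program that halts on the zero input has
been run, provided that program `m` decides this halting problem, where the number `p` is passed to
program `m` in unary in the bits whose index is a multiple of `e`. -/
def diagProg (e m : ℕ) : Prog 5 Ctl where
  addr s := if s.1 = 6 then Nat.pair s.2.1 s.2.2.2 else if s.1 = 7 then Nat.pair (s.2.1 - 1) 0 else
    if s.1 = 9 then Nat.pair s.2.1 (e * s.2.2.1) else if s.1 = 5 then 0 else s.2.1
  iaddr _ := 0
  next s _ c := (Θ.diagStep m s c).1
  out s _ c := (Θ.diagStep m s c).2
  lim := (0, 0, 0, 1)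

theorem diagProg_effective (e m : ℕ) : (Θ.diagProg e m).Effective where
  addr := by
    have s1 : Primrec fun s : Ctl => s.2.1 := Primrec.fst.comp Primrec.snd
    have s2 : Primrec fun s : Ctl => s.2.2.1 := Primrec.fst.comp (Primrec.snd.comp Primrec.snd)
    have s3 : Primrec fun s : Ctl => s.2.2.2 := Primrec.snd.comp (Primrec.snd.comp Primrec.snd)
    have tag (n : ℕ) : PrimrecPred fun s : Ctl => s.1 = n :=
      Primrec.eq.comp Primrec.fst (Primrec.const n)
    have h := Primrec.ite (tag 6) (Primrec₂.natPair.comp s1 s3) (Primrec.ite (tag 7)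
      (Primrec₂.natPair.comp (Primrec.pred.comp s1) (Primrec.const 0)) (Primrec.ite (tag 9)
        (Primrec₂.natPair.comp s1 (Primrec.nat_mul.comp (Primrec.const e) s2))
        (Primrec.ite (tag 5) (Primrec.const 0) s1)))
    exact h.of_eq fun _ => rfl
  iaddr := Primrec.const 0
  next := Primrec.fst.comp (Θ.primrec_diagStep m)
  out := Primrec.snd.comp (Θ.primrec_diagStep m)

section Steps

variable {Θ} {e m : ℕ} {w : R} {T : Fin 5 × ℕ → Bool}

theorem diag_start : ((Θ.diagProg e m).sys w).next ((0, 0, 0, 0), T) =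
    ((7, 0, 0, 0), Function.update T (4, 0) true) :=
  Prog.sys_next_update rfl rfl rfl rfl

theorem diag_lim (h : T (4, 0) = true) : ((Θ.diagProg e m).sys w).next ((0, 0, 0, 1), T) =
    ((4, 0, 0, 0), Function.update T (4, 0) false) := by
  refine Prog.sys_next_update (a := 0) rfl rfl ?_ ?_ <;> simp [diagProg, diagStep, h]

theorem diag_lim_halt (h : T (4, 0) = false) :
    ((Θ.diagProg e m).sys w).next ((0, 0, 0, 1), T) = ((1, 0, 0, 0), T) := by
  refine Prog.sys_next_same (a := 0) rfl rfl ?_ ?_ <;> simp [diagProg, diagStep, h]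

theorem diag_count {k : ℕ} (h : T (3, k) = true) :
    ((Θ.diagProg e m).sys w).next ((4, k, 0, 0), T) = ((4, k + 1, 0, 0), T) := by
  refine Prog.sys_next_same (a := k) rfl rfl ?_ ?_ <;> simp [diagProg, diagStep, h]

theorem diag_count_end {k : ℕ} (h : T (3, k) = false) :
    ((Θ.diagProg e m).sys w).next ((4, k, 0, 0), T) = ((5, k, 0, 0), T) := by
  refine Prog.sys_next_same (a := k) rfl rfl ?_ ?_ <;> simp [diagProg, diagStep, h]

theorem diag_restore {k : ℕ} : ((Θ.diagProg e m).sys w).next ((5, k, 0, 0), T) =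
    ((6, k, Θ.li (taskProg m k), 0), Function.update T (4, 0) true) :=
  Prog.sys_next_update (a := 0) rfl rfl rfl rfl

theorem diag_sim_halt {k h : ℕ} : ((Θ.diagProg e m).sys w).next
    ((6, k, Θ.ha (taskProg m k), h), T) = ((8, k, 0, 0), T) := by
  refine Prog.sys_next_same (a := Nat.pair k h) rfl rfl ?_ ?_ <;> simp [diagProg, diagStep]

theorem diag_sim {k h p : ℕ} (hp : taskProg m k = p) (q : Fin ((prog p).Q + 1))
    (hq : q ≠ (prog p).halt) :
    ((Θ.diagProg e m).sys w).next ((6, k, q, h), T) =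
      ((6, k, (((prog p).trans (q, fun i => T (rowCell k (i, h)))).1 : ℕ),
        if ((prog p).trans (q, fun i => T (rowCell k (i, h)))).2.2 then h + 1 else h - 1),
        fun y => if y.2 = Nat.pair k h then mergeBits (fun t => T (t, Nat.pair k h))
          ((prog p).trans (q, fun i => T (rowCell k (i, h)))).2.1 y.1 else T y) := by
  have hq' : (q : ℕ) ≠ Θ.ha p := by rwa [Θ.ha_eq, Ne, ← Fin.ext_iff]
  have hstep : ∀ c, Θ.diagStep m (6, k, q, h) c = Θ.simStep k p q h c := by
    intro c
    simp [diagStep, hp, hq']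
  have haddr : (Θ.diagProg e m).addr (6, k, q, h) = Nat.pair k h := rfl
  have hbits : simBits (fun t => T (t, Nat.pair k h)) = fun i => T (rowCell k (i, h)) := rfl
  simp only [Prog.sys, haddr]
  simp only [diagProg, hstep, simStep_eq, hbits]

theorem diag_begin_even {k : ℕ} (hk : k % 2 = 0) :
    ((Θ.diagProg e m).sys w).next ((7, k, 0, 0), T) = ((9, k, 0, 0), T) := by
  refine Prog.sys_next_same (a := Nat.pair (k - 1) 0) rfl rfl ?_ ?_ <;>
    simp [diagProg, diagStep, hk]

theorem diag_begin_run {k : ℕ} (hk : k % 2 ≠ 0) (h : T (2, Nat.pair (k - 1) 0) = true) :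
    ((Θ.diagProg e m).sys w).next ((7, k, 0, 0), T) = ((6, k, Θ.st (taskProg m k), 0), T) := by
  refine Prog.sys_next_same (a := Nat.pair (k - 1) 0) rfl rfl ?_ ?_ <;>
    simp [diagProg, diagStep, hk, h]

theorem diag_begin_skip {k : ℕ} (hk : k % 2 ≠ 0) (h : T (2, Nat.pair (k - 1) 0) = false) :
    ((Θ.diagProg e m).sys w).next ((7, k, 0, 0), T) = ((8, k, 0, 0), T) := by
  refine Prog.sys_next_same (a := Nat.pair (k - 1) 0) rfl rfl ?_ ?_ <;>
    simp [diagProg, diagStep, hk, h]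

theorem diag_finish {k : ℕ} : ((Θ.diagProg e m).sys w).next ((8, k, 0, 0), T) =
    ((7, k + 1, 0, 0), Function.update T (3, k) true) :=
  Prog.sys_next_update (a := k) rfl rfl rfl rfl

theorem diag_input {k i : ℕ} (hi : i < k / 2) :
    ((Θ.diagProg e m).sys w).next ((9, k, i, 0), T) =
      ((9, k, i + 1, 0), Function.update T (0, Nat.pair k (e * i)) true) := by
  refine Prog.sys_next_update (a := Nat.pair k (e * i)) rfl rfl ?_ ?_ <;>
    simp [diagProg, diagStep, hi]

theorem diag_input_end {k i : ℕ} (hi : ¬ i < k / 2) :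
    ((Θ.diagProg e m).sys w).next ((9, k, i, 0), T) = ((6, k, Θ.st (taskProg m k), 0), T) := by
  refine Prog.sys_next_same (a := Nat.pair k (e * i)) rfl rfl ?_ ?_ <;>
    simp only [diagProg, diagStep] <;> simp [hi]

/-- The simulation carried out in task `k`. -/
theorem diag_simulation (e m k : ℕ) (w : R) (v : Fin 5 × ℕ → Bool)
    (hv : ∀ j, v (3, j) = decide (j < k)) :
    Sys.Simulation (prog (taskProg m k)).toHM.sys ((Θ.diagProg e m).sys w)
      (fun c => c.1 = (prog (taskProg m k)).halt) (· = (1, 0, 0, 0))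
      (RowRel (prog (taskProg m k)) k (fun q h => (6, k, q, h)) v) (rowCell k)
      {y | (∀ x, y ≠ rowCell k x) ∧ y ≠ (4, 0)} v {(4, 0)} := by
  refine row_simulation _ _ (prog (taskProg m k)) k _ (fun j => (4, j, 0, 0)) (5, k, 0, 0) k v
    (fun q h T hq => diag_sim rfl q hq) (fun T hT hz => diag_lim hT) (fun T hz => ?_) (fun T => ?_)
    (by simp) (by simp [Prog.sys, diagProg]) (by simp) (by simp)
  · have h3 : ∀ j, T (3, j) = decide (j < k) := fun j =>
      (hz _ (fun x => rowCell_ne _ _ (by decide) _) (by simp)).trans (hv j)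
    exact ⟨fun j hj => diag_count (by simp [h3, hj]), diag_count_end (by simp [h3])⟩
  · rw [diag_restore, Θ.li_eq]

end Steps
end Tables

theorem Machine.outputs_iff_run (M : Machine) (x y : R) : M.outputs x y ↔
    ∃ α, M.toHM.sys.FirstHit (fun s => s.1 = M.halt) ((M.start, 0), HM.inputTape 0 x) α ∧
      ∀ n, (M.toHM.sys.run ((M.start, 0), HM.inputTape 0 x) α).2 (2, n) = y n := by
  refine exists_congr fun α => and_congr ?_ ?_
  · exact and_congr (M.haltedAt_iff x α) (forall₂_congr fun β _ => not_congr (M.haltedAt_iff x β))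
  · rw [← M.snap_eq_run, funext_iff]

/-- The number `p`, in unary, in the bits whose index is a multiple of `e`. -/
def spread (e p : ℕ) : R := fun n => decide (n % e = 0 ∧ n / e < p)

theorem rowCell_inj {r r' : ℕ} {x x' : Fin 3 × ℕ} (h : rowCell r x = rowCell r' x') :
    r = r' ∧ x = x' := by
  obtain ⟨i, n⟩ := x
  obtain ⟨i', n'⟩ := x'
  have h1 : i = i' := Fin.ext (congrArg (fun y : Fin 5 × ℕ => y.1.val) h :)
  have h2 := Nat.pair_eq_pair.1 (congrArg Prod.snd h :)
  exact ⟨h2.1, Prod.ext h1 h2.2⟩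

/-- The configurations of the diagonal program in which task `k` is about to begin. -/
structure TaskStart (k : ℕ) (b : Ctl × (Fin 5 × ℕ → Bool)) : Prop where
  state : b.1 = (7, k, 0, 0)
  flag : b.2 (4, 0) = true
  done : ∀ j, b.2 (3, j) = decide (j < k)
  blank : ∀ r, k ≤ r → ∀ x, b.2 (rowCell r x) = false
  verdict : k % 2 ≠ 0 → b.2 (2, Nat.pair (k - 1) 0) = decide ((prog (k / 2)).halts zeroR)

theorem TaskStart.of_finish {k : ℕ} {b : Ctl × (Fin 5 × ℕ → Bool)} {T : Fin 5 × ℕ → Bool}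
    (hb : TaskStart k b) (hT : ∀ y, (∀ x, y ≠ rowCell k x) → T y = b.2 y)
    (hv : (k + 1) % 2 ≠ 0 → T (2, Nat.pair k 0) = decide ((prog ((k + 1) / 2)).halts zeroR)) :
    TaskStart (k + 1) ((7, k + 1, 0, 0), Function.update T (3, k) true) where
  state := rfl
  flag := by
    simp only
    rw [Function.update_of_ne (by simp), hT _ fun x => rowCell_ne _ _ (by decide) _]
    exact hb.flag
  done j := by
    by_cases hj : j = k
    · subst hj; simp
    · simp only
      rw [Function.update_of_ne (by simpa using hj), hT _ fun x => rowCell_ne _ _ (by decide) _,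
        hb.done, decide_eq_decide]
      omega
  blank r hr x := by
    simp only
    rw [Function.update_of_ne (rowCell_ne _ _ (by decide) _).symm, hT, hb.blank r (by omega)]
    intro x' h
    have := (rowCell_inj h).1
    omega
  verdict hk := by
    simp only
    rw [Function.update_of_ne (by simp)]
    exact hv hk

namespace Tables

variable {Θ : Tables} {e m : ℕ} {w : R}

theorem diag_run {k p : ℕ} {T : Fin 5 × ℕ → Bool} {x : R} {α : Ordinal.{0}}
    (hp : taskProg m k = p) (h4 : T (4, 0) = true) (h3 : ∀ j, T (3, j) = decide (j < k))
    (hT : ∀ y, T (rowCell k y) = HM.inputTape 0 x y)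
    (hα : (prog p).toHM.sys.FirstHit (fun s => s.1 = (prog p).halt)
      (((prog p).start, 0), HM.inputTape 0 x) α) :
    ∃ δ T', α ≤ δ ∧ ((Θ.diagProg e m).sys w).Reach (fun d => d.1 ≠ (1, 0, 0, 0)) δ
      ((6, k, Θ.st (taskProg m k), 0), T) ((7, k + 1, 0, 0), Function.update T' (3, k) true) ∧
      (∀ y, T' (rowCell k y) =
        ((prog p).toHM.sys.run (((prog p).start, 0), HM.inputTape 0 x) α).2 y) ∧
      ∀ y, (∀ x, y ≠ rowCell k x) → T' y = T y := by
  subst hp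
  obtain ⟨f, hf, hrun⟩ := (diag_simulation (Θ := Θ) e m k w T h3).exists_clock
    (a := (((prog (taskProg m k)).start, 0), HM.inputTape 0 x))
    (b := ((6, k, Θ.st (taskProg m k), 0), T)) ⟨by rw [Θ.st_eq], hT, fun _ _ _ => rfl, h4⟩
  obtain ⟨hrel, hgood⟩ := hrun α hα.2
  obtain ⟨r1, r2, r3, r4⟩ := hrel
  set b := ((Θ.diagProg e m).sys w).run ((6, k, Θ.st (taskProg m k), 0), T) (f α) with hb
  have hst : b = ((6, k, Θ.ha (taskProg m k),
      ((prog (taskProg m k)).toHM.sys.run (((prog (taskProg m k)).start, 0),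
        HM.inputTape 0 x) α).1.2), b.2) := by
    refine Prod.ext ?_ rfl
    rw [r1, Θ.ha_eq, hα.1]
  have e1 : ((Θ.diagProg e m).sys w).Reach (fun d => d.1 ≠ (1, 0, 0, 0)) (f α)
      ((6, k, Θ.st (taskProg m k), 0), T) _ := ⟨hb.symm.trans hst, hgood⟩
  have e2 := (e1.trans (.step (by simp) diag_sim_halt)).trans (.step (by simp) diag_finish)
  refine ⟨_, b.2, ?_, e2, r2, fun y hy => ?_⟩
  · exact hf.le_apply.trans (le_self_add.trans le_self_add)
  · by_cases hy4 : y = (4, 0)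
    · rw [hy4, r4, h4]
    · exact r3 y hy hy4

/-- Carrying out task `k`, given that program `m` decides the halting problem. -/
theorem exists_taskStart_succ (he : 0 < e) (hm : ∀ p, (prog m).outputs (spread e p)
      (if (prog p).halts zeroR then oneR else zeroR)) {k : ℕ} {b : Ctl × (Fin 5 × ℕ → Bool)}
    (hb : TaskStart k b) :
    ∃ δ b', 0 < δ ∧ ((Θ.diagProg e m).sys w).Reach (fun d => d.1 ≠ (1, 0, 0, 0)) δ b b' ∧
      TaskStart (k + 1) b' ∧ (k % 2 ≠ 0 → ∀ α, (prog (k / 2)).toHM.sys.FirstHit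
        (fun s => s.1 = (prog (k / 2)).halt)
        (((prog (k / 2)).start, 0), HM.inputTape 0 zeroR) α → α ≤ δ) := by
  obtain ⟨s, T⟩ := b
  obtain rfl : s = (7, k, 0, 0) := hb.state
  by_cases hk : k % 2 = 0
  · obtain ⟨α, hα, hout⟩ := ((prog m).outputs_iff_run _ _).1 (hm (k / 2))
    let U (i : ℕ) : Fin 5 × ℕ → Bool := fun y =>
      if ∃ j < i, y = (0, Nat.pair k (e * j)) then true else T y
    have hU (y : Fin 5 × ℕ) (hy : ∀ x, y ≠ rowCell k x) (i : ℕ) : U i y = T y := by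
      refine if_neg ?_
      rintro ⟨j, -, h⟩
      exact hy (0, e * j) h
    have e1 : ((Θ.diagProg e m).sys w).Reach (fun d => d.1 ≠ (1, 0, 0, 0)) 1
        ((7, k, 0, 0), T) ((9, k, 0, 0), U 0) := by
      refine .step (by simp) ((diag_begin_even hk).trans ?_)
      simp [U]
    have e2 : ((Θ.diagProg e m).sys w).Reach (fun d => d.1 ≠ (1, 0, 0, 0)) (k / 2 : ℕ)
        ((9, k, 0, 0), U 0) ((9, k, k / 2, 0), U (k / 2)) := by
      refine .chain (fun i => ((9, k, i, 0), U i)) _ (by simp) fun i hi => ?_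
      rw [diag_input hi]
      refine Prod.ext rfl (funext fun y => ?_)
      by_cases hy : y = (0, Nat.pair k (e * i))
      · subst hy
        simp only [Function.update_self, U]
        rw [if_pos ⟨i, by omega, rfl⟩]
      · simp only [Function.update_of_ne hy, U]
        congr 1
        refine propext (exists_congr fun j => ⟨fun h => ⟨by omega, h.2⟩, fun h => ⟨?_, h.2⟩⟩)
        refine lt_of_le_of_ne (by omega) ?_
        rintro rfl
        exact hy h.2
    have e3 : ((Θ.diagProg e m).sys w).Reach (fun d => d.1 ≠ (1, 0, 0, 0)) 1
        ((9, k, k / 2, 0), U (k / 2)) ((6, k, Θ.st (taskProg m k), 0), U (k / 2)) :=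
      .step (by simp) (diag_input_end (by simp))
    obtain ⟨δ, T', -, e4, r1, r2⟩ := diag_run (Θ := Θ) (e := e) (m := m) (w := w) (k := k) (p := m)
      (T := U (k / 2)) (x := spread e (k / 2)) (by simp [taskProg, hk])
      ((hU _ (fun x => rowCell_ne _ _ (by decide) _) _).trans hb.flag)
      (fun j => (hU _ (fun x => rowCell_ne _ _ (by decide) _) _).trans (hb.done j)) (by
        rintro ⟨i, n⟩
        have hbl : T (rowCell k (i, n)) = false := hb.blank k le_rfl _
        simp only [U, hbl, HM.inputTape]
        by_cases hi : i = 0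
        · subst hi
          simp only [if_true, spread]
          rw [Bool.if_false_right, Bool.and_true, decide_eq_decide]
          constructor
          · rintro ⟨j, hj, h⟩
            obtain rfl : n = e * j := by simpa [rowCell] using h
            exact ⟨by simp, by simpa [he] using hj⟩
          · rintro ⟨h1, h2⟩
            exact ⟨n / e, h2, by rw [Nat.mul_div_cancel' (Nat.dvd_of_mod_eq_zero h1)]; rfl⟩
        · rw [if_neg hi, if_neg]
          rintro ⟨j, -, h⟩
          exact hi (Fin.ext (congrArg (fun y : Fin 5 × ℕ => y.1.val) h :))) hα
    refine ⟨_, _, ?_, ((e1.trans e2).trans e3).trans e4, hb.of_finish (fun y hy =>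
      (r2 y hy).trans (hU y hy _)) (fun _ => ?_), fun h => absurd hk h⟩
    · exact zero_lt_one.trans_le (le_self_add.trans (le_self_add.trans le_self_add))
    · have h1 : (k + 1) / 2 = k / 2 := by omega
      have h2 := (r1 (2, 0)).trans (hout 0)
      rw [h1]
      refine h2.trans ?_
      split_ifs with h <;> simp [h, oneR, zeroR]
  · have htask : taskProg m k = k / 2 := by simp [taskProg, hk]
    by_cases hh : (prog (k / 2)).halts zeroR
    · obtain ⟨β, hβ⟩ := ((prog (k / 2)).halts_iff_run zeroR).1 hh
      obtain ⟨α, hα⟩ := Sys.exists_firstHit (A := (prog (k / 2)).toHM.sys)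
        (hA := fun s => s.1 = (prog (k / 2)).halt) hβ
      have e1 : ((Θ.diagProg e m).sys w).Reach (fun d => d.1 ≠ (1, 0, 0, 0)) 1
          ((7, k, 0, 0), T) ((6, k, Θ.st (taskProg m k), 0), T) :=
        .step (by simp) (diag_begin_run hk ((hb.verdict hk).trans (decide_eq_true hh)))
      obtain ⟨δ, T', hδ, e2, r1, r2⟩ := diag_run (Θ := Θ) (e := e) (m := m) (w := w) htask
        hb.flag hb.done (x := zeroR) (fun y => (hb.blank k le_rfl y).trans (by
          simp [HM.inputTape, zeroR])) hα
      refine ⟨_, _, ?_, e1.trans e2, hb.of_finish r2 (fun h => by omega), fun _ α' hα' => ?_⟩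
      · exact zero_lt_one.trans_le le_self_add
      · rw [hα'.unique hα]
        exact hδ.trans le_add_self
    · have e1 : ((Θ.diagProg e m).sys w).Reach (fun d => d.1 ≠ (1, 0, 0, 0)) 1
          ((7, k, 0, 0), T) ((8, k, 0, 0), T) :=
        .step (by simp) (diag_begin_skip hk ((hb.verdict hk).trans (decide_eq_false hh)))
      refine ⟨_, _, ?_, e1.trans (.step (by simp) diag_finish),
        hb.of_finish (fun _ _ => rfl) (fun h => by omega), fun _ α hα => ?_⟩
      · exact zero_lt_one.trans_le le_self_add
      · exact absurd (((prog (k / 2)).halts_iff_run zeroR).2 ⟨α, hα.1⟩) hh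

/-- The diagonal program halts, but not before any program that halts on the zero input. -/
theorem exists_diag_firstHit (he : 0 < e) (hm : ∀ p, (prog m).outputs (spread e p)
      (if (prog p).halts zeroR then oneR else zeroR)) :
    ∃ γ, ((Θ.diagProg e m).sys w).FirstHit (· = (1, 0, 0, 0)) ((0, 0, 0, 0), fun _ => false) γ ∧
      ∀ p α, (prog p).toHM.sys.FirstHit (fun s => s.1 = (prog p).halt)
        (((prog p).start, 0), HM.inputTape 0 zeroR) α → α < γ := by
  set B := (Θ.diagProg e m).sys w with hB
  set Good : Ctl × (Fin 5 × ℕ → Bool) → Prop := fun d => d.1 ≠ (1, 0, 0, 0) with hG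
  set c : Ctl × (Fin 5 × ℕ → Bool) := ((0, 0, 0, 0), fun _ => false) with hc
  have hstart : ∃ b, B.Reach Good 1 c b ∧ TaskStart 0 b := by
    refine ⟨_, .step (by simp [Good, c]) diag_start, rfl, by simp, fun j => ?_, fun r _ x => ?_,
      by simp⟩
    · simp
    · simp only
      rw [Function.update_of_ne (rowCell_ne _ _ (by decide) _).symm]
  obtain ⟨b₀, hb₀, hs₀⟩ := hstart
  choose! δ nx hδ hnx hs hlen using fun (k : ℕ) (b : Ctl × (Fin 5 × ℕ → Bool)) =>
    exists_taskStart_succ (Θ := Θ) (w := w) he hm (k := k) (b := b)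
  let b : ℕ → Ctl × (Fin 5 × ℕ → Bool) := Nat.rec b₀ nx
  let f : ℕ → Ordinal.{0} := Nat.rec 1 fun k ζ => ζ + δ k (b k)
  have hbs : ∀ k, TaskStart k (b k) := fun k => by
    induction k with
    | zero => exact hs₀
    | succ k ih => exact hs k _ ih
  have hbf : ∀ k, B.Reach Good (f k) c (b k) := fun k => by
    induction k with
    | zero => exact hb₀
    | succ k ih => exact ih.trans (hnx k _ (hbs k))
  have hf : StrictMono f := strictMono_nat_of_lt_succ fun k =>
    lt_add_of_pos_right _ (hδ k _ (hbs k))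
  set lam := ⨆ k, f k with hlam
  have hfl : ∀ k, f k < lam := fun k =>
    (hf (Nat.lt_succ_self k)).trans_le (Ordinal.le_iSup f (k + 1))
  have hcof : ∀ ξ < lam, ∀ n, ∃ k, n ≤ k ∧ ξ < f k := fun ξ hξ n => by
    obtain ⟨k, hk⟩ := Ordinal.lt_iSup_iff.1 hξ
    exact ⟨max n k, le_max_left _ _, hk.trans_le (hf.monotone (le_max_right _ _))⟩
  have hlim : IsSuccLimit lam := by
    rw [Ordinal.isSuccLimit_iff]
    refine ⟨(zero_le.trans_lt (hfl 0)).ne', isSuccPrelimit_of_succ_lt fun ξ hξ => ?_⟩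
    obtain ⟨k, -, hk⟩ := hcof ξ hξ 0
    exact (succ_le_of_lt hk).trans_lt (hfl k)
  have hon : ∀ y n, (∀ k, n ≤ k → (b k).2 y = true) → (B.run c lam).2 y = true := fun y n h => by
    rw [Sys.run_limit_snd _ _ hlim]
    intro ξ hξ
    obtain ⟨k, h1, h2⟩ := hcof ξ hξ n
    exact ⟨f k, h2.le, hfl k, by rw [(hbf k).1]; exact h k h1⟩
  have e0 : B.Reach Good lam c ((0, 0, 0, 1), (B.run c lam).2) := by
    refine ⟨Prod.ext (Sys.run_limit_fst _ _ hlim) rfl, fun ξ hξ => ?_⟩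
    obtain ⟨k, -, hk⟩ := hcof ξ hξ 0
    exact (hbf k).2 ξ hk
  set T := (B.run c lam).2 with hT
  have e1 : B.Reach Good 1 ((0, 0, 0, 1), T) ((4, 0, 0, 0), Function.update T (4, 0) false) :=
    .step (by simp [Good]) (diag_lim (hon _ 0 fun k _ => (hbs k).flag))
  have e2 : B.Reach Good Ordinal.omega0 ((4, 0, 0, 0), Function.update T (4, 0) false)
      ((0, 0, 0, 1), Function.update T (4, 0) false) := by
    refine .omega (fun k => ((4, k, 0, 0), Function.update T (4, 0) false)) _
      (by simp [Good]) (fun k => diag_count ?_) fun x => ⟨0, fun _ _ => rfl⟩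
    rw [Function.update_of_ne (by simp)]
    refine hon _ (k + 1) fun j hj => ?_
    rw [(hbs j).done, decide_eq_true_iff]
    omega
  have e3 : B.Reach Good 1 ((0, 0, 0, 1), Function.update T (4, 0) false)
      ((1, 0, 0, 0), Function.update T (4, 0) false) :=
    .step (by simp [Good]) (diag_lim_halt (by simp))
  have er := ((e0.trans e1).trans e2).trans e3
  refine ⟨_, ⟨by rw [er.1], er.2⟩, fun p α hα => ?_⟩
  have hdiv : (2 * p + 1) / 2 = p := by omega
  have hα' : α ≤ δ (2 * p + 1) (b (2 * p + 1)) := by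
    refine hlen (2 * p + 1) _ (hbs _) (by omega) α ?_
    rw [hdiv]
    exact hα
  calc α ≤ f (2 * p + 1 + 1) := hα'.trans le_add_self
    _ < lam := hfl (2 * p + 1 + 1)
    _ ≤ _ := le_self_add.trans (le_self_add.trans le_self_add)

end Tables

/-- No set that encodes the halting problem for the zero input in unary is decidable. -/
theorem not_ittmDecidable_of_spread {e : ℕ} (he : 0 < e) {A : Set R}
    (hA : ∀ p, spread e p ∈ A ↔ (prog p).halts zeroR) : ¬ ITTMDecidable A := by
  rintro ⟨D, hD⟩
  have hprog : ∀ M : Machine, prog (Encodable.encode M) = M := fun M => by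
    simp [prog]
  obtain ⟨Θ⟩ := nonempty_tables
  obtain ⟨γ, hγ, hlt⟩ := Tables.exists_diag_firstHit (Θ := Θ) (w := zeroR) (e := e)
    (m := Encodable.encode D) he (fun p => by
      rw [hprog]
      split_ifs with h
      · exact (hD _).1 ((hA p).2 h)
      · exact (hD _).2 (mt (hA p).1 h))
  obtain ⟨M, hM⟩ := (Θ.diagProg_effective e (Encodable.encode D)).exists_machine (0, 0, 0, 0)
    (1, 0, 0, 0) Ctl.encode_start Ctl.encode_lim (by simp) (by simp [Tables.diagProg])
  obtain ⟨α, hα, hα'⟩ := (hM zeroR).1 γ hγ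
  have := hlt (Encodable.encode M) α
  rw [hprog] at this
  exact absurd (this hα') (not_lt.2 hα)

theorem not_ittmDecidable_haltSet : ¬ ITTMDecidable haltSet := by
  refine not_ittmDecidable_of_spread one_pos fun p => ?_
  have hs : ∀ p, spread 1 p = natR p := fun p => funext fun n => by
    simp [spread, natR, Nat.mod_one]
  rw [hs]
  refine ⟨?_, fun h => ⟨p, rfl, h⟩⟩
  rintro ⟨p', h1, h2⟩
  have hpp : ∀ i, i < p ↔ i < p' := fun i => by simpa [natR] using congrFun h1 i
  obtain rfl : p = p' := le_antisymm (le_of_forall_lt fun i hi => (hpp i).1 hi)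
    (le_of_forall_lt fun i hi => (hpp i).2 hi)
  exact h2

theorem not_ittmDecidable_HaltSet : ¬ ITTMDecidable HaltSet := by
  refine not_ittmDecidable_of_spread two_pos fun p => ?_
  have hs : spread 2 p = pairR (natR p) zeroR := funext fun n => by
    by_cases h : n % 2 = 0 <;> simp [spread, natR, pairR, zeroR, h]
  rw [hs]
  refine ⟨?_, fun h => ⟨p, _, rfl, h⟩⟩
  rintro ⟨p', x, h1, h2⟩
  have hpp : ∀ i, i < p ↔ i < p' := fun i => by
    simpa [natR, pairR] using congrFun h1 (2 * i)
  obtain rfl : p = p' := le_antisymm (le_of_forall_lt fun i hi => (hpp i).1 hi)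
    (le_of_forall_lt fun i hi => (hpp i).2 hi)
  obtain rfl : zeroR = x := funext fun n => by
    have h3 : (2 * n + 1) % 2 = 1 := by omega
    have h4 : (2 * n + 1) / 2 = n := by omega
    simpa [pairR, h3, h4] using congrFun h1 (2 * n + 1)
  exact h2

end ITTM

/-- **Halting Problem Theorem.** The halting problems `h` and `H` are both
infinite time semi-decidable but neither is infinite time decidable. -/
theorem halting_problem_theorem :
    ITTM.ITTMSemiDecidable haltSet ∧ ITTM.ITTMSemiDecidable HaltSet ∧
    ¬ ITTM.ITTMDecidable haltSet ∧ ¬ ITTM.ITTMDecidable HaltSet := by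
  exact ⟨ITTM.ittmSemiDecidable_haltSet, ITTM.ittmSemiDecidable_HaltSet,
    ITTM.not_ittmDecidable_haltSet, ITTM.not_ittmDecidable_HaltSet⟩
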